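/- For all integers k > ℓ ≥ 2 there exists an integer t₀ such that for every integer t ≥ t₀ the following holds. Let n > (1/4)(t+1)²·C(t-1, ℓ-2) + 2t and let G be an extremal ℓ-graph on n vertices for the (t,k)-degree condition that contains no isolated copy of K_{t+1}^ℓ. Then there is at most one unordered pair {A₁, A₂} of distinct (t+1)-element vertex sets such that A₁ and A₂ are both copies of K_{t+1}^ℓ in G and A₁ ∩ A₂ ≠ ∅. -/

import Mathlib

open Finset

open scoped Classical

/-- `E` is the edge set of an `ℓ`-uniform hypergraph on vertex type `V`:
every edge is an `ℓ`-element set. -/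
def IsLGraph {V : Type*} (ℓ : ℕ) (E : Finset (Finset V)) : Prop :=
  ∀ e ∈ E, e.card = ℓ

/-- `S` is a copy of `K_k^ℓ` in the hypergraph with edge set `E`:
`S` has `k` vertices and every `ℓ`-element subset of `S` is an edge. -/
def IsCopy {V : Type*} (E : Finset (Finset V)) (ℓ k : ℕ) (S : Finset V) : Prop :=
  S.card = k ∧ ∀ e ⊆ S, e.card = ℓ → e ∈ E

/-- The number of copies of `K_k^ℓ` containing the vertex `v`. -/
noncomputable def copiesAt {V : Type*} [Fintype V] (E : Finset (Finset V)) (ℓ k : ℕ)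
    (v : V) : ℕ :=
  ((univ : Finset (Finset V)).filter fun S => v ∈ S ∧ IsCopy E ℓ k S).card

/-- The degree of a vertex: the number of edges containing it. -/
noncomputable def hdeg {V : Type*} (E : Finset (Finset V)) (v : V) : ℕ :=
  (E.filter fun e => v ∈ e).card

/-- The `(t,k)`-degree condition: every vertex is contained in at least
`C(t, k-1)` copies of `K_k^ℓ`. -/
def DegCond {V : Type*} [Fintype V] (E : Finset (Finset V)) (ℓ k t : ℕ) : Prop :=
  ∀ v : V, Nat.choose t (k - 1) ≤ copiesAt E ℓ k v

/-- `E` is extremal: it is an `ℓ`-graph satisfying the `(t,k)`-degree condition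
with the minimum number of edges among all such `ℓ`-graphs on the same vertex set. -/
def IsExtremal {V : Type*} [Fintype V] (E : Finset (Finset V)) (ℓ k t : ℕ) : Prop :=
  IsLGraph ℓ E ∧ DegCond E ℓ k t ∧
    ∀ E' : Finset (Finset V), IsLGraph ℓ E' → DegCond E' ℓ k t → E.card ≤ E'.card

/-- `A` is an isolated copy of `K_{t+1}^ℓ`: it is a copy of `K_{t+1}^ℓ` and
every edge meeting `A` is contained in `A`. -/
def IsIsolatedCopy {V : Type*} [DecidableEq V] (E : Finset (Finset V)) (ℓ t : ℕ)
    (A : Finset V) : Prop :=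
  IsCopy E ℓ (t + 1) A ∧ ∀ e ∈ E, (e ∩ A).Nonempty → e ⊆ A

/-- The copies of `K_q^r` in the hypergraph with edge set `E`. -/
noncomputable def cliques {V : Type*} [Fintype V] (E : Finset (Finset V)) (r q : ℕ) :
    Finset (Finset V) :=
  univ.filter (IsCopy E r q)

/-- The link of the vertex `v`. -/
noncomputable def vlink {V : Type*} (E : Finset (Finset V)) (v : V) : Finset (Finset V) :=
  (E.filter fun e => v ∈ e).image fun e => e.erase v

section LKK

variable {V : Type*}

theorem mem_cliques [Fintype V] {E : Finset (Finset V)} {r q : ℕ} {S : Finset V} :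
    S ∈ cliques E r q ↔ IsCopy E r q S := by
  simp [cliques]

theorem mem_vlink {E : Finset (Finset V)} {v : V} {e : Finset V} :
    e ∈ vlink E v ↔ v ∉ e ∧ insert v e ∈ E := by
  simp only [vlink, mem_image, mem_filter]
  constructor
  · rintro ⟨f, ⟨hf, hv⟩, rfl⟩
    simp [insert_erase hv, hf]
  · rintro ⟨hv, he⟩
    exact ⟨insert v e, ⟨he, mem_insert_self _ _⟩, erase_insert hv⟩

theorem card_vlink (E : Finset (Finset V)) (v : V) : (vlink E v).card = hdeg E v := by
  unfold vlink hdeg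
  refine card_image_of_injOn fun e he f hf h => ?_
  simp only [coe_filter, Set.mem_ofPred_eq] at he hf
  have h' : e.erase v = f.erase v := h
  rw [← insert_erase he.2, ← insert_erase hf.2, h']

theorem isLGraph_vlink {E : Finset (Finset V)} {r : ℕ} (h : IsLGraph (r + 1) E) (v : V) :
    IsLGraph r (vlink E v) := by
  intro e he
  rw [mem_vlink] at he
  have := h _ he.2
  rw [card_insert_of_notMem he.1] at this
  omega

theorem isLGraph_cliques [Fintype V] (E : Finset (Finset V)) (r q : ℕ) :
    IsLGraph q (cliques E r q) := fun _ h => (mem_cliques.1 h).1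

theorem sum_hdeg [Fintype V] {E : Finset (Finset V)} {r : ℕ} (h : IsLGraph r E) :
    ∑ v, hdeg E v = r * E.card := by
  have : ∀ v, hdeg E v = ∑ e ∈ E, if v ∈ e then 1 else 0 := by
    intro v; simp [hdeg]
  simp_rw [this]
  rw [sum_comm, mul_comm, ← smul_eq_mul, ← sum_const]
  refine sum_congr rfl fun e he => ?_
  simp [h e he]

theorem erase_mem_cliques_vlink [Fintype V] {E : Finset (Finset V)} {r q : ℕ} {S : Finset V}
    {v : V} (hS : S ∈ cliques E (r + 1) (q + 1)) (hv : v ∈ S) :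
    S.erase v ∈ cliques (vlink E v) r q := by
  rw [mem_cliques] at hS ⊢
  refine ⟨by rw [card_erase_of_mem hv, hS.1]; rfl, fun e he hc => ?_⟩
  have hve : v ∉ e := fun h => by simpa using he h
  refine mem_vlink.2 ⟨hve, hS.2 _ (insert_subset hv (he.trans (erase_subset _ _))) ?_⟩
  rw [card_insert_of_notMem hve, hc]

theorem hdeg_cliques_le_link [Fintype V] (E : Finset (Finset V)) (r q : ℕ) (v : V) :
    hdeg (cliques E (r + 1) (q + 1)) v ≤ (cliques (vlink E v) r q).card := by
  rw [← card_vlink]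
  refine card_le_card fun S hS => ?_
  rw [mem_vlink] at hS
  simpa [erase_insert hS.1] using erase_mem_cliques_vlink hS.2 (mem_insert_self v S)

theorem hdeg_cliques_add_le [Fintype V] (E : Finset (Finset V)) (r : ℕ) (v : V) :
    hdeg (cliques E r (r + 1)) v + hdeg E v ≤ E.card := by
  rw [← card_vlink (cliques E r (r + 1)), hdeg,
    ← card_union_of_disjoint]
  · refine card_le_card (union_subset (fun S hS => ?_) (filter_subset _ _))
    rw [mem_vlink, mem_cliques] at hS
    refine hS.2.2 _ (subset_insert _ _) ?_
    have := hS.2.1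
    rw [card_insert_of_notMem hS.1] at this
    omega
  · rw [disjoint_left]
    intro S hS hS'
    exact (mem_vlink.1 hS).1 (mem_filter.1 hS').2

theorem cliques_vertex_step [Fintype V] (r : ℕ) : ∀ (m : ℕ) (E : Finset (Finset V)),
    IsLGraph (r + 1) E → E.card ≤ m.choose (r + 1) → ∀ v,
    (r + 1) * hdeg (cliques E (r + 1) (r + 2)) v ≤ (m - (r + 1)) * hdeg E v := by
  induction r with
  | zero =>
    intro m E hE hm v
    rcases Nat.eq_zero_or_pos (hdeg E v) with h0 | h0
    · have := hdeg_cliques_le_link E 0 1 v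
      have h2 : cliques (vlink E v) 0 1 = ∅ := by
        rw [eq_empty_iff_forall_notMem]
        intro S hS
        have := (mem_cliques.1 hS).2 ∅ (empty_subset _) rfl
        rw [← card_vlink, card_eq_zero] at h0
        simp [h0] at this
      rw [h2] at this
      simp at this ⊢
      omega
    · have h1 : hdeg (cliques E 1 2) v + hdeg E v ≤ E.card := hdeg_cliques_add_le E 1 v
      simp at hm ⊢
      have : hdeg (cliques E 1 2) v ≤ m - 1 := by omega
      nlinarith
  | succ r ih =>
    intro m E hE hm v
    rcases m with _ | m
    · simp at hm
      subst hm
      have := hdeg_cliques_add_le (∅ : Finset (Finset V)) (r + 1 + 1) v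
      simp at this
      simp [this.1]
    have hp := Nat.choose_succ_succ m (r + 1)
    rcases le_or_gt (hdeg E v) (m.choose (r + 1)) with h | h
    · have hl := isLGraph_vlink hE v
      have h1 := hdeg_cliques_le_link E (r + 1) (r + 2) v
      have h2 : (r + 2) * (cliques (vlink E v) (r + 1) (r + 2)).card
          ≤ (m - (r + 1)) * hdeg E v := by
        have h3 := sum_hdeg (isLGraph_cliques (vlink E v) (r + 1) (r + 2))
        have h4 := sum_hdeg hl
        have h5 : (r + 1) * ∑ u, hdeg (cliques (vlink E v) (r + 1) (r + 2)) u
            ≤ (m - (r + 1)) * ∑ u, hdeg (vlink E v) u := by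
          rw [mul_sum, mul_sum]
          exact sum_le_sum fun u _ => ih m _ hl (by rwa [card_vlink]) u
        rw [h3, h4, card_vlink] at h5
        refine Nat.le_of_mul_le_mul_left ?_ (show 0 < r + 1 by omega)
        calc _ ≤ _ := h5
          _ = _ := by ring
      have : m + 1 - (r + 1 + 1) = m - (r + 1) := by omega
      rw [this]
      exact (Nat.mul_le_mul_left _ h1).trans h2
    · have h1 : hdeg (cliques E (r + 2) (r + 3)) v + hdeg E v ≤ E.card :=
        hdeg_cliques_add_le E (r + 2) v
      have h2 : hdeg (cliques E (r + 2) (r + 3)) v ≤ m.choose (r + 2) := by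
        have hp' : (m + 1).choose (r + 1 + 1) = m.choose (r + 1) + m.choose (r + 2) := hp
        omega
      have h3 := Nat.choose_succ_right_eq m (r + 1)
      calc (r + 1 + 1) * hdeg (cliques E (r + 2) (r + 3)) v
          ≤ (r + 1 + 1) * m.choose (r + 2) := Nat.mul_le_mul_left _ h2
        _ = (m - (r + 1)) * m.choose (r + 1) := by rw [mul_comm, h3, mul_comm]
        _ ≤ (m - (r + 1)) * hdeg E v := Nat.mul_le_mul_left _ h.le
        _ = _ := by congr 1; omega

/-- One step of the linear Kruskal–Katona inequality. -/
theorem cliques_step [Fintype V] {r m : ℕ} (hr : 1 ≤ r) {E : Finset (Finset V)}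
    (hE : IsLGraph r E) (hm : E.card ≤ m.choose r) :
    (r + 1) * (cliques E r (r + 1)).card ≤ (m - r) * E.card := by
  obtain ⟨r, rfl⟩ : ∃ s, r = s + 1 := ⟨r - 1, by omega⟩
  have h3 := sum_hdeg (isLGraph_cliques E (r + 1) (r + 2))
  have h4 := sum_hdeg hE
  have h5 : (r + 1) * ∑ u, hdeg (cliques E (r + 1) (r + 2)) u
      ≤ (m - (r + 1)) * ∑ u, hdeg E u := by
    rw [mul_sum, mul_sum]
    exact sum_le_sum fun u _ => cliques_vertex_step r m _ hE hm u
  rw [h3, h4] at h5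
  refine Nat.le_of_mul_le_mul_left ?_ (show 0 < r + 1 by omega)
  calc _ ≤ _ := h5
    _ = _ := by ring

theorem cliques_self [Fintype V] {r : ℕ} {E : Finset (Finset V)} (hE : IsLGraph r E) :
    cliques E r r = E := by
  ext S
  rw [mem_cliques]
  refine ⟨fun h => h.2 S Subset.rfl h.1, fun h => ⟨hE S h, fun e he hc => ?_⟩⟩
  rwa [eq_of_subset_of_card_le he (by rw [hE S h, hc])]

theorem IsCopy.subset {E : Finset (Finset V)} {r q p : ℕ} {S T : Finset V}
    (h : IsCopy E r q S) (hT : T ⊆ S) (hp : T.card = p) : IsCopy E r p T :=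
  ⟨hp, fun e he hc => h.2 e (he.trans hT) hc⟩

theorem cliques_succ_subset [Fintype V] {E : Finset (Finset V)} {r q : ℕ} :
    cliques E r (q + 1) ⊆ cliques (cliques E r q) q (q + 1) := by
  intro S hS
  rw [mem_cliques] at hS ⊢
  exact ⟨hS.1, fun e he hc => mem_cliques.2 (hS.subset he hc)⟩

/-- Linear Kruskal–Katona inequality. -/
theorem cliques_card_mul_le [Fintype V] {r m q : ℕ} (hr : 1 ≤ r) (hq : r ≤ q)
    {E : Finset (Finset V)} (hE : IsLGraph r E) (hm : E.card ≤ m.choose r) :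
    (cliques E r q).card * m.choose r ≤ E.card * m.choose q := by
  induction q, hq using Nat.le_induction with
  | base => rw [cliques_self hE]
  | succ q hq ih =>
    have hle : (cliques E r q).card ≤ m.choose q := by
      rcases Nat.eq_zero_or_pos (m.choose r) with h0 | h0
      · have hE0 : E = ∅ := by
          rw [← card_eq_zero]; omega
        rw [Nat.choose_eq_zero_iff] at h0
        have : cliques E r q = ∅ := by
          rw [eq_empty_iff_forall_notMem]
          intro S hS
          rw [mem_cliques] at hS
          obtain ⟨T, hT, hc⟩ := exists_subset_card_eq (s := S) (n := r) (by rw [hS.1]; exact hq)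
          have := hS.2 T hT hc
          simp [hE0] at this
        simp [this]
      · refine Nat.le_of_mul_le_mul_right (ih.trans ?_) h0
        rw [mul_comm]
        exact Nat.mul_le_mul_left _ hm
    have h1 := cliques_step (by omega) (isLGraph_cliques E r q) hle
    have h2 : (cliques E r (q + 1)).card ≤ (cliques (cliques E r q) q (q + 1)).card :=
      card_le_card cliques_succ_subset
    have h3 := Nat.choose_succ_right_eq m q
    refine Nat.le_of_mul_le_mul_left ?_ (show 0 < q + 1 by omega)
    calc (q + 1) * ((cliques E r (q + 1)).card * m.choose r)
        = ((q + 1) * (cliques E r (q + 1)).card) * m.choose r := by ring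
      _ ≤ ((m - q) * (cliques E r q).card) * m.choose r :=
        Nat.mul_le_mul_right _ ((Nat.mul_le_mul_left _ h2).trans h1)
      _ = (m - q) * ((cliques E r q).card * m.choose r) := by ring
      _ ≤ (m - q) * (E.card * m.choose q) := Nat.mul_le_mul_left _ ih
      _ = E.card * (m.choose q * (m - q)) := by ring
      _ = (q + 1) * (E.card * m.choose (q + 1)) := by rw [← h3]; ring

theorem cliques_card_le [Fintype V] {r m q : ℕ} (hr : 1 ≤ r) (hq : r ≤ q)
    {E : Finset (Finset V)} (hE : IsLGraph r E) (hm : E.card ≤ m.choose r) :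
    (cliques E r q).card ≤ m.choose q := by
  rcases Nat.eq_zero_or_pos (m.choose r) with h0 | h0
  · have hE0 : E = ∅ := by
      rw [← card_eq_zero]; omega
    have : cliques E r q = ∅ := by
      rw [eq_empty_iff_forall_notMem]
      intro S hS
      rw [mem_cliques] at hS
      obtain ⟨T, hT, hc⟩ := exists_subset_card_eq (s := S) (n := r) (by rw [hS.1]; exact hq)
      have := hS.2 T hT hc
      simp [hE0] at this
    simp [this]
  · refine Nat.le_of_mul_le_mul_right ((cliques_card_mul_le hr hq hE hm).trans ?_) h0
    rw [mul_comm]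
    exact Nat.mul_le_mul_left _ hm

theorem isLGraph_subset_support [Fintype V] {E : Finset (Finset V)} {r : ℕ} (hE : IsLGraph r E) :
    E ⊆ powersetCard r (univ.filter fun v => 0 < hdeg E v) := by
  intro e he
  rw [mem_powersetCard]
  refine ⟨fun v hv => ?_, hE e he⟩
  simp only [mem_filter, mem_univ, true_and]
  exact card_pos.2 ⟨e, mem_filter.2 ⟨he, hv⟩⟩

/-- The equality case of one step of the linear Kruskal–Katona inequality. -/
theorem eq_powersetCard_of_cliques_step [Fintype V] (r : ℕ) : ∀ (m : ℕ) (E : Finset (Finset V)),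
    r + 1 < m → E.Nonempty → IsLGraph (r + 1) E → E.card ≤ m.choose (r + 1) →
    (m - (r + 1)) * E.card ≤ (r + 2) * (cliques E (r + 1) (r + 2)).card →
    ∃ A : Finset V, A.card = m ∧ E = powersetCard (r + 1) A := by
  induction r with
  | zero =>
    intro m E hm hne hE hc hK
    have hsum := sum_hdeg (isLGraph_cliques E 1 2)
    have hsumE := sum_hdeg hE
    have h1 : ∀ v, hdeg (cliques E 1 2) v + hdeg E v ≤ E.card :=
      fun v => hdeg_cliques_add_le E 1 v
    have hsub := isLGraph_subset_support hE
    simp only [zero_add, Nat.choose_one_right, one_mul] at *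
    have hcard : m ≤ E.card := by
      by_contra hlt
      push Not at hlt
      have h2 : ∀ v, hdeg (cliques E 1 2) v ≤ (E.card - 1) * hdeg E v := by
        intro v
        have := cliques_vertex_step 0 E.card E hE (by simp) v
        simpa using this
      have h3 : ∑ v, hdeg (cliques E 1 2) v ≤ ∑ v, (E.card - 1) * hdeg E v :=
        sum_le_sum fun v _ => h2 v
      rw [← mul_sum, hsumE, hsum] at h3
      have h4 := hK.trans h3
      have := Nat.le_of_mul_le_mul_right h4 hne.card_pos
      have := hne.card_pos
      omega
    set A := univ.filter fun v => 0 < hdeg E v with hA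
    have hAm : A.card ≤ m := by
      calc A.card = ∑ v ∈ A, 1 := by simp
        _ ≤ ∑ v ∈ A, hdeg E v := sum_le_sum fun v hv => (mem_filter.1 hv).2
        _ ≤ ∑ v, hdeg E v := sum_le_sum_of_subset (subset_univ _)
        _ ≤ m := by omega
    have h5 : (powersetCard 1 A).card ≤ E.card := by
      rw [card_powersetCard, Nat.choose_one_right]; omega
    refine ⟨A, ?_, eq_of_subset_of_card_le hsub h5⟩
    have := card_le_card hsub
    rw [card_powersetCard, Nat.choose_one_right] at this
    omega
  | succ r ih =>
    intro m E hm hne hE hc hK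
    have hsum := sum_hdeg (isLGraph_cliques E (r + 2) (r + 3))
    have hsumE : ∑ v, hdeg E v = (r + 2) * E.card := sum_hdeg hE
    have hstep : ∀ v, (r + 2) * hdeg (cliques E (r + 2) (r + 3)) v ≤ (m - (r + 2)) * hdeg E v :=
      fun v => cliques_vertex_step (r + 1) m E hE hc v
    have heq : ∀ v, (r + 2) * hdeg (cliques E (r + 2) (r + 3)) v
        = (m - (r + 2)) * hdeg E v := by
      have h1 : ∑ v, (r + 2) * hdeg (cliques E (r + 2) (r + 3)) v
          = ∑ v, (m - (r + 2)) * hdeg E v := by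
        refine le_antisymm (sum_le_sum fun v _ => hstep v) ?_
        rw [← mul_sum, ← mul_sum, hsum, hsumE]
        calc (m - (r + 2)) * ((r + 2) * E.card) = (r + 2) * ((m - (r + 2)) * E.card) := by ring
          _ ≤ (r + 2) * ((r + 3) * (cliques E (r + 2) (r + 3)).card) :=
            Nat.mul_le_mul_left _ hK
      intro v
      exact (sum_eq_sum_iff_of_le fun v _ => hstep v).1 h1 v (mem_univ v)
    obtain ⟨m, rfl⟩ : ∃ m', m = m' + 1 := ⟨m - 1, by omega⟩
    have hp : (m + 1).choose (r + 2) = m.choose (r + 1) + m.choose (r + 2) :=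
      Nat.choose_succ_succ m (r + 1)
    have hch := Nat.choose_succ_right_eq m (r + 1)
    have hmr : m + 1 - (r + 2) = m - (r + 1) := by omega
    have hlink : ∀ v, 0 < hdeg E v → ∃ A : Finset V, A.card = m ∧
        vlink E v = powersetCard (r + 1) A := by
      intro v hv
      have hle : hdeg E v ≤ m.choose (r + 1) := by
        by_contra hlt
        push Not at hlt
        have h1 : hdeg (cliques E (r + 2) (r + 3)) v + hdeg E v ≤ E.card :=
          hdeg_cliques_add_le E (r + 2) v
        have hc' : E.card ≤ (m + 1).choose (r + 2) := hc
        have h2 : hdeg (cliques E (r + 2) (r + 3)) v < m.choose (r + 2) := by omega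
        have h3 := heq v
        rw [hmr] at h3
        have h4 : (r + 2) * hdeg (cliques E (r + 2) (r + 3)) v < (r + 2) * m.choose (r + 2) :=
          Nat.mul_lt_mul_of_pos_left h2 (by omega)
        have h5 : (m - (r + 1)) * m.choose (r + 1) ≤ (m - (r + 1)) * hdeg E v :=
          Nat.mul_le_mul_left _ hlt.le
        have h6 : (r + 2) * m.choose (r + 2) = (m - (r + 1)) * m.choose (r + 1) := by
          rw [mul_comm, mul_comm (m - (r + 1))]; exact hch
        omega
      refine ih m (vlink E v) (by omega) ?_ (isLGraph_vlink hE v) (by rwa [card_vlink]) ?_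
      · rwa [← card_pos, card_vlink]
      · rw [card_vlink]
        have h3 := heq v
        rw [hmr] at h3
        rw [← h3]
        exact Nat.mul_le_mul_left _ (hdeg_cliques_le_link E (r + 1) (r + 2) v)
    set A := univ.filter fun v => 0 < hdeg E v with hA
    have hsub : E ⊆ powersetCard (r + 2) A := isLGraph_subset_support hE
    have hdeg_eq : ∀ v ∈ A, hdeg E v = m.choose (r + 1) := by
      intro v hv
      obtain ⟨B, hB, hl⟩ := hlink v (mem_filter.1 hv).2
      rw [← card_vlink, hl, card_powersetCard, hB]
    have hpos : 0 < m.choose (r + 1) := Nat.choose_pos (by omega)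
    have hAm : A.card ≤ m + 1 := by
      have h1 : A.card * m.choose (r + 1) ≤ (r + 2) * E.card := by
        rw [← hsumE, ← smul_eq_mul, ← sum_const, ← sum_congr rfl hdeg_eq]
        exact sum_le_sum_of_subset (subset_univ _)
      have h2 : (m + 1) * m.choose (r + 1) = (m + 1).choose (r + 2) * (r + 2) :=
        Nat.add_one_mul_choose_eq m (r + 1)
      have h3 : (r + 2) * E.card ≤ (r + 2) * (m + 1).choose (r + 2) := Nat.mul_le_mul_left _ hc
      refine Nat.le_of_mul_le_mul_right (h1.trans (h3.trans ?_)) hpos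
      rw [h2, mul_comm]
    obtain ⟨e, he⟩ := hne
    have heA := hsub he
    rw [mem_powersetCard] at heA
    obtain ⟨v, hve⟩ : e.Nonempty := card_pos.1 (by omega)
    have hvA := heA.1 hve
    obtain ⟨B, hB, hl⟩ := hlink v (mem_filter.1 hvA).2
    have hvB : v ∉ B := by
      intro h
      obtain ⟨T, hT, hTB, hTc⟩ := exists_subsuperset_card_eq (s := {v}) (t := B) (n := r + 1)
        (by simpa using h) (by simp) (by omega)
      have : T ∈ vlink E v := by rw [hl, mem_powersetCard]; exact ⟨hTB, hTc⟩
      exact (mem_vlink.1 this).1 (hT (mem_singleton_self v))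
    have hBA : insert v B ⊆ A := by
      refine insert_subset hvA fun u hu => ?_
      obtain ⟨T, hT, hTB, hTc⟩ := exists_subsuperset_card_eq (s := {u}) (t := B) (n := r + 1)
        (by simpa using hu) (by simp) (by omega)
      have : T ∈ vlink E v := by rw [hl, mem_powersetCard]; exact ⟨hTB, hTc⟩
      have h2 := hsub (mem_vlink.1 this).2
      exact (mem_powersetCard.1 h2).1 (mem_insert_of_mem (hT (mem_singleton_self u)))
    have hAm' : A.card = m + 1 := by
      have := card_le_card hBA
      rw [card_insert_of_notMem hvB] at this
      omega
    refine ⟨A, hAm', eq_of_subset_of_card_le hsub ?_⟩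
    have h1 : (m + 1) * m.choose (r + 1) ≤ (r + 2) * E.card := by
      rw [← hsumE, ← hAm', ← smul_eq_mul, ← sum_const, ← sum_congr rfl hdeg_eq]
      exact sum_le_sum_of_subset (subset_univ _)
    have h2 : (m + 1) * m.choose (r + 1) = (m + 1).choose (r + 2) * (r + 2) :=
      Nat.add_one_mul_choose_eq m (r + 1)
    rw [card_powersetCard, hAm']
    refine Nat.le_of_mul_le_mul_left ?_ (show 0 < r + 2 by omega)
    rw [mul_comm, ← h2]
    exact h1

/-- The equality case of the linear Kruskal–Katona inequality. -/
theorem eq_powersetCard_of_cliques [Fintype V] {r m q : ℕ} (hr : 1 ≤ r) (hq : r < q) (hqm : q ≤ m)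
    {E : Finset (Finset V)} (hE : IsLGraph r E) (hm : E.card ≤ m.choose r)
    (hK : m.choose q ≤ (cliques E r q).card) :
    ∃ A : Finset V, A.card = m ∧ E = powersetCard r A := by
  have hpos : 0 < m.choose q := Nat.choose_pos hqm
  have hposr : 0 < m.choose r := Nat.choose_pos (by omega)
  have hEc : m.choose r ≤ E.card := by
    have h := cliques_card_mul_le hr hq.le hE hm
    refine Nat.le_of_mul_le_mul_right (le_trans ?_ h) hpos
    rw [mul_comm]
    exact Nat.mul_le_mul_right _ hK
  have hKr : m.choose (r + 1) ≤ (cliques E r (r + 1)).card := by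
    by_contra hlt
    push Not at hlt
    have h1 := cliques_card_mul_le (by omega) hq (isLGraph_cliques E r (r + 1)) hlt.le
    have h2 : cliques E r q ⊆ cliques (cliques E r (r + 1)) (r + 1) q := by
      intro S hS
      rw [mem_cliques] at hS ⊢
      exact ⟨hS.1, fun e he hc => mem_cliques.2 (hS.subset he hc)⟩
    have h3 : m.choose q * m.choose (r + 1) ≤ (cliques E r (r + 1)).card * m.choose q :=
      (Nat.mul_le_mul_right _ (hK.trans (card_le_card h2))).trans h1
    rw [mul_comm] at h3
    have := Nat.le_of_mul_le_mul_right h3 hpos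
    omega
  obtain ⟨r, rfl⟩ : ∃ s, r = s + 1 := ⟨r - 1, by omega⟩
  refine eq_powersetCard_of_cliques_step r m E (by omega) (card_pos.1 (by omega)) hE hm ?_
  have h := Nat.choose_succ_right_eq m (r + 1)
  calc (m - (r + 1)) * E.card ≤ (m - (r + 1)) * m.choose (r + 1) := Nat.mul_le_mul_left _ hm
    _ = (r + 2) * m.choose (r + 2) := by rw [mul_comm, ← h, mul_comm]
    _ ≤ _ := Nat.mul_le_mul_left _ hKr

end LKK

section Degree

variable {V : Type*} [Fintype V]

theorem copiesAt_eq (E : Finset (Finset V)) (ℓ k : ℕ) (v : V) :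
    copiesAt E ℓ k v = hdeg (cliques E ℓ k) v := by
  unfold copiesAt hdeg cliques
  rw [filter_filter]
  simp only [and_comm]

theorem choose_le_hdeg {E : Finset (Finset V)} {r κ t : ℕ} (hr : 1 ≤ r) (hκ : r < κ) (ht : κ ≤ t)
    (hE : IsLGraph (r + 1) E) {v : V} (hv : t.choose κ ≤ copiesAt E (r + 1) (κ + 1) v) :
    t.choose r ≤ hdeg E v := by
  by_contra hlt
  push Not at hlt
  rw [copiesAt_eq] at hv
  have h1 := hdeg_cliques_le_link E r κ v
  have h2 := cliques_card_mul_le hr hκ.le (isLGraph_vlink hE v)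
    (by rw [card_vlink]; exact hlt.le)
  rw [card_vlink] at h2
  have hpos : 0 < t.choose κ := Nat.choose_pos ht
  have h3 : t.choose κ * t.choose r ≤ hdeg E v * t.choose κ :=
    (Nat.mul_le_mul_right _ (hv.trans h1)).trans h2
  rw [mul_comm] at h3
  have := Nat.le_of_mul_le_mul_right h3 hpos
  omega

theorem choose_le_copiesAt {E : Finset (Finset V)} {ℓ κ t : ℕ} {A : Finset V}
    (hA : IsCopy E ℓ (t + 1) A) {v : V} (hv : v ∈ A) :
    t.choose κ ≤ copiesAt E ℓ (κ + 1) v := by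
  have h1 : (powersetCard κ (A.erase v)).card = t.choose κ := by
    rw [card_powersetCard, card_erase_of_mem hv, hA.1]; rfl
  rw [← h1, copiesAt_eq, ← card_vlink]
  refine card_le_card fun Q hQ => ?_
  rw [mem_powersetCard] at hQ
  have hvQ : v ∉ Q := fun h => by simpa using hQ.1 h
  rw [mem_vlink, mem_cliques]
  refine ⟨hvQ, hA.subset (insert_subset hv (hQ.1.trans (erase_subset _ _))) ?_⟩
  rw [card_insert_of_notMem hvQ, hQ.2]

/-- A vertex of minimum degree lies in a copy of `K_{t+1}` containing all its edges. -/
theorem exists_copy_of_hdeg_le {E : Finset (Finset V)} {r κ t : ℕ} (hr : 1 ≤ r) (hκ : r < κ)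
    (ht : κ ≤ t) (hE : IsLGraph (r + 1) E) {v : V}
    (hv : t.choose κ ≤ copiesAt E (r + 1) (κ + 1) v) (hd : hdeg E v ≤ t.choose r) :
    ∃ A : Finset V, v ∈ A ∧ IsCopy E (r + 1) (t + 1) A ∧ ∀ e ∈ E, v ∈ e → e ⊆ A := by
  have hv' := hv
  rw [copiesAt_eq] at hv
  have h1 := hdeg_cliques_le_link E r κ v
  obtain ⟨B, hB, hl⟩ := eq_powersetCard_of_cliques hr hκ ht (isLGraph_vlink hE v)
    (by rwa [card_vlink]) (hv.trans h1)
  have hvB : v ∉ B := by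
    intro h
    obtain ⟨T, hT, hTB, hTc⟩ := exists_subsuperset_card_eq (s := {v}) (t := B) (n := r)
      (by simpa using h) (by simpa using hr) (by omega)
    have : T ∈ vlink E v := by rw [hl, mem_powersetCard]; exact ⟨hTB, hTc⟩
    exact (mem_vlink.1 this).1 (hT (mem_singleton_self v))
  have hedge : ∀ e ∈ E, v ∈ e → e ⊆ insert v B := by
    intro e he hve
    have : e.erase v ∈ vlink E v := mem_vlink.2 ⟨notMem_erase _ _, by rwa [insert_erase hve]⟩
    rw [hl, mem_powersetCard] at this
    rw [← insert_erase hve]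
    exact insert_subset_insert _ this.1
  have hsub : vlink (cliques E (r + 1) (κ + 1)) v ⊆ powersetCard κ B := by
    intro Q hQ
    rw [mem_vlink, mem_cliques] at hQ
    have hQc : Q.card = κ := by
      have := hQ.2.1
      rw [card_insert_of_notMem hQ.1] at this
      omega
    refine mem_powersetCard.2 ⟨fun x hx => ?_, hQc⟩
    obtain ⟨T, hT, hTB, hTc⟩ := exists_subsuperset_card_eq (s := {x}) (t := Q) (n := r)
      (by simpa using hx) (by simpa using hr) (by omega)
    have hvT : v ∉ T := fun h => hQ.1 (hTB h)
    have : insert v T ∈ E := hQ.2.2 _ (insert_subset_insert _ hTB)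
      (by rw [card_insert_of_notMem hvT, hTc])
    have h2 : T ∈ powersetCard r B := by rw [← hl]; exact mem_vlink.2 ⟨hvT, this⟩
    exact (mem_powersetCard.1 h2).1 (hT (mem_singleton_self x))
  have heq : vlink (cliques E (r + 1) (κ + 1)) v = powersetCard κ B := by
    refine eq_of_subset_of_card_le hsub ?_
    rwa [card_powersetCard, hB, card_vlink]
  refine ⟨insert v B, mem_insert_self _ _, ⟨by rw [card_insert_of_notMem hvB, hB], ?_⟩, hedge⟩
  intro e he hc
  by_cases hve : v ∈ e
  · have h2 : e.erase v ∈ powersetCard r B := by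
      rw [mem_powersetCard, card_erase_of_mem hve, hc]
      refine ⟨fun x hx => ?_, rfl⟩
      have := he (mem_of_mem_erase hx)
      rw [mem_insert] at this
      exact this.resolve_left (ne_of_mem_erase hx)
    rw [← hl, mem_vlink, insert_erase hve] at h2
    exact h2.2
  · have heB : e ⊆ B := fun x hx => by
      have := he hx
      rw [mem_insert] at this
      exact this.resolve_left (fun h => hve (h ▸ hx))
    obtain ⟨Q, hQ, hQB, hQc⟩ := exists_subsuperset_card_eq (s := e) (t := B) (n := κ)
      heB (by omega) (by omega)
    have h2 : Q ∈ vlink (cliques E (r + 1) (κ + 1)) v := by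
      rw [heq, mem_powersetCard]; exact ⟨hQB, hQc⟩
    rw [mem_vlink, mem_cliques] at h2
    exact h2.2.2 e (hQ.trans (subset_insert _ _)) hc

end Degree

section InitSeg

open Finset.Colex
open scoped FinsetFamily

theorem exists_isInitSeg_card (s r : ℕ) : ∀ m, m ≤ s.choose r →
    ∃ I : Finset (Finset (Fin s)), IsInitSeg I r ∧ I.card = m := by
  intro m
  induction m with
  | zero => exact fun _ => ⟨∅, isInitSeg_empty, rfl⟩
  | succ m ih =>
    intro hm
    obtain ⟨I, hI, hc⟩ := ih (by omega)
    have hne : (powersetCard r univ \ I).Nonempty := by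
      rw [← card_pos]
      have := le_card_sdiff I (powersetCard r (univ : Finset (Fin s)))
      rw [card_powersetCard, card_univ, Fintype.card_fin] at this
      omega
    obtain ⟨x, hx, hmin⟩ := exists_min_image _ (fun a => toColex a) hne
    rw [mem_sdiff, mem_powersetCard] at hx
    refine ⟨insert x I, ⟨?_, ?_⟩, by rw [card_insert_of_notMem hx.2, hc]⟩
    · intro a ha
      rw [coe_insert, Set.mem_insert_iff] at ha
      rcases ha with rfl | ha
      · exact hx.1.2
      · exact hI.1 ha
    · intro a b ha hb
      rw [mem_insert] at ha ⊢
      rcases ha with rfl | ha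
      · by_contra hnot
        push Not at hnot
        have := hmin b (mem_sdiff.2 ⟨mem_powersetCard.2 ⟨subset_univ _, hb.2⟩, hnot.2⟩)
        exact absurd hb.1 (not_lt.2 this)
      · exact Or.inr (hI.2 ha hb)

/-- An initial segment of the colexicographic order on `r`-subsets of `Fin s`, of size `m`
whenever `m ≤ s.choose r`. -/
noncomputable def seg (s r m : ℕ) : Finset (Finset (Fin s)) :=
  if h : m ≤ s.choose r then (exists_isInitSeg_card s r m h).choose else ∅

theorem isInitSeg_seg (s r m : ℕ) : IsInitSeg (seg s r m) r := by
  unfold seg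
  split_ifs with h
  · exact (exists_isInitSeg_card s r m h).choose_spec.1
  · exact isInitSeg_empty

theorem card_seg {s r m : ℕ} (h : m ≤ s.choose r) : (seg s r m).card = m := by
  unfold seg
  rw [dif_pos h]
  exact (exists_isInitSeg_card s r m h).choose_spec.2

theorem IsInitSeg.subset_of_card_le {s r : ℕ} {I J : Finset (Finset (Fin s))}
    (hI : IsInitSeg I r) (hJ : IsInitSeg J r) (h : I.card ≤ J.card) : I ⊆ J := by
  rcases hI.total hJ with h1 | h1
  · exact h1
  · rw [eq_of_subset_of_card_le h1 h]

/-- The first `t` elements of `Fin s`. -/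
def firstFin (s t : ℕ) : Finset (Fin s) := univ.filter fun i => i.val < t

theorem card_firstFin {s t : ℕ} (h : t ≤ s) : (firstFin s t).card = t := by
  rw [firstFin, Fin.card_filter_val_lt, min_eq_right h]

theorem isInitSeg_firstFin (s t r : ℕ) : IsInitSeg (powersetCard r (firstFin s t)) r := by
  refine ⟨Set.sized_powersetCard _ _, fun a b ha hb => ?_⟩
  rw [mem_powersetCard] at ha ⊢
  refine ⟨fun i hi => ?_, hb.2⟩
  have hlt : ∀ x ∈ a, x.val < t := fun x hx => (mem_filter.1 (ha.1 hx)).2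
  refine mem_filter.2 ⟨mem_univ _, ?_⟩
  by_cases hs : t < s
  · exact forall_lt_mono (a := (⟨t, hs⟩ : Fin s)) hb.1.le (fun x hx => hlt x hx) i hi
  · omega

end InitSeg

section Compress

open Finset.Colex
open scoped FinsetFamily

variable {V : Type*} {s : ℕ} (emb : Fin s ↪ V)

/-- The pullback of a vertex set along an embedding. -/
noncomputable def pre (e : Finset V) : Finset (Fin s) := univ.filter fun i => emb i ∈ e

/-- The trace of a family: those `R` for which `P` together with the image of `R` belongs to the
family. -/
noncomputable def trace (X : Finset (Finset V)) (P : Finset V) : Finset (Finset (Fin s)) :=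
  univ.filter fun R => P ∪ R.map emb ∈ X

/-- Replace all edges inside the image of `emb` by `F`, and compress all other traces. -/
noncomputable def compress [Fintype V] (ℓ : ℕ) (E F : Finset (Finset V)) : Finset (Finset V) :=
  univ.filter fun e => if e ⊆ univ.map emb then e ∈ F else
    pre emb e ∈ seg s (ℓ - (e \ univ.map emb).card) (trace emb E (e \ univ.map emb)).card

variable {emb}

theorem mem_trace {X : Finset (Finset V)} {P : Finset V} {R : Finset (Fin s)} :
    R ∈ trace emb X P ↔ P ∪ R.map emb ∈ X := by simp [trace]

theorem sdiff_union_map_pre (e : Finset V) : e \ univ.map emb ∪ (pre emb e).map emb = e := by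
  ext x
  simp only [mem_union, mem_sdiff, mem_map, mem_univ, true_and, pre, mem_filter]
  constructor
  · rintro (h | ⟨i, hi, rfl⟩)
    · exact h.1
    · exact hi
  · intro hx
    by_cases h : ∃ i, emb i = x
    · obtain ⟨i, rfl⟩ := h
      exact Or.inr ⟨i, hx, rfl⟩
    · exact Or.inl ⟨hx, h⟩

theorem union_map_sdiff {P : Finset V} (hP : Disjoint P (univ.map emb)) (R : Finset (Fin s)) :
    (P ∪ R.map emb) \ univ.map emb = P := by
  rw [union_sdiff_distrib, sdiff_eq_self_of_disjoint hP,
    sdiff_eq_empty_iff_subset.2 (map_subset_map.2 (subset_univ R)), union_empty]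

theorem pre_union_map {P : Finset V} (hP : Disjoint P (univ.map emb)) (R : Finset (Fin s)) :
    pre emb (P ∪ R.map emb) = R := by
  ext i
  simp only [pre, mem_filter, mem_univ, true_and, mem_union, mem_map']
  refine ⟨fun h => h.resolve_left fun h' => ?_, Or.inr⟩
  exact disjoint_left.1 hP h' (mem_map_of_mem _ (mem_univ i))

theorem disjoint_union_map {P : Finset V} (hP : Disjoint P (univ.map emb)) (R : Finset (Fin s)) :
    Disjoint P (R.map emb) := hP.mono_right (map_subset_map.2 (subset_univ R))

theorem card_union_map {P : Finset V} (hP : Disjoint P (univ.map emb)) (R : Finset (Fin s)) :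
    (P ∪ R.map emb).card = P.card + R.card := by
  rw [card_union_of_disjoint (disjoint_union_map hP R), card_map]

theorem card_fiber (X : Finset (Finset V)) {P : Finset V} (hP : Disjoint P (univ.map emb)) :
    (X.filter fun e => e \ univ.map emb = P).card = (trace emb X P).card := by
  refine card_nbij' (fun e => pre emb e) (fun R => P ∪ R.map emb) ?_ ?_ ?_ ?_
  · intro e he
    simp only [coe_filter, Set.mem_ofPred_eq] at he
    rw [mem_coe, mem_trace]
    have := sdiff_union_map_pre (emb := emb) e
    rw [he.2] at this
    rw [this]
    exact he.1
  · intro R hR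
    rw [mem_coe, mem_trace] at hR
    simp only [coe_filter, Set.mem_ofPred_eq]
    exact ⟨hR, union_map_sdiff hP R⟩
  · intro e he
    simp only [coe_filter, Set.mem_ofPred_eq] at he
    have := sdiff_union_map_pre (emb := emb) e
    rwa [he.2] at this
  · intro R _
    exact pre_union_map hP R

theorem card_eq_sum_trace [Fintype V] (X : Finset (Finset V)) :
    X.card = ∑ P ∈ (univ.map emb)ᶜ.powerset, (trace emb X P).card := by
  rw [card_eq_sum_card_fiberwise (f := fun e => e \ univ.map emb)
    (t := (univ.map emb)ᶜ.powerset)]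
  · refine sum_congr rfl fun P hP => card_fiber X ?_
    rw [mem_powerset] at hP
    exact disjoint_of_subset_left hP disjoint_compl_left
  · intro e _
    simp only [coe_powerset, Set.mem_preimage, Set.mem_powerset_iff, coe_subset]
    rw [sdiff_eq_inter_compl]
    exact inter_subset_right

theorem sized_trace {ℓ : ℕ} {E : Finset (Finset V)} (hE : IsLGraph ℓ E) {P : Finset V}
    (hP : Disjoint P (univ.map emb)) :
    (trace emb E P : Set (Finset (Fin s))).Sized (ℓ - P.card) := by
  intro R hR
  rw [mem_coe, mem_trace] at hR
  have := hE _ hR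
  rw [card_union_map hP] at this
  omega

theorem card_trace_le {ℓ : ℕ} {E : Finset (Finset V)} (hE : IsLGraph ℓ E) {P : Finset V}
    (hP : Disjoint P (univ.map emb)) : (trace emb E P).card ≤ s.choose (ℓ - P.card) := by
  have : trace emb E P ⊆ powersetCard (ℓ - P.card) univ := fun R hR =>
    mem_powersetCard.2 ⟨subset_univ _, sized_trace hE hP hR⟩
  simpa using card_le_card this

theorem mem_compress_of_subset [Fintype V] {ℓ : ℕ} {E F : Finset (Finset V)} {e : Finset V}
    (he : e ⊆ univ.map emb) : e ∈ compress emb ℓ E F ↔ e ∈ F := by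
  simp [compress, he]

theorem trace_compress [Fintype V] {ℓ : ℕ} {E F : Finset (Finset V)} {P : Finset V}
    (hP : Disjoint P (univ.map emb)) (hne : P.Nonempty) :
    trace emb (compress emb ℓ E F) P = seg s (ℓ - P.card) (trace emb E P).card := by
  ext R
  have hns : ¬ P ∪ R.map emb ⊆ univ.map emb := by
    intro h
    obtain ⟨x, hx⟩ := hne
    exact disjoint_left.1 hP hx (h (mem_union_left _ hx))
  rw [mem_trace, compress, mem_filter, if_neg hns, union_map_sdiff hP, pre_union_map hP]
  simp

theorem isLGraph_compress [Fintype V] {ℓ : ℕ} {E F : Finset (Finset V)} (hE : IsLGraph ℓ E)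
    (hF : IsLGraph ℓ F) : IsLGraph ℓ (compress emb ℓ E F) := by
  intro e he
  by_cases hs : e ⊆ univ.map emb
  · exact hF e ((mem_compress_of_subset hs).1 he)
  · have hP : Disjoint (e \ univ.map emb) (univ.map emb) := sdiff_disjoint
    rw [compress, mem_filter, if_neg hs] at he
    have h1 := (isInitSeg_seg _ _ _).1 he.2
    have h2 := card_union_map hP (pre emb e)
    rw [sdiff_union_map_pre, h1] at h2
    have h3 := card_pos.2 ⟨_, he.2⟩
    rw [card_seg (card_trace_le hE hP)] at h3
    obtain ⟨R, hR⟩ := card_pos.1 h3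
    rw [mem_trace] at hR
    have h4 := hE _ hR
    rw [card_union_map hP] at h4
    omega

theorem card_compress_add [Fintype V] {ℓ : ℕ} {E F : Finset (Finset V)} (hE : IsLGraph ℓ E)
    (hF : ∀ e ∈ F, e ⊆ univ.map emb) :
    (compress emb ℓ E F).card + (E.filter fun e => e ⊆ univ.map emb).card = E.card + F.card := by
  have h0 : ∅ ∈ (univ.map emb)ᶜ.powerset := empty_mem_powerset _
  have h1 := card_eq_sum_trace (emb := emb) E
  have h2 := card_eq_sum_trace (emb := emb) (compress emb ℓ E F)
  rw [← add_sum_erase _ _ h0] at h1 h2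
  have hd : Disjoint (∅ : Finset V) (univ.map emb) := disjoint_empty_left _
  have h3 : (trace emb E ∅).card = (E.filter fun e => e ⊆ univ.map emb).card := by
    rw [← card_fiber E hd]
    simp only [sdiff_eq_empty_iff_subset]
  have h4 : (trace emb (compress emb ℓ E F) ∅).card = F.card := by
    rw [← card_fiber _ hd]
    congr 1
    ext e
    simp only [sdiff_eq_empty_iff_subset, mem_filter]
    constructor
    · rintro ⟨h, hs⟩
      exact (mem_compress_of_subset hs).1 h
    · intro h
      exact ⟨(mem_compress_of_subset (hF e h)).2 h, hF e h⟩
  have h5 : ∑ P ∈ (univ.map emb)ᶜ.powerset.erase ∅, (trace emb (compress emb ℓ E F) P).card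
      = ∑ P ∈ (univ.map emb)ᶜ.powerset.erase ∅, (trace emb E P).card := by
    refine sum_congr rfl fun P hP => ?_
    rw [mem_erase, mem_powerset] at hP
    have hPd : Disjoint P (univ.map emb) := disjoint_of_subset_left hP.2 disjoint_compl_left
    rw [trace_compress hPd (nonempty_iff_ne_empty.2 hP.1), card_seg (card_trace_le hE hPd)]
  omega

theorem seg_subset_of_shadow {n r j m : ℕ} {𝒬 : Finset (Finset (Fin n))}
    {X : Finset (Finset (Fin n))} (h𝒬 : (𝒬 : Set (Finset (Fin n))).Sized m) (hj : j ≤ m)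
    (hX : (X : Set (Finset (Fin n))).Sized j)
    (hsub : ∀ Q ∈ 𝒬, ∀ R ⊆ Q, R.card = j → R ∈ X) (hr : r = 𝒬.card) :
    ∀ Q ∈ seg n m r, ∀ R ⊆ Q, R.card = j → R ∈ seg n j X.card := by
  subst hr
  have hcQ : 𝒬.card ≤ n.choose m := by
    have : 𝒬 ⊆ powersetCard m univ := fun R hR => mem_powersetCard.2 ⟨subset_univ _, h𝒬 hR⟩
    simpa using card_le_card this
  have hcX : X.card ≤ n.choose j := by
    have : X ⊆ powersetCard j univ := fun R hR => mem_powersetCard.2 ⟨subset_univ _, hX hR⟩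
    simpa using card_le_card this
  have hkk := iterated_kk (k := m - j) h𝒬 (card_seg hcQ).le (isInitSeg_seg n m 𝒬.card)
  have hsh : ∂^[m - j] 𝒬 ⊆ X := by
    intro R hR
    rw [mem_shadow_iterate_iff_exists_mem_card_add] at hR
    obtain ⟨Q, hQ, hRQ, hc⟩ := hR
    refine hsub Q hQ R hRQ ?_
    have := h𝒬 hQ
    omega
  have hinit : ∀ i, i ≤ m → IsInitSeg (∂^[i] (seg n m 𝒬.card)) (m - i) := by
    intro i
    induction i with
    | zero => intro _; exact isInitSeg_seg _ _ _
    | succ i ih =>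
      intro hi
      rw [Function.iterate_succ_apply']
      have := (ih (by omega)).shadow
      rwa [Nat.sub_sub] at this
  have h1 := hinit (m - j) (by omega)
  rw [Nat.sub_sub_self hj] at h1
  have h2 : ∂^[m - j] (seg n m 𝒬.card) ⊆ seg n j X.card := by
    refine IsInitSeg.subset_of_card_le h1 (isInitSeg_seg _ _ _) ?_
    rw [card_seg hcX]
    exact hkk.trans (card_le_card hsh)
  intro Q hQ R hR hc
  refine h2 ?_
  rw [mem_shadow_iterate_iff_exists_mem_card_add]
  refine ⟨Q, hQ, hR, ?_⟩
  have := (isInitSeg_seg n m 𝒬.card).1 hQ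
  omega

theorem degCond_compress [Fintype V] {r κ t : ℕ} (hr : 1 ≤ r) (hts : t + 1 ≤ s)
    {E F : Finset (Finset V)} (hE : IsLGraph (r + 1) E)
    (hcond : DegCond E (r + 1) (κ + 1) t)
    (hF : ∀ v ∈ univ.map emb, ∃ A ⊆ univ.map emb, v ∈ A ∧ IsCopy F (r + 1) (t + 1) A)
    (hfirst : ∀ e ⊆ (firstFin s t).map emb, e.card = r + 1 → e ∈ F) :
    DegCond (compress emb (r + 1) E F) (r + 1) (κ + 1) t := by
  set E' := compress emb (r + 1) E F with hE'
  intro u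
  rw [Nat.add_sub_cancel]
  by_cases hu : u ∈ univ.map emb
  · obtain ⟨A, hA, huA, hAc⟩ := hF u hu
    refine choose_le_copiesAt (A := A) ⟨hAc.1, fun e he hc => ?_⟩ huA
    exact (mem_compress_of_subset (he.trans hA)).2 (hAc.2 e he hc)
  have hud : Disjoint {u} (univ.map emb) := disjoint_singleton_left.2 hu
  have hutr := trace_compress (ℓ := r + 1) (E := E) (F := F) hud (singleton_nonempty u)
  rw [card_singleton, Nat.add_sub_cancel, ← hE'] at hutr
  have hcu := card_trace_le hE hud
  rw [card_singleton, Nat.add_sub_cancel] at hcu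
  rcases le_or_gt (t.choose r) (trace emb E {u}).card with hbig | hsmall
  · have hsub : powersetCard r (firstFin s t) ⊆ seg s r (trace emb E {u}).card := by
      refine IsInitSeg.subset_of_card_le (isInitSeg_firstFin _ _ _) (isInitSeg_seg _ _ _) ?_
      rw [card_seg hcu, card_powersetCard, card_firstFin (by omega)]
      exact hbig
    refine choose_le_copiesAt (A := {u} ∪ (firstFin s t).map emb) ⟨?_, fun e he hc => ?_⟩ (by simp)
    · rw [card_union_map hud, card_firstFin (by omega), card_singleton, add_comm]
    · by_cases hue : u ∈ e
      · have hes : e \ univ.map emb = {u} := by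
          ext x
          simp only [mem_sdiff, mem_singleton]
          constructor
          · rintro ⟨hx, hx'⟩
            have := he hx
            rw [mem_union, mem_singleton] at this
            refine this.resolve_right fun h => hx' (map_subset_map.2 (subset_univ _) h)
          · rintro rfl
            exact ⟨hue, hu⟩
        have h1 := sdiff_union_map_pre (emb := emb) e
        rw [hes] at h1
        rw [← h1, ← mem_trace, hutr]
        refine hsub (mem_powersetCard.2 ⟨fun i hi => ?_, ?_⟩)
        · have h2 := he (mem_filter.1 hi).2
          rw [mem_union, mem_singleton, mem_map'] at h2
          refine h2.resolve_left fun h => hu ?_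
          rw [← h]
          exact mem_map_of_mem _ (mem_univ i)
        · have h2 := card_union_map hud (pre emb e)
          rw [h1, hc, card_singleton] at h2
          omega
      · have he' : e ⊆ (firstFin s t).map emb := fun x hx => by
          have := he hx
          rw [mem_union, mem_singleton] at this
          exact this.resolve_left fun h => hue (h ▸ hx)
        exact (mem_compress_of_subset (he'.trans (map_subset_map.2 (subset_univ _)))).2
          (hfirst e he' hc)
  · have hsub : seg s r (trace emb E {u}).card ⊆ powersetCard r (firstFin s t) := by
      refine IsInitSeg.subset_of_card_le (isInitSeg_seg _ _ _) (isInitSeg_firstFin _ _ _) ?_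
      rw [card_seg hcu, card_powersetCard, card_firstFin (by omega)]
      exact hsmall.le
    refine (hcond u).trans ?_
    rw [copiesAt_eq, copiesAt_eq]
    unfold hdeg
    rw [card_eq_sum_trace (emb := emb), card_eq_sum_trace (emb := emb) (filter _ _)]
    refine sum_le_sum fun P hP => ?_
    rw [mem_powerset] at hP
    have hPd : Disjoint P (univ.map emb) := disjoint_of_subset_left hP disjoint_compl_left
    set 𝒬 := trace emb ((cliques E (r + 1) (κ + 1)).filter fun e => u ∈ e) P with h𝒬
    have hmem : ∀ Q ∈ 𝒬, u ∈ P ∧ IsCopy E (r + 1) (κ + 1) (P ∪ Q.map emb) := by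
      intro Q hQ
      rw [h𝒬, mem_trace, mem_filter, mem_cliques, mem_union] at hQ
      exact ⟨hQ.2.resolve_right fun h => hu (map_subset_map.2 (subset_univ _) h), hQ.1⟩
    have hsized : (𝒬 : Set (Finset (Fin s))).Sized (κ + 1 - P.card) := by
      intro Q hQ
      have := (hmem Q hQ).2.1
      rw [card_union_map hPd] at this
      omega
    have hcQ : 𝒬.card ≤ s.choose (κ + 1 - P.card) := by
      have : 𝒬 ⊆ powersetCard (κ + 1 - P.card) univ :=
        fun R hR => mem_powersetCard.2 ⟨subset_univ _, hsized hR⟩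
      simpa using card_le_card this
    rcases 𝒬.eq_empty_or_nonempty with h0 | ⟨Q₀, hQ₀⟩
    · rw [h0, card_empty]; exact Nat.zero_le _
    have hPκ : P.card ≤ κ + 1 := by
      have := (hmem Q₀ hQ₀).2.1
      rw [card_union_map hPd] at this
      omega
    have huP := (hmem Q₀ hQ₀).1
    rw [← card_seg hcQ]
    refine card_le_card fun Q hQ => ?_
    have hQc := (isInitSeg_seg s (κ + 1 - P.card) 𝒬.card).1 hQ
    have key : ∀ P' ⊆ P, P'.Nonempty → P'.card ≤ r + 1 → ∀ R ⊆ Q, P'.card + R.card = r + 1 →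
        P' ∪ R.map emb ∈ E' := by
      intro P' hP' hne' hc' R hR hcR
      have hPd' : Disjoint P' (univ.map emb) := disjoint_of_subset_left hP' hPd
      rw [← mem_trace, hE', trace_compress hPd' hne']
      by_cases hle : R.card ≤ κ + 1 - P.card
      · refine seg_subset_of_shadow hsized (by omega) (sized_trace hE hPd') ?_ rfl Q hQ R hR
          (by omega)
        intro Q' hQ' R' hR' hcR'
        rw [mem_trace]
        refine (hmem Q' hQ').2.2 _ (union_subset_union hP' (map_subset_map.2 hR')) ?_
        rw [card_union_map hPd']
        omega
      · have := card_le_card hR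
        omega
    rw [mem_trace, mem_filter, mem_cliques]
    refine ⟨⟨by rw [card_union_map hPd, hQc]; omega, fun f hf hfc => ?_⟩, mem_union_left _ huP⟩
    have hfd := sdiff_union_map_pre (emb := emb) f
    have hfP : f \ univ.map emb ⊆ P := by
      intro x hx
      rw [mem_sdiff] at hx
      have := hf hx.1
      rw [mem_union] at this
      exact this.resolve_right fun h => hx.2 (map_subset_map.2 (subset_univ _) h)
    have hfQ : pre emb f ⊆ Q := by
      intro i hi
      have := hf (mem_filter.1 hi).2
      rw [mem_union, mem_map'] at this
      refine this.resolve_left fun h => ?_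
      exact disjoint_left.1 hPd h (mem_map_of_mem _ (mem_univ i))
    have hfd' : Disjoint (f \ univ.map emb) (univ.map emb) := sdiff_disjoint
    have hcf := card_union_map hfd' (pre emb f)
    rw [hfd, hfc] at hcf
    rcases (f \ univ.map emb).eq_empty_or_nonempty with h0 | hne
    · rw [h0, empty_union] at hfd
      rw [h0, card_empty, zero_add] at hcf
      have hQfirst : Q ⊆ firstFin s t := by
        intro x hx
        have hle := card_le_card hfQ
        obtain ⟨T, hT, hTQ, hTc⟩ := exists_subsuperset_card_eq (s := {x}) (t := Q) (n := r)
          (by simpa using hx) (by simpa using hr) (by omega)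
        have h1 := key {u} (by simpa using huP) (singleton_nonempty u) (by simp) T hTQ
          (by rw [card_singleton, hTc, add_comm])
        rw [← mem_trace, hutr] at h1
        exact (mem_powersetCard.1 (hsub h1)).1 (hT (mem_singleton_self x))
      rw [← hfd] at hfc ⊢
      refine (mem_compress_of_subset (map_subset_map.2 (subset_univ _))).2 (hfirst _ ?_ hfc)
      exact map_subset_map.2 (hfQ.trans hQfirst)
    · rw [← hfd]
      exact key _ hfP hne (by omega) _ hfQ hcf.symm

end Compress

section LocalSparsity

variable {V : Type*}

theorem exists_emb {S T : Finset V} (hT : T ⊆ S) :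
    ∃ emb : Fin S.card ↪ V, univ.map emb = S ∧ (firstFin S.card T.card).map emb = T := by
  have hc : S.card = T.card + (S \ T).card := by
    rw [card_sdiff_of_subset hT]; have := card_le_card hT; omega
  have hdis : Disjoint T (S \ T) := disjoint_sdiff
  let x : Fin T.card ↪ V := T.equivFin.symm.toEmbedding.trans (Function.Embedding.subtype _)
  let y : Fin (S \ T).card ↪ V :=
    (S \ T).equivFin.symm.toEmbedding.trans (Function.Embedding.subtype _)
  have hx : ∀ i, x i ∈ T := fun i => (T.equivFin.symm i).2
  have hy : ∀ i, y i ∈ S \ T := fun i => ((S \ T).equivFin.symm i).2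
  have hxy : Disjoint (Set.range x) (Set.range y) := by
    rw [Set.disjoint_left]
    rintro _ ⟨i, rfl⟩ ⟨j, hj⟩
    exact disjoint_left.1 hdis (hx i) (hj ▸ hy j)
  let emb : Fin S.card ↪ V := (finCongr hc).toEmbedding.trans (Fin.Embedding.append hxy)
  have hsub : univ.map emb ⊆ S := by
    intro v hv
    obtain ⟨i, -, rfl⟩ := mem_map.1 hv
    change Fin.append x y (finCongr hc i) ∈ S
    refine Fin.addCases (fun a => ?_) (fun b => ?_) (finCongr hc i)
    · rw [Fin.append_left]; exact hT (hx a)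
    · rw [Fin.append_right]; exact (mem_sdiff.1 (hy b)).1
  have hsubT : (firstFin S.card T.card).map emb ⊆ T := by
    intro v hv
    obtain ⟨i, hi, rfl⟩ := mem_map.1 hv
    have hi' : (finCongr hc i).val < T.card := (mem_filter.1 hi).2
    change Fin.append x y (finCongr hc i) ∈ T
    have : finCongr hc i = Fin.castAdd _ ⟨(finCongr hc i).val, hi'⟩ := rfl
    rw [this, Fin.append_left]
    exact hx _
  refine ⟨emb, eq_of_subset_of_card_le hsub ?_, eq_of_subset_of_card_le hsubT ?_⟩
  · simp
  · rw [card_map, card_firstFin (card_le_card hT)]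

/-- Local sparsity of extremal hypergraphs. -/
theorem card_filter_subset_le [Fintype V] {r κ t : ℕ} (hr : 1 ≤ r)
    {E F : Finset (Finset V)} (hE : IsExtremal E (r + 1) (κ + 1) t) {S : Finset V}
    (hFl : IsLGraph (r + 1) F) (hFS : ∀ e ∈ F, e ⊆ S)
    (hF : ∀ v ∈ S, ∃ A ⊆ S, v ∈ A ∧ IsCopy F (r + 1) (t + 1) A) :
    (E.filter fun e => e ⊆ S).card ≤ F.card := by
  rcases S.eq_empty_or_nonempty with rfl | ⟨v, hv⟩
  · have : (E.filter fun e => e ⊆ ∅) = ∅ := by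
      rw [filter_eq_empty_iff]
      intro e he h
      have := hE.1 e he
      rw [subset_empty.1 h] at this
      simp at this
    rw [this]; simp
  obtain ⟨A, hAS, hvA, hA⟩ := hF v hv
  obtain ⟨T, hTA, hTc⟩ := exists_subset_card_eq (s := A) (n := t) (by rw [hA.1]; omega)
  obtain ⟨emb, hembS, hembT⟩ := exists_emb (hTA.trans hAS)
  have hts : t + 1 ≤ S.card := by rw [← hA.1]; exact card_le_card hAS
  rw [hTc] at hembT
  have hdc := degCond_compress (emb := emb) (F := F) hr hts hE.1 hE.2.1
    (by rw [hembS]; exact hF)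
    (by rw [hembT]; exact fun e he hc => hA.2 e (he.trans hTA) hc)
  have h1 := hE.2.2 _ (isLGraph_compress hE.1 hFl) hdc
  have h2 := card_compress_add (emb := emb) (F := F) hE.1 (by rw [hembS]; exact hFS)
  rw [hembS] at h2
  omega

end LocalSparsity

section Choose

theorem choose_add_le_add {a b : ℕ} (hab : a ≤ b) (d r : ℕ) :
    (a + d).choose (r + 1) + b.choose (r + 1) ≤ (b + d).choose (r + 1) + a.choose (r + 1) := by
  induction d with
  | zero => simp [add_comm]
  | succ d ih =>
    have h1 : (a + d + 1).choose (r + 1) = (a + d).choose r + (a + d).choose (r + 1) :=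
      Nat.choose_succ_succ _ _
    have h2 : (b + d + 1).choose (r + 1) = (b + d).choose r + (b + d).choose (r + 1) :=
      Nat.choose_succ_succ _ _
    have h3 : (a + d).choose r ≤ (b + d).choose r := Nat.choose_le_choose _ (by omega)
    rw [← add_assoc, ← add_assoc, h1, h2]
    omega

theorem choose_lt_choose_left {a b r : ℕ} (hab : a < b) (hr : 1 ≤ r) (hb : r ≤ b) :
    a.choose r < b.choose r := by
  obtain ⟨b, rfl⟩ : ∃ b', b = b' + 1 := ⟨b - 1, by omega⟩
  obtain ⟨r, rfl⟩ : ∃ r', r = r' + 1 := ⟨r - 1, by omega⟩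
  have h1 : (b + 1).choose (r + 1) = b.choose r + b.choose (r + 1) := Nat.choose_succ_succ _ _
  have h2 : 0 < b.choose r := Nat.choose_pos (by omega)
  have h3 : a.choose (r + 1) ≤ b.choose (r + 1) := Nat.choose_le_choose _ (by omega)
  omega

theorem choose_add_lt_add {a b d r : ℕ} (hab : a < b) (hd : 1 ≤ d) (hr : 1 ≤ r)
    (hb : r + 1 ≤ b + d) :
    (a + d).choose (r + 1) + b.choose (r + 1) < (b + d).choose (r + 1) + a.choose (r + 1) := by
  obtain ⟨d, rfl⟩ : ∃ d', d = d' + 1 := ⟨d - 1, by omega⟩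
  have h1 : (a + d + 1).choose (r + 1) = (a + d).choose r + (a + d).choose (r + 1) :=
    Nat.choose_succ_succ _ _
  have h2 : (b + d + 1).choose (r + 1) = (b + d).choose r + (b + d).choose (r + 1) :=
    Nat.choose_succ_succ _ _
  have h3 : (a + d).choose r < (b + d).choose r := choose_lt_choose_left (by omega) hr (by omega)
  have h4 := choose_add_le_add hab.le d r
  rw [← add_assoc, ← add_assoc, h1, h2]
  omega

end Choose

section Cover

variable {V : Type*}

/-- `F` is a union of copies of `K_{t+1}` covering `S`. -/
def IsCover (F : Finset (Finset V)) (ℓ t : ℕ) (S : Finset V) : Prop :=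
  IsLGraph ℓ F ∧ (∀ e ∈ F, e ⊆ S) ∧ ∀ v ∈ S, ∃ A ⊆ S, v ∈ A ∧ IsCopy F ℓ (t + 1) A

theorem IsCover.union {F F' : Finset (Finset V)} {ℓ t : ℕ} {S S' : Finset V}
    (h : IsCover F ℓ t S) (h' : IsCover F' ℓ t S') : IsCover (F ∪ F') ℓ t (S ∪ S') := by
  refine ⟨fun e he => ?_, fun e he => ?_, fun v hv => ?_⟩
  · rcases mem_union.1 he with he | he
    exacts [h.1 e he, h'.1 e he]
  · rcases mem_union.1 he with he | he
    exacts [(h.2.1 e he).trans subset_union_left, (h'.2.1 e he).trans subset_union_right]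
  · rcases mem_union.1 hv with hv | hv
    · obtain ⟨A, hA, hvA, hc⟩ := h.2.2 v hv
      exact ⟨A, hA.trans subset_union_left, hvA, hc.1,
        fun e he hce => mem_union_left _ (hc.2 e he hce)⟩
    · obtain ⟨A, hA, hvA, hc⟩ := h'.2.2 v hv
      exact ⟨A, hA.trans subset_union_right, hvA, hc.1,
        fun e he hce => mem_union_right _ (hc.2 e he hce)⟩

theorem isCover_powersetCard {ℓ t : ℕ} {A : Finset V} (hA : A.card = t + 1) :
    IsCover (powersetCard ℓ A) ℓ t A :=
  ⟨fun _ he => (mem_powersetCard.1 he).2, fun _ he => (mem_powersetCard.1 he).1,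
    fun _ hv => ⟨A, Subset.rfl, hv, hA, fun _ he hc => mem_powersetCard.2 ⟨he, hc⟩⟩⟩

theorem card_union_powersetCard (ℓ : ℕ) (A B : Finset V) :
    (powersetCard ℓ A ∪ powersetCard ℓ B).card + (A ∩ B).card.choose ℓ
      = A.card.choose ℓ + B.card.choose ℓ := by
  have h : powersetCard ℓ (A ∩ B) = powersetCard ℓ A ∩ powersetCard ℓ B := by
    ext e
    simp only [mem_powersetCard, mem_inter, subset_inter_iff]
    tauto
  rw [← card_powersetCard ℓ A, ← card_powersetCard ℓ B, ← card_powersetCard ℓ (A ∩ B), h,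
    card_union_add_card_inter]

theorem exists_cover {ℓ t : ℕ} {y : ℕ} (hy : y ≤ t + 1) (c : ℕ) : ∀ S : Finset V,
    S.card + y = (c + 2) * (t + 1) → ∃ F, IsCover F ℓ t S ∧
      F.card + y.choose ℓ ≤ (c + 2) * (t + 1).choose ℓ := by
  induction c with
  | zero =>
    intro S hS
    obtain ⟨A, hA, hAc⟩ := exists_subset_card_eq (s := S) (n := t + 1) (by omega)
    have hd : (S \ A).card + y = t + 1 := by
      have := card_sdiff_add_card_eq_card hA; omega
    obtain ⟨B, hB, hBS, hBc⟩ := exists_subsuperset_card_eq (s := S \ A) (t := S) (n := t + 1)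
      sdiff_subset (by omega) (by omega)
    have hu : A ∪ B = S := by
      refine subset_antisymm (union_subset hA hBS) fun x hx => ?_
      by_cases h : x ∈ A
      · exact mem_union_left _ h
      · exact mem_union_right _ (hB (mem_sdiff.2 ⟨hx, h⟩))
    refine ⟨powersetCard ℓ A ∪ powersetCard ℓ B, ?_, ?_⟩
    · rw [← hu]
      exact (isCover_powersetCard hAc).union (isCover_powersetCard hBc)
    · have h1 := card_union_powersetCard ℓ A B
      have h2 := card_union_add_card_inter A B
      rw [hu] at h2
      have h3 : (A ∩ B).card = y := by omega
      rw [h3, hAc, hBc] at h1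
      omega
  | succ c ih =>
    intro S hS
    have hS' : S.card + y = (c + 2) * (t + 1) + (t + 1) := by rw [hS]; ring
    have h2 : 1 * (t + 1) ≤ (c + 2) * (t + 1) := Nat.mul_le_mul_right _ (by omega)
    obtain ⟨A, hA, hAc⟩ := exists_subset_card_eq (s := S) (n := t + 1) (by omega)
    obtain ⟨F, hF, hFc⟩ := ih (S \ A) (by
      have := card_sdiff_add_card_eq_card hA; omega)
    refine ⟨F ∪ powersetCard ℓ A, ?_, ?_⟩
    · have := hF.union (isCover_powersetCard (ℓ := ℓ) hAc)
      rwa [sdiff_union_of_subset hA] at this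
    · have h1 := card_union_le F (powersetCard ℓ A)
      rw [card_powersetCard, hAc] at h1
      have : (c + 1 + 2) * (t + 1).choose ℓ = (c + 2) * (t + 1).choose ℓ + (t + 1).choose ℓ := by
        ring
      omega

/-- The number of edges inside `S`. -/
noncomputable def eIn (E : Finset (Finset V)) (S : Finset V) : ℕ :=
  (E.filter fun e => e ⊆ S).card

theorem eIn_le [Fintype V] {r κ t y c : ℕ} (hr : 1 ≤ r) {E : Finset (Finset V)}
    (hE : IsExtremal E (r + 1) (κ + 1) t) {S : Finset V} (hy : y ≤ t + 1) (hc : 2 ≤ c)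
    (hS : S.card + y = c * (t + 1)) :
    eIn E S + y.choose (r + 1) ≤ c * (t + 1).choose (r + 1) := by
  obtain ⟨c, rfl⟩ : ∃ c', c = c' + 2 := ⟨c - 2, by omega⟩
  obtain ⟨F, hF, hFc⟩ := exists_cover (ℓ := r + 1) hy c S hS
  have := card_filter_subset_le hr hE hF.1 hF.2.1 hF.2.2
  unfold eIn
  omega

theorem eIn_union_ge {E : Finset (Finset V)} {ℓ t : ℕ} {A : Finset V}
    (hA : IsCopy E ℓ (t + 1) A) (X : Finset V) :
    eIn E X + (t + 1).choose ℓ ≤ eIn E (X ∪ A) + (A ∩ X).card.choose ℓ := by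
  have h1 : (E.filter fun e => e ⊆ X) ∪ powersetCard ℓ A ⊆ E.filter fun e => e ⊆ X ∪ A := by
    refine union_subset (fun e he => ?_) fun e he => ?_
    · rw [mem_filter] at he ⊢
      exact ⟨he.1, he.2.trans subset_union_left⟩
    · rw [mem_powersetCard] at he
      exact mem_filter.2 ⟨hA.2 e he.1 he.2, he.1.trans subset_union_right⟩
  have h2 : (E.filter fun e => e ⊆ X) ∩ powersetCard ℓ A ⊆ powersetCard ℓ (A ∩ X) := by
    intro e he
    rw [mem_inter, mem_filter, mem_powersetCard] at he
    exact mem_powersetCard.2 ⟨subset_inter he.2.1 he.1.2, he.2.2⟩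
  have h3 := card_union_add_card_inter (E.filter fun e => e ⊆ X) (powersetCard ℓ A)
  have h4 := card_le_card h1
  have h5 := card_le_card h2
  rw [card_powersetCard] at h3 h5
  rw [hA.1] at h3
  unfold eIn
  omega

theorem eIn_union_disjoint {E : Finset (Finset V)} {ℓ : ℕ} (hℓ : 1 ≤ ℓ) (hE : IsLGraph ℓ E)
    {X Y : Finset V} (h : Disjoint X Y) : eIn E X + eIn E Y ≤ eIn E (X ∪ Y) := by
  unfold eIn
  rw [← card_union_of_disjoint]
  · refine card_le_card (union_subset (fun e he => ?_) fun e he => ?_)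
    · rw [mem_filter] at he ⊢
      exact ⟨he.1, he.2.trans subset_union_left⟩
    · rw [mem_filter] at he ⊢
      exact ⟨he.1, he.2.trans subset_union_right⟩
  · rw [disjoint_left]
    intro e h1 h2
    rw [mem_filter] at h1 h2
    have h3 : e ⊆ X ∩ Y := subset_inter h1.2 h2.2
    rw [disjoint_iff_inter_eq_empty.1 h] at h3
    have := hE e h1.1
    rw [subset_empty.1 h3] at this
    simp at this
    omega

end Cover

section Family

variable {V : Type*}

/-- A family of copies of `K_{t+1}` whose total overlap `o` satisfies `2 ≤ o < ℓ`. -/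
def GoodFamily (E : Finset (Finset V)) (ℓ t : ℕ) (𝒟 : Finset (Finset V)) (o : ℕ) : Prop :=
  (∀ A ∈ 𝒟, IsCopy E ℓ (t + 1) A) ∧ (𝒟.biUnion id).card + o = 𝒟.card * (t + 1) ∧ 2 ≤ o ∧ o < ℓ

theorem add_lt_of_eIn [Fintype V] {r κ t a b c : ℕ} (hr : 1 ≤ r) (hrt : r ≤ t)
    {E : Finset (Finset V)}
    (hE : IsExtremal E (r + 1) (κ + 1) t) {Z : Finset V} (hc : 3 ≤ c) (ha : 1 ≤ a) (hb : 1 ≤ b)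
    (hat : a ≤ t) (hbt : b ≤ t) (hZ : Z.card + (a + b) = c * (t + 1))
    (hZE : c * (t + 1).choose (r + 1) ≤ eIn E Z + a.choose (r + 1) + b.choose (r + 1)) :
    a + b < r + 1 := by
  by_contra hge
  push Not at hge
  rcases le_or_gt (a + b) (t + 1) with h | h
  · have h1 := eIn_le hr hE h (by omega) hZ
    have h2 := choose_add_lt_add (a := 0) (b := b) (d := a) (by omega) ha hr (by omega)
    simp only [zero_add, Nat.choose_zero_succ, add_zero] at h2
    rw [add_comm b a] at h2
    omega
  · obtain ⟨c, rfl⟩ : ∃ c', c = c' + 1 := ⟨c - 1, by omega⟩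
    obtain ⟨w, hw⟩ : ∃ w, a + b = t + 1 + w := ⟨a + b - (t + 1), by omega⟩
    have h1 := eIn_le hr hE (S := Z) (y := w) (c := c) (by omega) (by omega)
      (by rw [hw] at hZ; linarith)
    have h2 := choose_add_lt_add (a := w) (b := b) (d := t + 1 - b) (r := r)
      (by omega) (by omega) hr (by omega)
    rw [show w + (t + 1 - b) = a by omega, show b + (t + 1 - b) = t + 1 by omega] at h2
    rw [add_mul, one_mul] at hZE
    omega

theorem eIn_pair [Fintype V] {r κ t : ℕ} (hr : 1 ≤ r) {E : Finset (Finset V)}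
    (hE : IsExtremal E (r + 1) (κ + 1) t) {A₁ A₂ : Finset V}
    (h₁ : IsCopy E (r + 1) (t + 1) A₁) (h₂ : IsCopy E (r + 1) (t + 1) A₂) :
    (A₁ ∪ A₂).card + (A₁ ∩ A₂).card = 2 * (t + 1) ∧
    2 * (t + 1).choose (r + 1) = eIn E (A₁ ∪ A₂) + (A₁ ∩ A₂).card.choose (r + 1) ∧
    ∀ e ∈ E, e ⊆ A₁ ∪ A₂ → e ⊆ A₁ ∨ e ⊆ A₂ := by
  have hcard := card_union_add_card_inter A₁ A₂
  rw [h₁.1, h₂.1] at hcard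
  have hP := card_union_powersetCard (r + 1) A₁ A₂
  rw [h₁.1, h₂.1] at hP
  have hsub : powersetCard (r + 1) A₁ ∪ powersetCard (r + 1) A₂
      ⊆ E.filter fun e => e ⊆ A₁ ∪ A₂ := by
    intro e he
    rw [mem_union, mem_powersetCard, mem_powersetCard] at he
    rw [mem_filter]
    rcases he with he | he
    · exact ⟨h₁.2 e he.1 he.2, he.1.trans subset_union_left⟩
    · exact ⟨h₂.2 e he.1 he.2, he.1.trans subset_union_right⟩
  have hle := eIn_le hr hE (S := A₁ ∪ A₂) (y := (A₁ ∩ A₂).card) (c := 2)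
    (by rw [← h₁.1]; exact card_le_card inter_subset_left) le_rfl (by omega)
  have hge := card_le_card hsub
  have heq := eq_of_subset_of_card_le hsub (by unfold eIn at hle; omega)
  refine ⟨by omega, ?_, fun e he hs => ?_⟩
  · unfold eIn at hle ⊢; omega
  · have : e ∈ E.filter fun e => e ⊆ A₁ ∪ A₂ := mem_filter.2 ⟨he, hs⟩
    rw [← heq, mem_union, mem_powersetCard, mem_powersetCard] at this
    exact this.imp And.left And.left

theorem exists_mem_notMem_of_card {A B : Finset V} (hc : A.card = B.card) (hne : A ≠ B) :
    ∃ x ∈ A, x ∉ B := by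
  by_contra h
  push Not at h
  exact hne (eq_of_subset_of_card_le h hc.ge)

theorem card_inter_le_of_ne {A B : Finset V} {t : ℕ} (hA : A.card = t + 1) (hB : B.card = t + 1)
    (hne : A ≠ B) : (A ∩ B).card ≤ t := by
  obtain ⟨x, hxA, hxB⟩ := exists_mem_notMem_of_card (hA.trans hB.symm) hne
  have : (A ∩ B).card < A.card := card_lt_card ⟨inter_subset_left, fun h =>
    hxB (mem_inter.1 (h hxA)).2⟩
  omega

theorem goodFamily_of_triple [Fintype V] {r κ t : ℕ} (hr : 1 ≤ r) (hrt : r ≤ t)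
    {E : Finset (Finset V)}
    (hE : IsExtremal E (r + 1) (κ + 1) t) {A₁ A₂ B : Finset V}
    (h₁ : IsCopy E (r + 1) (t + 1) A₁) (h₂ : IsCopy E (r + 1) (t + 1) A₂)
    (hB : IsCopy E (r + 1) (t + 1) B) (h12 : A₁ ≠ A₂) (hne : (A₁ ∩ A₂).Nonempty)
    (hB1 : B ≠ A₁) (hB2 : B ≠ A₂) (hBne : (B ∩ (A₁ ∪ A₂)).Nonempty) :
    ∃ 𝒟 o, GoodFamily E (r + 1) t 𝒟 o := by
  obtain ⟨hc, he, hpure⟩ := eIn_pair hr hE h₁ h₂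
  have hnot : ¬ B ⊆ A₁ ∪ A₂ := by
    intro hsub
    obtain ⟨p, hpB, hp⟩ := exists_mem_notMem_of_card (hB.1.trans h₁.1.symm) hB1
    obtain ⟨q, hqB, hq⟩ := exists_mem_notMem_of_card (hB.1.trans h₂.1.symm) hB2
    obtain ⟨e, hpe, heB, hec⟩ := exists_subsuperset_card_eq (s := {p, q}) (t := B) (n := r + 1)
      (by simp [insert_subset_iff, hpB, hqB]) (card_le_two.trans (by omega))
      (by rw [hB.1]; omega)
    rcases hpure e (hB.2 e heB hec) (heB.trans hsub) with h | h
    · exact hp (h (hpe (by simp)))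
    · exact hq (h (hpe (by simp)))
  have hbt : (B ∩ (A₁ ∪ A₂)).card ≤ t := by
    have : (B ∩ (A₁ ∪ A₂)).card < B.card := card_lt_card ⟨inter_subset_left, fun h =>
      hnot (h.trans inter_subset_right)⟩
    rw [hB.1] at this
    omega
  have hcard := card_union_add_card_inter (A₁ ∪ A₂) B
  rw [inter_comm, hB.1] at hcard
  have hgrow := eIn_union_ge hB (A₁ ∪ A₂)
  have hZ : (A₁ ∪ A₂ ∪ B).card + ((A₁ ∩ A₂).card + (B ∩ (A₁ ∪ A₂)).card) = 3 * (t + 1) := by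
    omega
  have hlt := add_lt_of_eIn hr hrt hE (Z := A₁ ∪ A₂ ∪ B) (c := 3) le_rfl hne.card_pos
    hBne.card_pos (card_inter_le_of_ne h₁.1 h₂.1 h12) hbt hZ (by omega)
  refine ⟨{A₁, A₂, B}, _, ?_, ?_, ?_, hlt⟩
  · intro A hA
    simp only [mem_insert, mem_singleton] at hA
    rcases hA with rfl | rfl | rfl <;> assumption
  · have h3 : ({A₁, A₂, B} : Finset (Finset V)).card = 3 :=
      card_eq_three.2 ⟨_, _, _, h12, hB1.symm, hB2.symm, rfl⟩
    have h4 : ({A₁, A₂, B} : Finset (Finset V)).biUnion id = A₁ ∪ A₂ ∪ B := by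
      ext; simp
    rw [h3, h4, hZ]
  · have := hne.card_pos
    have := hBne.card_pos
    omega

theorem exists_goodFamily [Fintype V] {r κ t : ℕ} (hr : 1 ≤ r) (hrt : r ≤ t) {E : Finset (Finset V)}
    (hE : IsExtremal E (r + 1) (κ + 1) t) {A₁ A₂ A₃ A₄ : Finset V} (h12 : A₁ ≠ A₂) (h34 : A₃ ≠ A₄)
    (h₁ : IsCopy E (r + 1) (t + 1) A₁) (h₂ : IsCopy E (r + 1) (t + 1) A₂)
    (h₃ : IsCopy E (r + 1) (t + 1) A₃) (h₄ : IsCopy E (r + 1) (t + 1) A₄)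
    (hne12 : (A₁ ∩ A₂).Nonempty) (hne34 : (A₃ ∩ A₄).Nonempty)
    (hne : ({A₁, A₂} : Finset (Finset V)) ≠ {A₃, A₄}) :
    ∃ 𝒟 o, GoodFamily E (r + 1) t 𝒟 o := by
  have hmeet : ∀ B ∈ ({A₃, A₄} : Finset (Finset V)), B ∉ ({A₁, A₂} : Finset (Finset V)) →
      (B ∩ (A₁ ∪ A₂)).Nonempty → ∃ 𝒟 o, GoodFamily E (r + 1) t 𝒟 o := by
    intro B hB hB' hBne
    simp only [mem_insert, mem_singleton, not_or] at hB hB'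
    refine goodFamily_of_triple hr hrt hE h₁ h₂ ?_ h12 hne12 hB'.1 hB'.2 hBne
    rcases hB with rfl | rfl <;> assumption
  by_contra hno
  have hdis : ∀ B ∈ ({A₃, A₄} : Finset (Finset V)), B ∉ ({A₁, A₂} : Finset (Finset V)) →
      Disjoint (A₁ ∪ A₂) B := by
    intro B hB hB'
    by_contra h
    rw [disjoint_iff_inter_eq_empty, inter_comm, ← ne_eq, ← nonempty_iff_ne_empty] at h
    exact hno (hmeet B hB hB' h)
  have hx : ∀ B B', ({A₃, A₄} : Finset (Finset V)) = {B, B'} → (B ∩ B').Nonempty →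
      B' ∈ ({A₁, A₂} : Finset (Finset V)) → B ∈ ({A₁, A₂} : Finset (Finset V)) := by
    intro B B' h hne' hB'
    by_contra hB
    have h1 := hdis B (by rw [h]; simp) hB
    obtain ⟨x, hx⟩ := hne'
    rw [mem_inter] at hx
    refine disjoint_left.1 h1 ?_ hx.1
    rw [mem_insert, mem_singleton] at hB'
    rcases hB' with rfl | rfl
    · exact mem_union_left _ hx.2
    · exact mem_union_right _ hx.2
  have h3n : A₃ ∉ ({A₁, A₂} : Finset (Finset V)) := by
    intro h3
    have h4 := hx A₄ A₃ (pair_comm _ _) (by rwa [inter_comm]) h3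
    refine hne (eq_of_subset_of_card_le ?_ ?_).symm
    · exact insert_subset h3 (singleton_subset_iff.2 h4)
    · rw [card_pair h12, card_pair h34]
  have h4n : A₄ ∉ ({A₁, A₂} : Finset (Finset V)) := fun h4 => h3n (hx A₃ A₄ rfl hne34 h4)
  have hd3 := hdis A₃ (by simp) h3n
  have hd4 := hdis A₄ (by simp) h4n
  have hd : Disjoint (A₁ ∪ A₂) (A₃ ∪ A₄) := disjoint_union_right.2 ⟨hd3, hd4⟩
  obtain ⟨hc, he, -⟩ := eIn_pair hr hE h₁ h₂
  obtain ⟨hc', he', -⟩ := eIn_pair hr hE h₃ h₄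
  have hee := eIn_union_disjoint (by omega) hE.1 hd
  have hcc := card_union_of_disjoint hd
  have hZ : (A₁ ∪ A₂ ∪ (A₃ ∪ A₄)).card + ((A₁ ∩ A₂).card + (A₃ ∩ A₄).card) = 4 * (t + 1) := by
    omega
  have hlt := add_lt_of_eIn hr hrt hE (c := 4) (by omega) hne12.card_pos
    hne34.card_pos (card_inter_le_of_ne h₁.1 h₂.1 h12) (card_inter_le_of_ne h₃.1 h₄.1 h34) hZ
    (by omega)
  refine hno ⟨{A₁, A₂, A₃, A₄}, _, ?_, ?_, ?_, hlt⟩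
  · intro A hA
    simp only [mem_insert, mem_singleton] at hA
    rcases hA with rfl | rfl | rfl | rfl <;> assumption
  · simp only [mem_insert, mem_singleton, not_or] at h3n h4n
    have h5 : ({A₁, A₂, A₃, A₄} : Finset (Finset V)).card = 4 := by
      rw [card_insert_of_notMem, card_insert_of_notMem, card_pair h34]
      · simp [Ne.symm h3n.2, Ne.symm h4n.2]
      · simp [h12, Ne.symm h3n.1, Ne.symm h4n.1]
    have h6 : ({A₁, A₂, A₃, A₄} : Finset (Finset V)).biUnion id = A₁ ∪ A₂ ∪ (A₃ ∪ A₄) := by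
      ext; simp
    rw [h5, h6, hZ]
  · have := hne12.card_pos
    have := hne34.card_pos
    omega

end Family

section Structure

variable {V : Type*}

/-- The vertices covered by a family. -/
noncomputable def ground (𝒟 : Finset (Finset V)) : Finset V := 𝒟.biUnion id

theorem subset_ground {𝒟 : Finset (Finset V)} {A : Finset V} (hA : A ∈ 𝒟) : A ⊆ ground 𝒟 :=
  subset_biUnion_of_mem id hA

theorem card_ground_le {𝒟 : Finset (Finset V)} {m : ℕ} (h : ∀ A ∈ 𝒟, A.card = m) :
    (ground 𝒟).card ≤ 𝒟.card * m :=
  card_biUnion_le_card_mul _ _ _ fun A hA => (h A hA).le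

theorem GoodFamily.card_inter_le {E : Finset (Finset V)} {ℓ t o : ℕ} {𝒟 : Finset (Finset V)}
    (h : GoodFamily E ℓ t 𝒟 o) {A B : Finset V} (hA : A ∈ 𝒟) (hB : B ∈ 𝒟) (hne : A ≠ B) :
    (A ∩ B).card ≤ o := by
  have h1 : ground 𝒟 ⊆ (A ∪ B) ∪ ground ((𝒟.erase A).erase B) := by
    intro x hx
    obtain ⟨C, hC, hxC⟩ := mem_biUnion.1 hx
    by_cases h1 : C = A
    · subst h1; exact mem_union_left _ (mem_union_left _ hxC)
    by_cases h2 : C = B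
    · subst h2; exact mem_union_left _ (mem_union_right _ hxC)
    exact mem_union_right _ (mem_biUnion.2 ⟨C, by simp [h1, h2, hC], hxC⟩)
  have h2 := (card_le_card h1).trans (card_union_le _ _)
  have h3 := card_ground_le (𝒟 := (𝒟.erase A).erase B) (m := t + 1)
    fun C hC => (h.1 C (mem_of_mem_erase (mem_of_mem_erase hC))).1
  have h4 := card_union_add_card_inter A B
  have h5 := card_erase_add_one hA
  have h6 := card_erase_add_one (mem_erase.2 ⟨hne.symm, hB⟩ : B ∈ 𝒟.erase A)
  have h7 := h.2.1
  rw [← h5, ← h6, add_mul, add_mul] at h7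
  rw [(h.1 A hA).1, (h.1 B hB).1] at h4
  unfold ground at h2 h3
  omega

theorem GoodFamily.two_le_card {E : Finset (Finset V)} {ℓ t o : ℕ} {𝒟 : Finset (Finset V)}
    (h : GoodFamily E ℓ t 𝒟 o) : 2 ≤ 𝒟.card := by
  by_contra hlt
  have h2 := h.2.1
  have h3 := h.2.2.1
  obtain h0 | h1 : 𝒟.card = 0 ∨ 𝒟.card = 1 := by omega
  · rw [h0] at h2; omega
  · obtain ⟨A, rfl⟩ := card_eq_one.1 h1
    have := (h.1 A (by simp)).1
    simp at h2
    omega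

theorem GoodFamily.card_edges {E : Finset (Finset V)} {ℓ t o : ℕ} {𝒟 : Finset (Finset V)}
    (h : GoodFamily E ℓ t 𝒟 o) :
    (𝒟.biUnion (powersetCard ℓ)).card = 𝒟.card * (t + 1).choose ℓ := by
  rw [card_biUnion]
  · rw [sum_const_nat fun A hA => ?_]
    rw [card_powersetCard, (h.1 A hA).1]
  · intro A hA B hB hne
    refine disjoint_left.2 fun e heA heB => ?_
    rw [mem_powersetCard] at heA heB
    have h1 := card_le_card (subset_inter heA.1 heB.1)
    have h2 := h.card_inter_le hA hB hne
    have h3 := h.2.2.2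
    omega

theorem GoodFamily.exists_subset_of_card_sdiff_le [Fintype V] {r κ t o : ℕ} (hr : 1 ≤ r)
    (hrt : r ≤ t) {E : Finset (Finset V)} (hE : IsExtremal E (r + 1) (κ + 1) t)
    {𝒟 : Finset (Finset V)} (h : GoodFamily E (r + 1) t 𝒟 o) {f : Finset V} (hf : f ∈ E)
    (hfo : (f \ ground 𝒟).card ≤ o) : ∃ A ∈ 𝒟, f ⊆ A := by
  have hsub : 𝒟.biUnion (powersetCard (r + 1)) ⊆ E.filter fun e => e ⊆ ground 𝒟 ∪ f \ ground 𝒟 := by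
    intro e he
    obtain ⟨A, hA, heA⟩ := mem_biUnion.1 he
    rw [mem_powersetCard] at heA
    exact mem_filter.2 ⟨(h.1 A hA).2 e heA.1 heA.2,
      heA.1.trans ((subset_ground hA).trans subset_union_left)⟩
  have hS : (ground 𝒟 ∪ f \ ground 𝒟).card + (o - (f \ ground 𝒟).card) = 𝒟.card * (t + 1) := by
    rw [card_union_of_disjoint disjoint_sdiff]
    have := h.2.1
    unfold ground at hfo ⊢
    omega
  have ho := h.2.2.2
  have hle := eIn_le hr hE (by omega) h.two_le_card hS
  have heq := eq_of_subset_of_card_le hsub (by rw [h.card_edges]; unfold eIn at hle; omega)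
  have hmem : f ∈ E.filter fun e => e ⊆ ground 𝒟 ∪ f \ ground 𝒟 :=
    mem_filter.2 ⟨hf, fun x hx => by
      by_cases hx' : x ∈ ground 𝒟 <;> simp [hx, hx']⟩
  rw [← heq, mem_biUnion] at hmem
  obtain ⟨A, hA, hfA⟩ := hmem
  exact ⟨A, hA, (mem_powersetCard.1 hfA).1⟩

theorem exists_goodFamily_low_subset [Fintype V] {r κ t : ℕ} (hr : 1 ≤ r) (hκ : r < κ)
    (ht : κ ≤ t) {E : Finset (Finset V)} (hE : IsExtremal E (r + 1) (κ + 1) t)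
    (hex : ∃ 𝒟 o, GoodFamily E (r + 1) t 𝒟 o) :
    ∃ 𝒟 o, GoodFamily E (r + 1) t 𝒟 o ∧ ∀ v, hdeg E v ≤ t.choose r → v ∈ ground 𝒟 := by
  obtain ⟨𝒟, h𝒟, hmax⟩ := exists_max_image
    ((univ : Finset (Finset (Finset V))).filter fun 𝒟 => ∃ o, GoodFamily E (r + 1) t 𝒟 o) card
    (by obtain ⟨𝒟, h⟩ := hex; exact ⟨𝒟, by simpa using h⟩)
  rw [mem_filter] at h𝒟
  obtain ⟨-, o, hg⟩ := h𝒟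
  refine ⟨𝒟, o, hg, fun v hv => ?_⟩
  by_contra hvW
  have hDC : t.choose κ ≤ copiesAt E (r + 1) (κ + 1) v := by
    have := hE.2.1 v
    rwa [Nat.add_sub_cancel] at this
  obtain ⟨A, hvA, hA, -⟩ := exists_copy_of_hdeg_le hr hκ ht hE.1 hDC hv
  have hA𝒟 : A ∉ 𝒟 := fun h => hvW (subset_ground h hvA)
  have hyt : (A ∩ ground 𝒟).card ≤ t := by
    have : (A ∩ ground 𝒟).card < A.card := card_lt_card ⟨inter_subset_left, fun h =>
      hvW (mem_inter.1 (h hvA)).2⟩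
    rw [hA.1] at this
    omega
  have hgrow := eIn_union_ge hA (ground 𝒟)
  have hin : 𝒟.card * (t + 1).choose (r + 1) ≤ eIn E (ground 𝒟) := by
    rw [← hg.card_edges]
    refine card_le_card fun e he => ?_
    obtain ⟨B, hB, heB⟩ := mem_biUnion.1 he
    rw [mem_powersetCard] at heB
    exact mem_filter.2 ⟨(hg.1 B hB).2 e heB.1 heB.2, heB.1.trans (subset_ground hB)⟩
  have hcu := card_union_add_card_inter (ground 𝒟) A
  rw [inter_comm, hA.1] at hcu
  have hgc : (ground 𝒟).card + o = 𝒟.card * (t + 1) := hg.2.1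
  have hgu : ground (insert A 𝒟) = ground 𝒟 ∪ A := by
    unfold ground; rw [biUnion_insert, union_comm]; rfl
  have hci := card_insert_of_notMem hA𝒟
  have hZ : (ground 𝒟 ∪ A).card + (o + (A ∩ ground 𝒟).card) = (𝒟.card + 1) * (t + 1) := by
    rw [add_mul]; omega
  have h2 := hg.2.2.1
  have ho := hg.2.2.2
  have h3 := hg.two_le_card
  have hlt : o + (A ∩ ground 𝒟).card < r + 1 := by
    rcases Nat.eq_zero_or_pos (A ∩ ground 𝒟).card with h0 | h0
    · omega
    · refine add_lt_of_eIn hr (by omega) hE (c := 𝒟.card + 1) (by omega) (by omega) h0 (by omega)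
        hyt hZ ?_
      rw [add_mul]
      omega
  have hnew : GoodFamily E (r + 1) t (insert A 𝒟) (o + (A ∩ ground 𝒟).card) := by
    refine ⟨fun B hB => ?_, ?_, by omega, hlt⟩
    · rcases mem_insert.1 hB with rfl | hB
      exacts [hA, hg.1 B hB]
    · have : (insert A 𝒟).biUnion id = ground 𝒟 ∪ A := hgu
      rw [this, hci]
      exact hZ
  have := hmax (insert A 𝒟) (mem_filter.2 ⟨mem_univ _, _, hnew⟩)
  omega

/-- The members of the family that are disjoint from all the others. -/
theorem GoodFamily.card_meeting_le {E : Finset (Finset V)} {ℓ t o : ℕ} {𝒟 : Finset (Finset V)}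
    (h : GoodFamily E ℓ t 𝒟 o) :
    (𝒟.filter fun A => ∃ B ∈ 𝒟, B ≠ A ∧ (A ∩ B).Nonempty).card ≤ 2 * o := by
  set m : V → ℕ := fun v => (𝒟.filter fun A => v ∈ A).card with hm
  have hm1 : ∀ v ∈ ground 𝒟, 1 ≤ m v := by
    intro v hv
    obtain ⟨A, hA, hvA⟩ := mem_biUnion.1 hv
    exact card_pos.2 ⟨A, mem_filter.2 ⟨hA, hvA⟩⟩
  have hsum : ∑ v ∈ ground 𝒟, m v = 𝒟.card * (t + 1) := by
    refine (sum_card_bipartiteAbove_eq_sum_card_bipartiteBelow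
      (fun v (A : Finset V) => v ∈ A)).trans ?_
    rw [sum_const_nat (m := t + 1)]
    intro A hA
    rw [← (h.1 A hA).1]
    congr 1
    ext x
    simp only [bipartiteBelow, mem_filter]
    exact ⟨fun h => h.2, fun h => ⟨subset_ground hA h, h⟩⟩
  have hexc : ∑ v ∈ ground 𝒟, (m v - 1) = o := by
    have h1 : ∑ v ∈ ground 𝒟, (m v - 1) + (ground 𝒟).card = ∑ v ∈ ground 𝒟, m v := by
      rw [card_eq_sum_ones, ← sum_add_distrib]
      exact sum_congr rfl fun v hv => Nat.sub_add_cancel (hm1 v hv)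
    have h2 : (ground 𝒟).card + o = 𝒟.card * (t + 1) := h.2.1
    omega
  have hsub : (𝒟.filter fun A => ∃ B ∈ 𝒟, B ≠ A ∧ (A ∩ B).Nonempty) ⊆
      ((ground 𝒟).filter fun v => 2 ≤ m v).biUnion fun v => 𝒟.filter fun A => v ∈ A := by
    intro A hA
    obtain ⟨hA, B, hB, hne, x, hx⟩ := mem_filter.1 hA
    rw [mem_inter] at hx
    refine mem_biUnion.2 ⟨x, mem_filter.2 ⟨subset_ground hA hx.1, ?_⟩, mem_filter.2 ⟨hA, hx.1⟩⟩
    rw [← card_pair hne]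
    refine card_le_card ?_
    simp [insert_subset_iff, hA, hB, hx.1, hx.2]
  calc _ ≤ _ := card_le_card hsub
    _ ≤ ∑ v ∈ (ground 𝒟).filter (fun v => 2 ≤ m v), m v := card_biUnion_le
    _ ≤ ∑ v ∈ (ground 𝒟).filter (fun v => 2 ≤ m v), 2 * (m v - 1) :=
      sum_le_sum fun v hv => by have := (mem_filter.1 hv).2; omega
    _ ≤ ∑ v ∈ ground 𝒟, 2 * (m v - 1) := sum_le_sum_of_subset (filter_subset _ _)
    _ = 2 * o := by rw [← mul_sum, hexc]

theorem GoodFamily.exists_transversal [Fintype V] {r κ t o : ℕ} (hr : 1 ≤ r)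
    (hrt : r ≤ t) {E : Finset (Finset V)} (hE : IsExtremal E (r + 1) (κ + 1) t)
    {𝒟 : Finset (Finset V)} (h : GoodFamily E (r + 1) t 𝒟 o)
    (hiso : ∀ A, ¬ IsIsolatedCopy E (r + 1) t A) :
    ∃ J : Finset V, (∀ w ∈ J, ∃ A ∈ 𝒟, w ∈ A) ∧
      (∀ A ∈ 𝒟, ∀ w ∈ J, ∀ w' ∈ J, w ∈ A → w' ∈ A → w = w') ∧
      (∀ w ∈ J, ∃ f ∈ E, w ∈ f ∧ ¬ f ⊆ ground 𝒟) ∧ 𝒟.card ≤ J.card + 2 * o := by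
  set ℒ := 𝒟.filter fun A => ¬ ∃ B ∈ 𝒟, B ≠ A ∧ (A ∩ B).Nonempty with hℒ
  have hc : 𝒟.card ≤ ℒ.card + 2 * o := by
    have h1 := h.card_meeting_le
    have h2 := card_filter_add_card_filter_not (s := 𝒟)
      (fun A => ∃ B ∈ 𝒟, B ≠ A ∧ (A ∩ B).Nonempty)
    rw [← hℒ] at h2
    omega
  have hV : Nonempty V := by
    obtain ⟨B, hB⟩ := card_pos.1 (two_pos.trans_le h.two_le_card)
    obtain ⟨x, -⟩ := card_pos.1 (by rw [(h.1 B hB).1]; omega : 0 < B.card)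
    exact ⟨x⟩
  have hw : ∀ A : Finset V, ∃ w, A ∈ ℒ → w ∈ A ∧ ∃ f ∈ E, w ∈ f ∧ ¬ f ⊆ ground 𝒟 := by
    intro A
    by_cases hA : A ∈ ℒ
    swap
    · exact ⟨hV.some, fun h => absurd h hA⟩
    obtain ⟨hA𝒟, hlon⟩ := mem_filter.1 hA
    have h1 := hiso A
    unfold IsIsolatedCopy at h1
    push Not at h1
    obtain ⟨f, hf, ⟨w, hw⟩, hfA⟩ := h1 (h.1 A hA𝒟)
    rw [mem_inter] at hw
    refine ⟨w, fun _ => ⟨hw.2, f, hf, hw.1, fun hsub => ?_⟩⟩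
    obtain ⟨B, hB, hfB⟩ := h.exists_subset_of_card_sdiff_le hr hrt hE hf
      (by rw [sdiff_eq_empty_iff_subset.2 hsub]; simp)
    refine hlon ⟨B, hB, ?_, w, mem_inter.2 ⟨hw.2, hfB hw.1⟩⟩
    rintro rfl
    exact hfA hfB
  choose w hw using hw
  have hmem : ∀ A ∈ ℒ, ∀ B ∈ 𝒟, w A ∈ B → B = A := by
    intro A hA B hB hwB
    by_contra hne
    exact (mem_filter.1 hA).2 ⟨B, hB, hne, w A, mem_inter.2 ⟨(hw A hA).1, hwB⟩⟩
  refine ⟨ℒ.image w, ?_, ?_, ?_, ?_⟩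
  · rintro _ hx
    obtain ⟨A, hA, rfl⟩ := mem_image.1 hx
    exact ⟨A, (mem_filter.1 hA).1, (hw A hA).1⟩
  · intro B hB x hx y hy hxB hyB
    obtain ⟨A, hA, rfl⟩ := mem_image.1 hx
    obtain ⟨A', hA', rfl⟩ := mem_image.1 hy
    rw [← hmem A hA B hB hxB, ← hmem A' hA' B hB hyB]
  · rintro _ hx
    obtain ⟨A, hA, rfl⟩ := mem_image.1 hx
    exact (hw A hA).2
  · rw [card_image_of_injOn]
    · exact hc
    · intro A hA B hB hAB
      refine (hmem B hB A (mem_filter.1 hA).1 ?_)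
      rw [← hAB]
      exact (hw A hA).1

end Structure

section Excess

theorem choose_sub_mul_le (m x s : ℕ) (hs : 1 ≤ s) :
    (m - x).choose s * m ≤ (m - x) * m.choose s := by
  obtain ⟨s, rfl⟩ : ∃ s', s = s' + 1 := ⟨s - 1, by omega⟩
  rcases Nat.eq_zero_or_pos (m - x) with h0 | h0
  · rw [h0]; simp
  obtain ⟨a, ha⟩ : ∃ a, m - x = a + 1 := ⟨m - x - 1, by omega⟩
  obtain ⟨b, rfl⟩ : ∃ b, m = b + 1 := ⟨m - 1, by omega⟩
  rw [ha]
  have h1 := Nat.add_one_mul_choose_eq a s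
  have h2 := Nat.add_one_mul_choose_eq b s
  have h3 : a.choose s ≤ b.choose s := Nat.choose_le_choose _ (by omega)
  refine Nat.le_of_mul_le_mul_left ?_ (show 0 < s + 1 by omega)
  calc (s + 1) * ((a + 1).choose (s + 1) * (b + 1))
      = ((a + 1).choose (s + 1) * (s + 1)) * (b + 1) := by ring
    _ = (a + 1) * a.choose s * (b + 1) := by rw [h1]
    _ ≤ (a + 1) * b.choose s * (b + 1) := by gcongr
    _ = (a + 1) * ((b + 1) * b.choose s) := by ring
    _ = (s + 1) * ((a + 1) * (b + 1).choose (s + 1)) := by rw [h2]; ring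

theorem choose_le_choose_sub_add (m s x : ℕ) (hs : 1 ≤ s) (hx : x ≤ m + 1) :
    2 * m * (m + 1).choose (s + 1) ≤
      2 * m * (m + 1 - x).choose (s + 1) + m.choose s * (x * (2 * m + 1 - x)) := by
  induction x with
  | zero => simp
  | succ x ih =>
    have h1 := ih (by omega)
    obtain ⟨a, ha⟩ : ∃ a, m = x + a := ⟨m - x, by omega⟩
    have h2 : m + 1 - x = a + 1 := by omega
    have h3 : m + 1 - (x + 1) = a := by omega
    have h4 := choose_sub_mul_le m x s hs
    rw [show m - x = a by omega] at h4
    rw [h2, Nat.choose_succ_succ a s] at h1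
    rw [h3]
    have h5 : 2 * m + 1 - x = x + 2 * a + 1 := by omega
    have h6 : 2 * m + 1 - (x + 1) = x + 2 * a := by omega
    rw [h5] at h1
    rw [h6]
    have h7 : m.choose s * (x * (x + 2 * a + 1)) + 2 * (a * m.choose s) =
      m.choose s * ((x + 1) * (x + 2 * a)) := by ring
    have h8 : 2 * m * (a.choose s + a.choose (s + 1)) =
      2 * (a.choose s * m) + 2 * m * a.choose (s + 1) := by ring
    simp only [Nat.succ_eq_add_one] at h1
    omega

variable {V : Type*}

theorem sum_excess_le [Fintype V] {r κ t y c : ℕ} (hr : 1 ≤ r) {E : Finset (Finset V)}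
    (hE : IsExtremal E (r + 1) (κ + 1) t) (hy : y ≤ t) (hc : 2 ≤ c)
    (hV : Fintype.card V + y = c * (t + 1)) :
    ∑ v, hdeg E v + y * (y - 1).choose r ≤ (Fintype.card V + y) * t.choose r := by
  have h1 := eIn_le hr hE (S := univ) (y := y) (c := c) (by omega) hc hV
  have h2 : eIn E univ = E.card := by simp [eIn]
  rw [h2] at h1
  have h3 := sum_hdeg hE.1
  have h4 : (r + 1) * (t + 1).choose (r + 1) = (t + 1) * t.choose r := by
    rw [Nat.add_one_mul_choose_eq]; ring
  have h5 : (r + 1) * y.choose (r + 1) = y * (y - 1).choose r := by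
    rcases y with _ | y
    · simp
    · rw [Nat.add_sub_cancel, Nat.add_one_mul_choose_eq]; ring
  rw [h3, hV, ← h5]
  calc (r + 1) * E.card + (r + 1) * y.choose (r + 1) = (r + 1) * (E.card + y.choose (r + 1)) := by
        ring
    _ ≤ (r + 1) * (c * (t + 1).choose (r + 1)) := Nat.mul_le_mul_left _ h1
    _ = c * ((r + 1) * (t + 1).choose (r + 1)) := by ring
    _ = c * (t + 1) * t.choose r := by rw [h4]; ring

theorem sum_hdeg_sub_le [Fintype V] {r κ t : ℕ} (hr : 2 ≤ r) {E : Finset (Finset V)}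
    (hE : IsExtremal E (r + 1) (κ + 1) t) (ht : 100 ≤ t) (hV : t + 1 < Fintype.card V)
    (hdeg_ge : ∀ v, t.choose r ≤ hdeg E v) :
    200 * ∑ v, (hdeg E v - t.choose r) ≤ 41 * ((t + 1) ^ 2 * (t - 1).choose (r - 1)) := by
  obtain ⟨c, y, hy, hcy⟩ : ∃ c y, y ≤ t ∧ Fintype.card V + y = c * (t + 1) := by
    refine ⟨(Fintype.card V + t) / (t + 1), t - (Fintype.card V + t) % (t + 1), by omega, ?_⟩
    have h1 := Nat.div_add_mod (Fintype.card V + t) (t + 1)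
    have h2 := Nat.mod_lt (Fintype.card V + t) (show 0 < t + 1 by omega)
    rw [mul_comm] at h1
    omega
  have hc : 2 ≤ c := by
    by_contra h
    have : c * (t + 1) ≤ 1 * (t + 1) := Nat.mul_le_mul_right _ (by omega)
    omega
  have h1 := sum_excess_le (by omega) hE hy hc hcy
  have h2 : ∑ v, (hdeg E v - t.choose r) + Fintype.card V * t.choose r = ∑ v, hdeg E v := by
    rw [← smul_eq_mul, ← card_univ, ← sum_const, ← sum_add_distrib]
    exact sum_congr rfl fun v _ => Nat.sub_add_cancel (hdeg_ge v)
  set X := ∑ v, (hdeg E v - t.choose r)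
  rw [← h2, add_mul] at h1
  have h3 : X + y * (y - 1).choose r ≤ y * t.choose r := by omega
  obtain ⟨s, rfl⟩ : ∃ s, r = s + 1 := ⟨r - 1, by omega⟩
  obtain ⟨m, rfl⟩ : ∃ m, t = m + 1 := ⟨t - 1, by omega⟩
  simp only [Nat.add_sub_cancel] at h3 ⊢
  rcases Nat.eq_zero_or_pos y with h0 | h0
  · subst h0
    have : X = 0 := by omega
    rw [this]; simp
  have h4 := choose_le_choose_sub_add m s (m + 2 - y) (by omega) (by omega)
  rw [show m + 1 - (m + 2 - y) = y - 1 by omega, show 2 * m + 1 - (m + 2 - y) = m + y - 1 by omega]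
    at h4
  have h5 : 2 * m * X ≤ m.choose s * (y * ((m + 2 - y) * (m + y - 1))) := by
    have := Nat.mul_le_mul_left y h4
    have := Nat.mul_le_mul_left (2 * m) h3
    nlinarith
  have h6 : 200 * (y * ((m + 2 - y) * (m + y - 1))) ≤ 2 * m * (41 * (m + 1 + 1) ^ 2) := by
    obtain ⟨x, hx⟩ : ∃ x, m + 2 = y + x := ⟨m + 2 - y, by omega⟩
    have h7 : (m + 2 - y) * (m + y - 1) ≤ x * (x + 2 * y) :=
      Nat.mul_le_mul (by omega) (by omega)
    have h8 : 5 * (y * (x * (x + 2 * y))) ≤ 2 * (y + x) ^ 3 := by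
      zify
      have hy0 : (0 : ℤ) ≤ y := by positivity
      have hx0 : (0 : ℤ) ≤ x := by positivity
      nlinarith [mul_nonneg hx0 (sq_nonneg ((5 : ℤ) * x - 4 * y)),
        mul_nonneg hy0 (sq_nonneg ((8 : ℤ) * x - 6 * y)), mul_nonneg hy0 (sq_nonneg (x : ℤ)),
        mul_nonneg hx0 (sq_nonneg (x : ℤ)), mul_nonneg hy0 (sq_nonneg (y : ℤ)),
        mul_nonneg hx0 (sq_nonneg (y : ℤ)), mul_nonneg hy0 (sq_nonneg ((7 : ℤ) * x - 5 * y)),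
        mul_nonneg hx0 (sq_nonneg ((7 : ℤ) * x - 5 * y))]
    have h9 : 40 * (y + x) ≤ 41 * m := by omega
    calc 200 * (y * ((m + 2 - y) * (m + y - 1))) ≤ 200 * (y * (x * (x + 2 * y))) := by gcongr
      _ = 40 * (5 * (y * (x * (x + 2 * y)))) := by ring
      _ ≤ 40 * (2 * (y + x) ^ 3) := by gcongr
      _ = 2 * (40 * (y + x)) * (y + x) ^ 2 := by ring
      _ ≤ 2 * (41 * m) * (y + x) ^ 2 := by gcongr
      _ = 2 * m * (41 * (m + 1 + 1) ^ 2) := by rw [show m + 1 + 1 = y + x by omega]; ring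
  refine Nat.le_of_mul_le_mul_left ?_ (show 0 < 2 * m by omega)
  calc 2 * m * (200 * X) = 200 * (2 * m * X) := by ring
    _ ≤ 200 * (m.choose s * (y * ((m + 2 - y) * (m + y - 1)))) := by gcongr
    _ = m.choose s * (200 * (y * ((m + 2 - y) * (m + y - 1)))) := by ring
    _ ≤ m.choose s * (2 * m * (41 * (m + 1 + 1) ^ 2)) := by gcongr
    _ = 2 * m * (41 * ((m + 1 + 1) ^ 2 * m.choose s)) := by ring

end Excess

section State

variable {V : Type*}

/-- Extremal hypergraphs in which all the members of the family `𝒟` are copies of `K_{t+1}`. -/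
def IsState [Fintype V] (E : Finset (Finset V)) (r κ t : ℕ) (𝒟 : Finset (Finset V)) (o : ℕ) :
    Prop :=
  IsExtremal E (r + 1) (κ + 1) t ∧ GoodFamily E (r + 1) t 𝒟 o

/-- The copies of `K_k` at `v` that avoid `Z` and are not contained in `W`. -/
noncomputable def mcop [Fintype V] (E : Finset (Finset V)) (ℓ k : ℕ) (W Z : Finset V) (v : V) :
    Finset (Finset V) :=
  univ.filter fun K => v ∈ K ∧ IsCopy E ℓ k K ∧ ¬ K ⊆ W ∧ Disjoint K Z

/-- The edges at `v` that are not contained in `W`. -/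
noncomputable def medge (E : Finset (Finset V)) (W : Finset V) (v : V) : Finset (Finset V) :=
  E.filter fun f => v ∈ f ∧ ¬ f ⊆ W

theorem mem_mcop [Fintype V] {E : Finset (Finset V)} {ℓ k : ℕ} {W Z : Finset V} {v : V}
    {K : Finset V} :
    K ∈ mcop E ℓ k W Z v ↔ v ∈ K ∧ IsCopy E ℓ k K ∧ ¬ K ⊆ W ∧ Disjoint K Z := by
  simp [mcop]

theorem mem_medge {E : Finset (Finset V)} {W : Finset V} {v : V} {f : Finset V} :
    f ∈ medge E W v ↔ f ∈ E ∧ v ∈ f ∧ ¬ f ⊆ W := by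
  simp [medge]

theorem card_mcop_empty [Fintype V] {E : Finset (Finset V)} {ℓ k : ℕ} {W : Finset V} {v : V}
    (hv : v ∉ W) : (mcop E ℓ k W ∅ v).card = copiesAt E ℓ k v := by
  unfold mcop copiesAt
  congr 1
  ext K
  simp only [mem_filter, mem_univ, true_and, disjoint_empty_right, and_true]
  exact ⟨fun h => ⟨h.1, h.2.1⟩, fun h => ⟨h.1, h.2, fun hK => hv (hK h.1)⟩⟩

variable [Fintype V] {E : Finset (Finset V)} {r κ t o : ℕ} {𝒟 : Finset (Finset V)}

theorem IsState.choose_le_mcop (h : IsState E r κ t 𝒟 o) {v : V} (hv : v ∉ ground 𝒟) :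
    t.choose κ ≤ (mcop E (r + 1) (κ + 1) (ground 𝒟) ∅ v).card := by
  rw [card_mcop_empty hv]
  have := h.1.2.1 v
  rwa [Nat.add_sub_cancel] at this

theorem IsState.subset_of_card_le_two (h : IsState E r κ t 𝒟 o) (hr : 1 ≤ r) (hrt : r ≤ t)
    {f : Finset V} (hf : f ∈ E) (hc : (f \ ground 𝒟).card ≤ 2) : ∃ A ∈ 𝒟, f ⊆ A :=
  h.2.exists_subset_of_card_sdiff_le hr hrt h.1 hf (hc.trans h.2.2.2.1)

/-- A copy that leaves the ground set has fewer than `ℓ - 1` vertices in the ground set. -/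
theorem IsState.card_inter_lt (h : IsState E r κ t 𝒟 o) (hr : 1 ≤ r) (hrt : r ≤ t)
    {p : ℕ} {K : Finset V} (hK : IsCopy E (r + 1) p K) (hKW : ¬ K ⊆ ground 𝒟) :
    (K ∩ ground 𝒟).card < r := by
  by_contra hge
  push Not at hge
  obtain ⟨x, hxK, hx⟩ := not_subset.1 hKW
  obtain ⟨Q, hQ, hQc⟩ := exists_subset_card_eq hge
  have hxQ : x ∉ Q := fun h' => hx (mem_inter.1 (hQ h')).2
  have he : insert x Q ∈ E := hK.2 _
    (insert_subset hxK (hQ.trans inter_subset_left)) (by rw [card_insert_of_notMem hxQ, hQc])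
  have hsub : insert x Q \ ground 𝒟 ⊆ {x} := by
    intro y hy
    rw [mem_sdiff, mem_insert] at hy
    rcases hy.1 with rfl | hy'
    · simp
    · exact absurd (mem_inter.1 (hQ hy')).2 hy.2
  obtain ⟨A, hA, hsA⟩ := h.subset_of_card_le_two hr hrt he
    ((card_le_card hsub).trans (by simp))
  exact hx (subset_ground hA (hsA (mem_insert_self _ _)))

theorem IsState.not_subset_of_copy (h : IsState E r κ t 𝒟 o) (hr : 1 ≤ r) (hrt : r ≤ t)
    {p : ℕ} {K : Finset V} (hK : IsCopy E (r + 1) p K) (hKW : ¬ K ⊆ ground 𝒟) {e : Finset V}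
    (he : e ⊆ K) (hc : e.card = r + 1) : ¬ e ⊆ ground 𝒟 := by
  intro heW
  have h1 := h.card_inter_lt hr hrt hK hKW
  have h2 := card_le_card (subset_inter he heW)
  omega

/-- In an extremal hypergraph every edge lies in a copy. -/
theorem IsExtremal.exists_copy {ℓ k : ℕ} (h : IsExtremal E ℓ k t) {e : Finset V} (he : e ∈ E) :
    ∃ K, e ⊆ K ∧ IsCopy E ℓ k K := by
  by_contra hno
  push Not at hno
  have hle := h.2.2 (E.erase e) (fun f hf => h.1 f (mem_of_mem_erase hf)) (fun v => by
    refine (h.2.1 v).trans (card_le_card fun K hK => ?_)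
    rw [mem_filter] at hK ⊢
    refine ⟨hK.1, hK.2.1, hK.2.2.1, fun f hf hc => mem_erase.2 ⟨?_, hK.2.2.2 f hf hc⟩⟩
    rintro rfl
    exact hno K hf hK.2.2)
  have := card_erase_add_one he
  omega

end State

section Shift

variable {V : Type*}

/-- The edges moved by the compression replacing `w` by `z`. -/
noncomputable def moved (E : Finset (Finset V)) (W : Finset V) (w z : V) : Finset (Finset V) :=
  E.filter fun f => w ∈ f ∧ ¬ f ⊆ W ∧ z ∉ f ∧ insert z (f.erase w) ∉ E

/-- The compression replacing `w` by `z` in the edges not contained in `W`. -/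
noncomputable def shift (E : Finset (Finset V)) (W : Finset V) (w z : V) : Finset (Finset V) :=
  (E \ moved E W w z) ∪ (moved E W w z).image fun f => insert z (f.erase w)

theorem swap_inj {w z : V} {K K' : Finset V} (hw : w ∈ K) (hw' : w ∈ K') (hz : z ∉ K)
    (hz' : z ∉ K') (h : insert z (K.erase w) = insert z (K'.erase w)) : K = K' := by
  have h1 : (insert z (K.erase w)).erase z = (insert z (K'.erase w)).erase z := by rw [h]
  rw [erase_insert (fun h => hz (mem_of_mem_erase h)),
    erase_insert (fun h => hz' (mem_of_mem_erase h))] at h1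
  rw [← insert_erase hw, ← insert_erase hw', h1]

theorem card_swap {w z : V} {K : Finset V} (hw : w ∈ K) (hz : z ∉ K) :
    (insert z (K.erase w)).card = K.card := by
  rw [card_insert_of_notMem (fun h => hz (mem_of_mem_erase h)), card_erase_add_one hw]

variable {E : Finset (Finset V)} {W : Finset V} {w z : V}

theorem mem_moved {f : Finset V} :
    f ∈ moved E W w z ↔ f ∈ E ∧ w ∈ f ∧ ¬ f ⊆ W ∧ z ∉ f ∧ insert z (f.erase w) ∉ E := by
  simp [moved]

theorem mem_shift {f : Finset V} : f ∈ shift E W w z ↔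
    (f ∈ E ∧ f ∉ moved E W w z) ∨ ∃ g ∈ moved E W w z, insert z (g.erase w) = f := by
  simp [shift]

theorem card_shift : (shift E W w z).card = E.card := by
  unfold shift
  rw [card_union_of_disjoint, card_image_of_injOn,
    card_sdiff_add_card_eq_card (show moved E W w z ⊆ E from filter_subset _ _)]
  · intro f hf g hg hfg
    have hf := mem_moved.1 hf
    have hg := mem_moved.1 hg
    exact swap_inj hf.2.1 hg.2.1 hf.2.2.2.1 hg.2.2.2.1 hfg
  · rw [disjoint_left]
    intro f hf hf'
    obtain ⟨g, hg, rfl⟩ := mem_image.1 hf'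
    exact (mem_moved.1 hg).2.2.2.2 (mem_sdiff.1 hf).1

theorem isLGraph_shift {ℓ : ℕ} (h : IsLGraph ℓ E) : IsLGraph ℓ (shift E W w z) := by
  intro f hf
  rcases mem_shift.1 hf with hf | ⟨g, hg, rfl⟩
  · exact h f hf.1
  · have hg := mem_moved.1 hg
    rw [card_swap hg.2.1 hg.2.2.2.1]
    exact h g hg.1

theorem mem_shift_of_notMem {f : Finset V} (hf : f ∈ E) (hw : w ∉ f) : f ∈ shift E W w z :=
  mem_shift.2 (Or.inl ⟨hf, fun h => hw (mem_moved.1 h).2.1⟩)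

theorem mem_shift_of_subset {f : Finset V} (hf : f ∈ E) (hW : f ⊆ W) : f ∈ shift E W w z :=
  mem_shift.2 (Or.inl ⟨hf, fun h => (mem_moved.1 h).2.2.1 hW⟩)

/-- Copies destroyed by the compression give rise to new ones. -/
theorem isCopy_swap {ℓ p : ℕ} (hwz : w ≠ z) {K : Finset V} (hK : IsCopy E ℓ p K)
    (hKW : ∀ e ⊆ K, e.card = ℓ → ¬ e ⊆ W) (hKn : ¬ IsCopy (shift E W w z) ℓ p K) :
    w ∈ K ∧ z ∉ K ∧ IsCopy (shift E W w z) ℓ p (insert z (K.erase w)) ∧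
      ¬ IsCopy E ℓ p (insert z (K.erase w)) := by
  have h1 : ∃ e ⊆ K, e.card = ℓ ∧ e ∉ shift E W w z := by
    by_contra hno
    push Not at hno
    exact hKn ⟨hK.1, hno⟩
  obtain ⟨e, heK, hec, he⟩ := h1
  have heE := hK.2 e heK hec
  have hem : e ∈ moved E W w z := by
    by_contra h
    exact he (mem_shift.2 (Or.inl ⟨heE, h⟩))
  obtain ⟨-, hwe, heW, hze, hne⟩ := mem_moved.1 hem
  have hwK := heK hwe
  have hzK : z ∉ K := fun hz => hne (hK.2 _
    (insert_subset hz ((erase_subset _ _).trans heK)) (by rw [card_swap hwe hze, hec]))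
  have hsub : insert z (e.erase w) ⊆ insert z (K.erase w) :=
    insert_subset_insert _ (erase_subset_erase _ heK)
  refine ⟨hwK, hzK, ⟨by rw [card_swap hwK hzK, hK.1], fun g hg hgc => ?_⟩,
    fun h => hne (h.2 _ hsub (by rw [card_swap hwe hze, hec]))⟩
  have hwg : w ∉ g := fun h => by
    have := hg h
    simp [hwz] at this
  by_cases hzg : z ∈ g
  · by_cases hgE : g ∈ E
    · exact mem_shift_of_notMem hgE hwg
    have hg0 : insert w (g.erase z) ⊆ K := by
      refine insert_subset hwK fun x hx => ?_
      have h2 := hg (mem_of_mem_erase hx)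
      rw [mem_insert] at h2
      rcases h2 with rfl | h2
      · simp at hx
      · exact mem_of_mem_erase h2
    have hg0c : (insert w (g.erase z)).card = ℓ := by rw [card_swap hzg hwg, hgc]
    have hback : insert z ((insert w (g.erase z)).erase w) = g := by
      rw [erase_insert (fun h => hwg (mem_of_mem_erase h)), insert_erase hzg]
    refine mem_shift.2 (Or.inr ⟨insert w (g.erase z), mem_moved.2 ⟨hK.2 _ hg0 hg0c,
      mem_insert_self _ _, hKW _ hg0 hg0c, ?_, ?_⟩, hback⟩)
    · simp [hwz.symm]
    · rwa [hback]
  · refine mem_shift_of_notMem (hK.2 g (fun x hx => ?_) hgc) hwg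
    have h2 := hg hx
    rw [mem_insert] at h2
    rcases h2 with rfl | h2
    · exact absurd hx hzg
    · exact mem_of_mem_erase h2

/-- The degree outside `W` of a vertex of `W` does not increase. -/
theorem card_medge_shift_le (hz : z ∉ W) {v : V} (hv : v ∈ W) :
    (medge (shift E W w z) W v).card ≤ (medge E W v).card := by
  have hvz : v ≠ z := by rintro rfl; exact hz hv
  have hsub : medge (shift E W w z) W v ⊆ (medge E W v \ moved E W w z) ∪
      ((moved E W w z).filter fun f => v ∈ f).image fun f => insert z (f.erase w) := by
    intro f hf
    obtain ⟨hf, hvf, hfW⟩ := mem_medge.1 hf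
    rcases mem_shift.1 hf with hf | ⟨g, hg, rfl⟩
    · exact mem_union_left _ (mem_sdiff.2 ⟨mem_medge.2 ⟨hf.1, hvf, hfW⟩, hf.2⟩)
    · refine mem_union_right _ (mem_image.2 ⟨g, mem_filter.2 ⟨hg, ?_⟩, rfl⟩)
      rw [mem_insert] at hvf
      exact mem_of_mem_erase (hvf.resolve_left hvz)
  have hsub2 : ((moved E W w z).filter fun f => v ∈ f) = medge E W v ∩ moved E W w z := by
    ext f
    rw [mem_filter, mem_inter, mem_medge]
    exact ⟨fun h => ⟨⟨(mem_moved.1 h.1).1, h.2, (mem_moved.1 h.1).2.2.1⟩, h.1⟩,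
      fun h => ⟨h.2, h.1.2.1⟩⟩
  have h1 := (card_le_card hsub).trans (card_union_le _ _)
  have h2 := card_image_le (s := (moved E W w z).filter fun f => v ∈ f)
    (f := fun f => insert z (f.erase w))
  rw [hsub2] at h2 h1
  have h3 := card_sdiff_add_card_inter (medge E W v) (moved E W w z)
  omega

theorem card_medge_shift_lt (hwz : w ≠ z) {f : Finset V} (hf : f ∈ moved E W w z) :
    (medge (shift E W w z) W w).card < (medge E W w).card := by
  refine card_lt_card ⟨fun g hg => ?_, fun hs => ?_⟩
  · obtain ⟨hg, hwg, hgW⟩ := mem_medge.1 hg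
    rcases mem_shift.1 hg with hg | ⟨g', hg', rfl⟩
    · exact mem_medge.2 ⟨hg.1, hwg, hgW⟩
    · simp [hwz] at hwg
  · have hf' := mem_moved.1 hf
    have := mem_medge.1 (hs (mem_medge.2 ⟨hf'.1, hf'.2.1, hf'.2.2.1⟩))
    rcases mem_shift.1 this.1 with h | ⟨g, hg, hgf⟩
    · exact h.2 hf
    · have := hf'.2.2.2.1
      rw [← hgf] at this
      simp at this

variable [Fintype V] {r κ t o : ℕ} {𝒟 : Finset (Finset V)}

theorem IsState.isCopy_swap (h : IsState E r κ t 𝒟 o) (hr : 1 ≤ r) (hrt : r ≤ t) {p : ℕ}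
    (hw : w ∈ ground 𝒟) (hz : z ∉ ground 𝒟) {K : Finset V} (hK : IsCopy E (r + 1) p K)
    (hKW : ¬ K ⊆ ground 𝒟) (hKn : ¬ IsCopy (shift E (ground 𝒟) w z) (r + 1) p K) :
    w ∈ K ∧ z ∉ K ∧ IsCopy (shift E (ground 𝒟) w z) (r + 1) p (insert z (K.erase w)) ∧
      ¬ IsCopy E (r + 1) p (insert z (K.erase w)) :=
  _root_.isCopy_swap (by rintro rfl; exact hz hw) hK
    (fun _ he hc => h.not_subset_of_copy hr hrt hK hKW he hc) hKn

theorem IsState.card_mcop_le_shift (h : IsState E r κ t 𝒟 o) (hr : 1 ≤ r) (hrt : r ≤ t) {p : ℕ}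
    (hw : w ∈ ground 𝒟) (hz : z ∉ ground 𝒟) {Z : Finset V} (hzZ : z ∉ Z) {v : V} (hv : v ≠ w) :
    (mcop E (r + 1) p (ground 𝒟) Z v).card ≤
      (mcop (shift E (ground 𝒟) w z) (r + 1) p (ground 𝒟) Z v).card := by
  set E' := shift E (ground 𝒟) w z with hE'
  refine card_le_card_of_injOn
    (fun K => if IsCopy E' (r + 1) p K then K else insert z (K.erase w)) ?_ ?_
  · intro K hK
    have hK := mem_mcop.1 hK
    change (if IsCopy E' (r + 1) p K then K else insert z (K.erase w)) ∈ _
    split_ifs with hc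
    · exact mem_mcop.2 ⟨hK.1, hc, hK.2.2⟩
    · obtain ⟨h1, h2, h3, h4⟩ := h.isCopy_swap hr hrt hw hz hK.2.1 hK.2.2.1 hc
      refine mem_mcop.2 ⟨mem_insert_of_mem (mem_erase.2 ⟨hv, hK.1⟩), h3,
        fun hs => hz (hs (mem_insert_self _ _)), ?_⟩
      rw [disjoint_insert_left]
      exact ⟨hzZ, hK.2.2.2.mono_left (erase_subset _ _)⟩
  · intro K hK K' hK' heq
    have hK := mem_mcop.1 hK
    have hK' := mem_mcop.1 hK'
    change (if IsCopy E' (r + 1) p K then K else insert z (K.erase w)) =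
      (if IsCopy E' (r + 1) p K' then K' else insert z (K'.erase w)) at heq
    split_ifs at heq with hc hc' hc'
    · exact heq
    · obtain ⟨-, -, -, h4⟩ := h.isCopy_swap hr hrt hw hz hK'.2.1 hK'.2.2.1 hc'
      exact absurd (heq ▸ hK.2.1) h4
    · obtain ⟨-, -, -, h4⟩ := h.isCopy_swap hr hrt hw hz hK.2.1 hK.2.2.1 hc
      exact absurd (heq ▸ hK'.2.1) h4
    · obtain ⟨h1, h2, -, -⟩ := h.isCopy_swap hr hrt hw hz hK.2.1 hK.2.2.1 hc
      obtain ⟨h1', h2', -, -⟩ := h.isCopy_swap hr hrt hw hz hK'.2.1 hK'.2.2.1 hc'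
      exact swap_inj h1 h1' h2 h2' heq

/-- If the compression destroys all the copies at `w`, then they all contribute to `z`. -/
theorem IsState.card_mcop_add_le_shift (h : IsState E r κ t 𝒟 o) (hr : 1 ≤ r) (hrt : r ≤ t)
    {p : ℕ} (hw : w ∈ ground 𝒟) (hz : z ∉ ground 𝒟) {Z : Finset V} (hzZ : z ∉ Z)
    (hdead : mcop (shift E (ground 𝒟) w z) (r + 1) p (ground 𝒟) ∅ w = ∅) :
    (mcop E (r + 1) p (ground 𝒟) Z z).card + (mcop E (r + 1) p (ground 𝒟) Z w).card ≤
      (mcop (shift E (ground 𝒟) w z) (r + 1) p (ground 𝒟) Z z).card := by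
  set E' := shift E (ground 𝒟) w z with hE'
  have hdes : ∀ K ∈ mcop E (r + 1) p (ground 𝒟) Z w, w ∈ K ∧ z ∉ K ∧
      IsCopy E' (r + 1) p (insert z (K.erase w)) ∧
      ¬ IsCopy E (r + 1) p (insert z (K.erase w)) := by
    intro K hK
    have hK := mem_mcop.1 hK
    refine h.isCopy_swap hr hrt hw hz hK.2.1 hK.2.2.1 fun hc => ?_
    have : K ∈ mcop E' (r + 1) p (ground 𝒟) ∅ w :=
      mem_mcop.2 ⟨hK.1, hc, hK.2.2.1, disjoint_empty_right _⟩
    rw [hdead] at this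
    exact notMem_empty _ this
  have hinj : Set.InjOn (fun K : Finset V => insert z (K.erase w))
      (mcop E (r + 1) p (ground 𝒟) Z w) := by
    intro K hK K' hK' heq
    exact swap_inj (hdes K hK).1 (hdes K' hK').1 (hdes K hK).2.1 (hdes K' hK').2.1 heq
  rw [← card_image_of_injOn hinj, ← card_union_of_disjoint]
  · refine card_le_card (union_subset (fun K hK => ?_) fun K hK => ?_)
    · have hK := mem_mcop.1 hK
      refine mem_mcop.2 ⟨hK.1, ?_, hK.2.2⟩
      by_contra hc
      exact (h.isCopy_swap hr hrt hw hz hK.2.1 hK.2.2.1 hc).2.1 hK.1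
    · obtain ⟨K, hKm, rfl⟩ := mem_image.1 hK
      refine mem_mcop.2 ⟨mem_insert_self _ _, (hdes K hKm).2.2.1,
        fun hs => hz (hs (mem_insert_self _ _)), ?_⟩
      rw [disjoint_insert_left]
      exact ⟨hzZ, (mem_mcop.1 hKm).2.2.2.mono_left (erase_subset _ _)⟩
  · rw [disjoint_left]
    intro K hK hK'
    obtain ⟨K', hKm, rfl⟩ := mem_image.1 hK'
    exact (hdes K' hKm).2.2.2 (mem_mcop.1 hK).2.1

theorem IsState.shift (h : IsState E r κ t 𝒟 o) (hr : 1 ≤ r) (hrt : r ≤ t)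
    (hw : w ∈ ground 𝒟) (hz : z ∉ ground 𝒟) : IsState (shift E (ground 𝒟) w z) r κ t 𝒟 o := by
  have hcop : ∀ A ∈ 𝒟, IsCopy (_root_.shift E (ground 𝒟) w z) (r + 1) (t + 1) A := fun A hA =>
    ⟨(h.2.1 A hA).1, fun e he hc =>
      mem_shift_of_subset ((h.2.1 A hA).2 e he hc) (he.trans (subset_ground hA))⟩
  refine ⟨⟨isLGraph_shift h.1.1, fun v => ?_, fun E' h1 h2 => ?_⟩, hcop, h.2.2⟩
  · rw [Nat.add_sub_cancel]
    by_cases hv : v ∈ ground 𝒟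
    · obtain ⟨A, hA, hvA⟩ := mem_biUnion.1 hv
      exact choose_le_copiesAt (hcop A hA) hvA
    · rw [← card_mcop_empty hv]
      exact (h.choose_le_mcop hv).trans (h.card_mcop_le_shift hr hrt hw hz (notMem_empty _)
        (by rintro rfl; exact hv hw))
  · rw [card_shift]
    exact h.1.2.2 E' h1 h2

end Shift

section Numeric

theorem mul_choose_le_choose_add (m q x : ℕ) : x * m.choose q ≤ (m + x).choose (q + 1) := by
  induction x with
  | zero => simp
  | succ x ih =>
    have h1 : (m + x + 1).choose (q + 1) = (m + x).choose q + (m + x).choose (q + 1) :=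
      Nat.choose_succ_succ _ _
    have h2 : m.choose q ≤ (m + x).choose q := Nat.choose_le_choose _ (by omega)
    rw [← add_assoc, h1, add_mul]
    omega

theorem pow_le_choose_mul (q x : ℕ) : x ^ q ≤ (q * x).choose q := by
  induction q with
  | zero => simp
  | succ q ih =>
    calc x ^ (q + 1) = x * x ^ q := by ring
      _ ≤ x * (q * x).choose q := Nat.mul_le_mul_left _ ih
      _ ≤ (q * x + x).choose (q + 1) := mul_choose_le_choose_add _ _ _
      _ = ((q + 1) * x).choose (q + 1) := by ring_nf

theorem pow_le_mul_choose_add_one {r a : ℕ} (hr : 1 ≤ r) :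
    a ^ r ≤ (2 * r) ^ r * ((a - 1).choose r + 1) := by
  rcases le_or_gt a (2 * r) with h | h
  · calc a ^ r ≤ (2 * r) ^ r := Nat.pow_le_pow_left h _
      _ ≤ _ := Nat.le_mul_of_pos_right _ (by omega)
  · have h1 := Nat.div_add_mod (a - 1) r
    have h2 := Nat.mod_lt (a - 1) (show 0 < r by omega)
    set x := (a - 1) / r
    calc a ^ r ≤ (2 * r * x) ^ r := Nat.pow_le_pow_left (by rw [mul_assoc]; omega) _
      _ = (2 * r) ^ r * x ^ r := mul_pow _ _ _
      _ ≤ (2 * r) ^ r * (r * x).choose r := Nat.mul_le_mul_left _ (pow_le_choose_mul _ _)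
      _ ≤ (2 * r) ^ r * ((a - 1).choose r + 1) := Nat.mul_le_mul_left _
        ((Nat.choose_le_choose _ (by omega)).trans (Nat.le_succ _))

/-- The size of a set whose `κ`-subsets suffice to repair a deficiency `d`. -/
theorem exists_repair_size {r κ t a b d : ℕ} (hκ : r < κ) (ha : 1 ≤ a) (hb : 1 ≤ b)
    (hd : d ≤ t.choose κ) : ∃ h ≤ t, d ≤ h.choose κ ∧
      h.choose r * (b * a ^ (κ - r)) ≤
        (κ * b * a) ^ r * (b * a ^ (κ - r)) + (2 * κ) ^ r * d := by
  have hex : ∃ x : ℕ, d ≤ x ^ κ := ⟨d, Nat.le_self_pow (by omega) _⟩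
  obtain ⟨x, hx, hmin⟩ : ∃ x : ℕ, d ≤ x ^ κ ∧ ∀ y < x, y ^ κ < d :=
    ⟨Nat.find hex, Nat.find_spec hex, fun y hy => not_le.1 (Nat.find_min hex hy)⟩
  refine ⟨min (κ * x) t, min_le_right _ _, ?_, ?_⟩
  · rcases min_choice (κ * x) t with h | h <;> rw [h]
    exacts [hx.trans (pow_le_choose_mul _ _), hd]
  have h1 : (min (κ * x) t).choose r ≤ (κ * x) ^ r :=
    (Nat.choose_le_choose _ (min_le_left _ _)).trans (Nat.choose_le_pow _ _)
  refine (Nat.mul_le_mul_right _ h1).trans ?_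
  rcases le_or_gt x (b * a) with h | h
  · refine (Nat.mul_le_mul_right _ (Nat.pow_le_pow_left ?_ r)).trans (Nat.le_add_right _ _)
    rw [mul_assoc]
    exact Nat.mul_le_mul_left _ h
  · refine le_trans ?_ (Nat.le_add_left _ _)
    have hba : 1 ≤ b * a := Nat.mul_pos hb ha
    obtain ⟨y, rfl⟩ : ∃ y, x = y + 1 := ⟨x - 1, by omega⟩
    have h2 := hmin y (by omega)
    have h3 : b * a ^ (κ - r) ≤ y ^ (κ - r) := by
      calc b * a ^ (κ - r) ≤ b ^ (κ - r) * a ^ (κ - r) :=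
            Nat.mul_le_mul_right _ (Nat.le_self_pow (by omega) _)
        _ = (b * a) ^ (κ - r) := (mul_pow _ _ _).symm
        _ ≤ y ^ (κ - r) := Nat.pow_le_pow_left (by omega) _
    calc (κ * (y + 1)) ^ r * (b * a ^ (κ - r)) ≤ (2 * κ * y) ^ r * y ^ (κ - r) := by
          refine Nat.mul_le_mul (Nat.pow_le_pow_left ?_ _) h3
          rw [mul_comm 2, mul_assoc]
          exact Nat.mul_le_mul_left _ (by omega)
      _ = (2 * κ) ^ r * (y ^ r * y ^ (κ - r)) := by rw [mul_pow]; ring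
      _ = (2 * κ) ^ r * y ^ κ := by rw [← pow_add, Nat.add_sub_cancel' hκ.le]
      _ ≤ (2 * κ) ^ r * d := Nat.mul_le_mul_left _ h2.le

end Numeric

section Attack

theorem sum_card_medge_le {V : Type*} {E : Finset (Finset V)} {ℓ : ℕ}
    (hE : IsLGraph ℓ E) (W Z : Finset V) :
    ∑ w ∈ Z, (medge E W w).card ≤
      ℓ * (E.filter fun f => ¬ f ⊆ W ∧ ¬ Disjoint f Z).card := by
  have h1 : ∀ w ∈ Z, medge E W w = bipartiteAbove (fun w (f : Finset V) => w ∈ f)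
      (E.filter fun f => ¬ f ⊆ W ∧ ¬ Disjoint f Z) w := by
    intro w hw
    ext f
    simp only [medge, bipartiteAbove, mem_filter]
    exact ⟨fun h => ⟨⟨h.1, h.2.2, not_disjoint_iff.2 ⟨w, h.2.1, hw⟩⟩, h.2.1⟩,
      fun h => ⟨h.1.1, h.2, h.1.2.1⟩⟩
  rw [sum_congr rfl fun w hw => by rw [h1 w hw],
    sum_card_bipartiteAbove_eq_sum_card_bipartiteBelow, mul_comm]
  refine sum_le_card_nsmul _ _ _ fun f hf => ?_
  rw [← hE f (mem_filter.1 hf).1]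
  exact card_le_card fun w hw => (mem_filter.1 hw).2

variable {V : Type*} [Fintype V] {E : Finset (Finset V)} {r κ t o : ℕ} {𝒟 : Finset (Finset V)}

theorem IsState.card_mcop_le (h : IsState E r κ t 𝒟 o) (hr : 1 ≤ r) (hκ : r < κ) (hrt : r ≤ t)
    {w : V} {m : ℕ} (hm : (medge E (ground 𝒟) w).card ≤ m.choose r) :
    (mcop E (r + 1) (κ + 1) (ground 𝒟) ∅ w).card ≤ m.choose κ := by
  set Γ := medge E (ground 𝒟) w with hΓ
  have hΓE : IsLGraph (r + 1) Γ := fun e he => h.1.1 e (mem_medge.1 he).1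
  have hc : (vlink Γ w).card = Γ.card := by
    rw [card_vlink]
    unfold hdeg
    congr 1
    exact filter_true_of_mem fun e he => (mem_medge.1 he).2.1
  have hle := cliques_card_le (E := vlink Γ w) (m := m) hr hκ.le (isLGraph_vlink hΓE w)
    (by rw [hc]; exact hm)
  refine le_trans (card_le_card_of_injOn (fun K => K.erase w) ?_ ?_) hle
  · intro K hK
    have hK := mem_mcop.1 hK
    refine mem_coe.2 (mem_cliques.2 ⟨?_, fun Q hQ hQc => ?_⟩)
    · rw [card_erase_of_mem hK.1, hK.2.1.1, Nat.add_sub_cancel]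
    · have hwQ : w ∉ Q := fun hw => by simpa using hQ hw
      have hsub : insert w Q ⊆ K := insert_subset hK.1 (hQ.trans (erase_subset _ _))
      have hcard : (insert w Q).card = r + 1 := by rw [card_insert_of_notMem hwQ, hQc]
      exact mem_vlink.2 ⟨hwQ, mem_medge.2 ⟨hK.2.1.2 _ hsub hcard, mem_insert_self _ _,
        h.not_subset_of_copy hr hrt hK.2.1 hK.2.2.1 hsub hcard⟩⟩
  · intro K hK K' hK' heq
    rw [← insert_erase (mem_mcop.1 hK).1, ← insert_erase (mem_mcop.1 hK').1]
    exact congrArg _ heq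

theorem IsState.card_mcop_lt (h : IsState E r κ t 𝒟 o) (hr : 1 ≤ r) (hκ : r < κ) (hrt : r ≤ t)
    (w : V) : (mcop E (r + 1) (κ + 1) (ground 𝒟) ∅ w).card <
      ((medge E (ground 𝒟) w).card + r + 1) ^ κ := by
  set e := (medge E (ground 𝒟) w).card with he
  have h1 := mul_choose_le_choose_add (r - 1) (r - 1) (e + 1)
  rw [Nat.choose_self, show r - 1 + (e + 1) = e + r by omega, show r - 1 + 1 = r by omega] at h1
  calc _ ≤ (e + r).choose κ := h.card_mcop_le hr hκ hrt (by omega)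
    _ ≤ (e + r) ^ κ := Nat.choose_le_pow _ _
    _ < _ := Nat.pow_lt_pow_left (by omega) (by omega)

theorem IsState.pow_le_card_medge (h : IsState E r κ t 𝒟 o) (hr : 1 ≤ r) (hκ : r < κ)
    (hrt : r ≤ t) {w : V} {a : ℕ} (ha : 1 ≤ a)
    (hw : a ^ κ ≤ (mcop E (r + 1) (κ + 1) (ground 𝒟) ∅ w).card) :
    a ^ r ≤ (2 * r) ^ r * (medge E (ground 𝒟) w).card := by
  refine (pow_le_mul_choose_add_one hr).trans (Nat.mul_le_mul_left _ ?_)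
  by_contra hlt
  have h1 := h.card_mcop_le (m := a - 1) (w := w) hr hκ hrt (by omega)
  have h2 := Nat.choose_le_pow (a - 1) κ
  have h3 : (a - 1) ^ κ < a ^ κ := Nat.pow_lt_pow_left (by omega) (by omega)
  omega

/-- The number of copies missing at `u` when those meeting `Z` are discarded. -/
noncomputable def deficit (E : Finset (Finset V)) (r κ t : ℕ) (W Z : Finset V) (u : V) : ℕ :=
  t.choose κ - (mcop E (r + 1) (κ + 1) W Z u).card

/-- The vertices outside `W` with positive deficit. -/
noncomputable def deficient (E : Finset (Finset V)) (r κ t : ℕ) (W Z : Finset V) : Finset V :=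
  univ.filter fun u => u ∉ W ∧ 0 < deficit E r κ t W Z u

theorem mem_deficient {W Z : Finset V} {u : V} :
    u ∈ deficient E r κ t W Z ↔ u ∉ W ∧ 0 < deficit E r κ t W Z u := by
  simp [deficient]

/-- Deleting the edges that meet `Z` and leave the ground set, and repairing the deficient
vertices by joining them to part of a member of the family. -/
theorem IsState.card_filter_le (h : IsState E r κ t 𝒟 o) (hr : 1 ≤ r) (hκ : r < κ) (hrt : r ≤ t)
    (Z : Finset V) (s : V → ℕ) (hs : ∀ u, s u ≤ t)
    (hsd : ∀ u, deficit E r κ t (ground 𝒟) Z u ≤ (s u).choose κ) :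
    (E.filter fun f => ¬ f ⊆ ground 𝒟 ∧ ¬ Disjoint f Z).card ≤
      ∑ u ∈ deficient E r κ t (ground 𝒟) Z, (s u).choose r := by
  set W := ground 𝒟 with hW
  set del := E.filter fun f => ¬ f ⊆ W ∧ ¬ Disjoint f Z with hdel
  obtain ⟨A, hA⟩ := card_pos.1 (two_pos.trans_le h.2.two_le_card)
  have hAc := h.2.1 A hA
  have hAW : A ⊆ W := subset_ground hA
  have hH : ∀ u, ∃ H ⊆ A, H.card = s u := fun u =>
    exists_subset_card_eq (by rw [hAc.1]; exact (hs u).trans (Nat.le_succ _))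
  choose H hHA hHc using hH
  set add : Finset (Finset V) := (deficient E r κ t W Z).biUnion fun u =>
    (powersetCard r (H u)).image (insert u) with hadd
  have haddc : add.card ≤ ∑ u ∈ deficient E r κ t W Z, (s u).choose r := by
    refine card_biUnion_le.trans (sum_le_sum fun u _ => card_image_le.trans ?_)
    rw [card_powersetCard, hHc]
  set E' := (E \ del) ∪ add with hE'
  have hE'L : IsLGraph (r + 1) E' := by
    intro f hf
    rcases mem_union.1 hf with hf | hf
    · exact h.1.1 f (mem_sdiff.1 hf).1
    · obtain ⟨u, hu, hf⟩ := mem_biUnion.1 hf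
      obtain ⟨Q, hQ, rfl⟩ := mem_image.1 hf
      rw [mem_powersetCard] at hQ
      rw [card_insert_of_notMem, hQ.2]
      exact fun huQ => (mem_deficient.1 hu).1 (hAW (hHA u (hQ.1 huQ)))
  have hkeep : ∀ f ∈ E, f ⊆ W ∨ Disjoint f Z → f ∈ E' := by
    intro f hf hor
    refine mem_union_left _ (mem_sdiff.2 ⟨hf, fun hd => ?_⟩)
    have := (mem_filter.1 hd).2
    tauto
  have hkeepc : ∀ K, IsCopy E (r + 1) (κ + 1) K → Disjoint K Z → IsCopy E' (r + 1) (κ + 1) K :=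
    fun K hK hKZ => ⟨hK.1, fun e he hc => hkeep e (hK.2 e he hc) (Or.inr (hKZ.mono_left he))⟩
  have hdeg : DegCond E' (r + 1) (κ + 1) t := by
    intro v
    rw [Nat.add_sub_cancel]
    by_cases hv : v ∈ W
    · obtain ⟨B, hB, hvB⟩ := mem_biUnion.1 hv
      refine choose_le_copiesAt (A := B) ⟨(h.2.1 B hB).1, fun e he hc =>
        hkeep e ((h.2.1 B hB).2 e he hc) (Or.inl (he.trans (subset_ground hB)))⟩ hvB
    rw [← card_mcop_empty hv]
    have hsub : mcop E (r + 1) (κ + 1) W Z v ⊆ mcop E' (r + 1) (κ + 1) W ∅ v := by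
      intro K hK
      have hK := mem_mcop.1 hK
      exact mem_mcop.2 ⟨hK.1, hkeepc K hK.2.1 hK.2.2.2, hK.2.2.1, disjoint_empty_right _⟩
    rcases Nat.eq_zero_or_pos (deficit E r κ t W Z v) with h0 | h0
    · refine le_trans ?_ (card_le_card hsub)
      unfold deficit at h0
      omega
    have hvd : v ∈ deficient E r κ t W Z := mem_deficient.2 ⟨hv, h0⟩
    have hvH : ∀ Q ⊆ H v, v ∉ Q := fun Q hQ hvQ => hv (hAW (hHA v (hQ hvQ)))
    have hnew : (powersetCard κ (H v)).image (insert v) ⊆ mcop E' (r + 1) (κ + 1) W ∅ v := by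
      intro K hK
      obtain ⟨Q, hQ, rfl⟩ := mem_image.1 hK
      rw [mem_powersetCard] at hQ
      refine mem_mcop.2 ⟨mem_insert_self _ _, ⟨?_, fun e he hc => ?_⟩,
        fun hs => hv (hs (mem_insert_self _ _)), disjoint_empty_right _⟩
      · rw [card_insert_of_notMem (hvH Q hQ.1), hQ.2]
      · by_cases hve : v ∈ e
        · refine mem_union_right _ (mem_biUnion.2 ⟨v, hvd, mem_image.2 ⟨e.erase v, ?_,
            insert_erase hve⟩⟩)
          rw [mem_powersetCard, card_erase_of_mem hve, hc]
          exact ⟨(subset_insert_iff.1 he).trans hQ.1, rfl⟩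
        · have heA : e ⊆ A := ((subset_insert_iff_of_notMem hve).1 he).trans
            (hQ.1.trans (hHA v))
          exact hkeep e (hAc.2 e heA hc) (Or.inl (heA.trans hAW))
    have hdisj : Disjoint (mcop E (r + 1) (κ + 1) W Z v)
        ((powersetCard κ (H v)).image (insert v)) := by
      rw [disjoint_left]
      intro K hK hK'
      have hK := mem_mcop.1 hK
      obtain ⟨Q, hQ, rfl⟩ := mem_image.1 hK'
      rw [mem_powersetCard] at hQ
      have h1 := h.card_inter_lt hr hrt hK.2.1 hK.2.2.1
      have h2 : Q ⊆ insert v Q ∩ ground 𝒟 :=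
        subset_inter (subset_insert _ _) (hQ.1.trans ((hHA v).trans hAW))
      have h3 := card_le_card h2
      omega
    have hcount := card_le_card (union_subset hsub hnew)
    rw [card_union_of_disjoint hdisj, card_image_of_injOn, card_powersetCard, hHc] at hcount
    · have := hsd v
      unfold deficit at this
      omega
    · intro Q hQ Q' hQ' heq
      rw [mem_coe, mem_powersetCard] at hQ hQ'
      rw [← erase_insert (hvH Q hQ.1), ← erase_insert (hvH Q' hQ'.1)]
      exact congrArg (fun K => K.erase v) heq
  have hle := h.1.2.2 E' hE'L hdeg
  have h1 : E'.card ≤ (E \ del).card + add.card := card_union_le _ _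
  have h2 := card_sdiff_add_card_eq_card (show del ⊆ E from filter_subset _ _)
  omega

/-- The constant of `IsState.card_le_mul_deficient`. -/
def attackConst (r κ c : ℕ) : ℕ :=
  2 * ((r + 1) * (2 * r) ^ r) * (κ * (2 * ((r + 1) * (2 * r) ^ r) * ((2 * κ) ^ r * c))) ^ r

theorem IsState.card_le_mul_deficient (h : IsState E r κ t 𝒟 o) (hr : 1 ≤ r) (hκ : r < κ)
    (hrt : r ≤ t) {Z : Finset V} {a c : ℕ} (ha : 1 ≤ a) (hc : 1 ≤ c)
    (he : ∀ w ∈ Z, a ^ r ≤ (2 * r) ^ r * (medge E (ground 𝒟) w).card)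
    (hdef : ∑ u ∈ deficient E r κ t (ground 𝒟) Z, deficit E r κ t (ground 𝒟) Z u ≤
      c * Z.card * a ^ κ) :
    Z.card ≤ attackConst r κ c * (deficient E r κ t (ground 𝒟) Z).card := by
  set G := (r + 1) * (2 * r) ^ r with hG
  have hGpos : 1 ≤ G := Nat.mul_pos (by omega) (pow_pos (by omega) _)
  set b := 2 * G * ((2 * κ) ^ r * c) with hb
  have hbpos : 1 ≤ b := Nat.mul_pos (by omega) (Nat.mul_pos (pow_pos (by omega) _) hc)
  set P := deficient E r κ t (ground 𝒟) Z with hP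
  choose s hst hsd hscost using fun u => exists_repair_size (d := deficit E r κ t (ground 𝒟) Z u)
    hκ ha hbpos (Nat.sub_le _ _)
  have h1 := h.card_filter_le hr hκ hrt Z s hst hsd
  have h2 := sum_card_medge_le h.1.1 (ground 𝒟) Z
  have h3 : Z.card * a ^ r ≤ (2 * r) ^ r * ∑ w ∈ Z, (medge E (ground 𝒟) w).card := by
    rw [mul_sum, ← smul_eq_mul]
    exact card_nsmul_le_sum _ _ _ he
  have h4 : Z.card * a ^ r ≤ G * ∑ u ∈ P, (s u).choose r := by
    refine h3.trans ((Nat.mul_le_mul_left _ (h2.trans (Nat.mul_le_mul_left _ h1))).trans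
      (le_of_eq ?_))
    rw [hG]; ring
  have h5 : (∑ u ∈ P, (s u).choose r) * (b * a ^ (κ - r)) ≤
      P.card * ((κ * b * a) ^ r * (b * a ^ (κ - r))) + (2 * κ) ^ r * (c * Z.card * a ^ κ) := by
    rw [sum_mul]
    refine (sum_le_sum fun u _ => hscost u).trans ?_
    rw [sum_add_distrib, sum_const, smul_eq_mul, ← mul_sum]
    exact Nat.add_le_add_left (Nat.mul_le_mul_left _ hdef) _
  have haκ : a ^ r * a ^ (κ - r) = a ^ κ := by rw [← pow_add, Nat.add_sub_cancel' hκ.le]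
  have h6 : b * Z.card * a ^ κ ≤ (G * (P.card * (κ * b) ^ r * b) +
      G * ((2 * κ) ^ r * c) * Z.card) * a ^ κ := by
    calc b * Z.card * a ^ κ = Z.card * a ^ r * (b * a ^ (κ - r)) := by rw [← haκ]; ring
      _ ≤ G * (∑ u ∈ P, (s u).choose r) * (b * a ^ (κ - r)) := Nat.mul_le_mul_right _ h4
      _ = G * ((∑ u ∈ P, (s u).choose r) * (b * a ^ (κ - r))) := by ring
      _ ≤ G * (P.card * ((κ * b * a) ^ r * (b * a ^ (κ - r))) +
          (2 * κ) ^ r * (c * Z.card * a ^ κ)) := Nat.mul_le_mul_left _ h5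
      _ = _ := by rw [mul_pow (κ * b) a r, ← haκ]; ring
  have h7 := Nat.le_of_mul_le_mul_right h6 (pow_pos ha κ)
  have h8 : b * Z.card = 2 * (G * ((2 * κ) ^ r * c) * Z.card) := by rw [hb]; ring
  have h9 : b * Z.card ≤ b * (2 * G * (κ * b) ^ r * P.card) := by
    calc b * Z.card ≤ 2 * (G * (P.card * (κ * b) ^ r * b)) := by omega
      _ = _ := by ring
  exact Nat.le_of_mul_le_mul_left h9 hbpos

end Attack

section Abundance

/-- The sum of the excesses of the degrees over `C(t, ℓ - 1)`. -/
noncomputable def totalExcess {V : Type*} [Fintype V] (E : Finset (Finset V)) (r t : ℕ) : ℕ :=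
  ∑ v, (hdeg E v - t.choose r)

variable {V : Type*} [Fintype V] {E : Finset (Finset V)} {r κ t o : ℕ} {𝒟 : Finset (Finset V)}

theorem IsExtremal.choose_le_hdeg (h : IsExtremal E (r + 1) (κ + 1) t) (hr : 1 ≤ r) (hκ : r < κ)
    (ht : κ ≤ t) (v : V) : t.choose r ≤ hdeg E v :=
  _root_.choose_le_hdeg hr hκ ht h.1 (h.2.1 v)

theorem IsState.card_medge_le (h : IsState E r κ t 𝒟 o) {w : V} (hw : w ∈ ground 𝒟) :
    (medge E (ground 𝒟) w).card ≤ hdeg E w - t.choose r := by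
  obtain ⟨A, hA, hwA⟩ := mem_biUnion.1 hw
  rw [id] at hwA
  have hAc := h.2.1 A hA
  have h1 : (powersetCard r (A.erase w)).image (insert w) ⊆
      (E.filter fun e => w ∈ e) \ medge E (ground 𝒟) w := by
    intro f hf
    obtain ⟨Q, hQ, rfl⟩ := mem_image.1 hf
    rw [mem_powersetCard] at hQ
    have hs : insert w Q ⊆ A := insert_subset hwA (hQ.1.trans (erase_subset _ _))
    have hwQ : w ∉ Q := fun h' => by simpa using hQ.1 h'
    refine mem_sdiff.2 ⟨mem_filter.2 ⟨hAc.2 _ hs ?_, mem_insert_self _ _⟩,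
      fun h' => (mem_medge.1 h').2.2 (hs.trans (subset_ground hA))⟩
    rw [card_insert_of_notMem hwQ, hQ.2]
  have h2 := card_le_card h1
  rw [card_image_of_injOn, card_powersetCard, card_erase_of_mem hwA, hAc.1,
    Nat.add_sub_cancel] at h2
  · have h3 : medge E (ground 𝒟) w ⊆ E.filter fun e => w ∈ e := fun f hf =>
      mem_filter.2 ⟨(mem_medge.1 hf).1, (mem_medge.1 hf).2.1⟩
    have h4 := card_sdiff_add_card_eq_card h3
    unfold hdeg
    omega
  · intro Q hQ Q' hQ' heq
    rw [mem_coe, mem_powersetCard] at hQ hQ'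
    rw [← erase_insert (fun h' => by simpa using hQ.1 h' : w ∉ Q),
      ← erase_insert (fun h' => by simpa using hQ'.1 h' : w ∉ Q')]
    exact congrArg (fun K => K.erase w) heq

theorem IsState.sum_card_medge_le (h : IsState E r κ t 𝒟 o) {J : Finset V} (hJ : J ⊆ ground 𝒟) :
    ∑ w ∈ J, (medge E (ground 𝒟) w).card ≤ totalExcess E r t :=
  (sum_le_sum fun _ hw => h.card_medge_le (hJ hw)).trans
    (sum_le_sum_of_subset (subset_univ J))

theorem card_le_totalExcess_add (hle : ∀ v, hdeg E v ≤ t.choose r → v ∈ ground 𝒟)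
    (hc : ∀ A ∈ 𝒟, A.card = t + 1) :
    Fintype.card V ≤ totalExcess E r t + 𝒟.card * (t + 1) := by
  have h1 : (ground 𝒟)ᶜ.card ≤ totalExcess E r t := by
    rw [card_eq_sum_ones]
    refine (sum_le_sum fun v hv => ?_).trans
      (sum_le_sum_of_subset (f := fun v => hdeg E v - t.choose r) (subset_univ _))
    have : ¬ hdeg E v ≤ t.choose r := fun h' => mem_compl.1 hv (hle v h')
    change 1 ≤ hdeg E v - t.choose r
    omega
  have h2 := card_ground_le hc
  have h3 := card_add_card_compl (ground 𝒟)
  omega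

theorem exists_state (hr : 2 ≤ r) (hκ : r < κ) :
    ∃ C t₀ : ℕ, ∀ t, t₀ ≤ t → ∀ (V : Type) [Fintype V] (E : Finset (Finset V)),
      (t + 1) ^ 2 * (t - 1).choose (r - 1) + 8 * t < 4 * Fintype.card V →
      IsExtremal E (r + 1) (κ + 1) t → (∀ A, ¬ IsIsolatedCopy E (r + 1) t A) →
      (∃ 𝒟 o, GoodFamily E (r + 1) t 𝒟 o) →
      ∃ 𝒟 o J, IsState E r κ t 𝒟 o ∧ J ⊆ ground 𝒟 ∧
        (∀ w ∈ J, (medge E (ground 𝒟) w).Nonempty) ∧ t ^ 3 ≤ C * J.card ∧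
        ∀ E', IsState E' r κ t 𝒟 o → totalExcess E' r t ≤ 6 * (t + 1) * J.card := by
  refine ⟨100 * (r - 1).factorial, 400 * κ + 100, fun t ht V _ E hV hE hiso hex => ?_⟩
  obtain ⟨𝒟, o, hG, hlow⟩ := exists_goodFamily_low_subset (by omega) hκ (by omega) hE hex
  obtain ⟨J, hJ1, -, hJ3, hJ4⟩ := hG.exists_transversal (by omega) (by omega) hE hiso
  set D := (t - 1).choose (r - 1) with hD
  have hDpos : 1 ≤ D := Nat.choose_pos (by omega)
  have hTD : (t + 1) * (t + 1) * D = (t + 1) ^ 2 * D := by ring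
  have hTD1 : t + 1 ≤ (t + 1) * D := Nat.le_mul_of_pos_right _ hDpos
  have hVt : t + 1 < Fintype.card V := by omega
  have hexc : ∀ E', IsExtremal E' (r + 1) (κ + 1) t →
      200 * totalExcess E' r t ≤ 41 * ((t + 1) ^ 2 * D) := fun E' hE' =>
    sum_hdeg_sub_le hr hE' (by omega) hVt (hE'.choose_le_hdeg (by omega) hκ (by omega))
  have h1 := card_le_totalExcess_add hlow fun A hA => (hG.1 A hA).1
  have h2 := hexc E hE
  have h3 : 9 * ((t + 1) * D) ≤ 200 * 𝒟.card := by
    refine Nat.le_of_mul_le_mul_left ?_ (show 0 < t + 1 by omega)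
    have h4 : (t + 1) * (9 * ((t + 1) * D)) = 9 * ((t + 1) ^ 2 * D) := by ring
    have h5 : (t + 1) * (200 * 𝒟.card) = 200 * (𝒟.card * (t + 1)) := by ring
    omega
  have ho := hG.2.2.2
  have hN : (t + 1) * D ≤ 25 * J.card := by omega
  have hJW : J ⊆ ground 𝒟 := fun w hw => by
    obtain ⟨A, hA, hwA⟩ := hJ1 w hw
    exact subset_ground hA hwA
  have hst : IsState E r κ t 𝒟 o := ⟨hE, hG⟩
  refine ⟨𝒟, o, J, hst, hJW, fun w hw => ?_, ?_, fun E' hE' => ?_⟩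
  · obtain ⟨f, hf, hwf, hfW⟩ := hJ3 w hw
    exact ⟨f, mem_medge.2 ⟨hf, hwf, hfW⟩⟩
  · rcases Nat.lt_or_ge 2 r with hr3 | hr3
    · have h4 : (t - 1 + 1 - (r - 1)) ^ (r - 1) ≤ (r - 1).factorial * D := by
        rw [← Nat.descFactorial_eq_factorial_mul_choose]
        exact Nat.pow_sub_le_descFactorial _ _
      have h5 : (t - 1 + 1 - (r - 1)) ^ 2 ≤ (t - 1 + 1 - (r - 1)) ^ (r - 1) :=
        Nat.pow_le_pow_right (by omega) (by omega)
      have h6 : t ^ 2 ≤ 4 * (t - 1 + 1 - (r - 1)) ^ 2 := by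
        rw [show 4 = 2 ^ 2 from rfl, ← mul_pow]
        exact Nat.pow_le_pow_left (by omega) _
      calc t ^ 3 = t * t ^ 2 := by ring
        _ ≤ (t + 1) * (4 * ((r - 1).factorial * D)) := Nat.mul_le_mul (by omega) (by omega)
        _ = 4 * (r - 1).factorial * ((t + 1) * D) := by ring
        _ ≤ 4 * (r - 1).factorial * (25 * J.card) := Nat.mul_le_mul_left _ hN
        _ = _ := by ring
    · obtain ⟨w, hw⟩ := card_pos.1 (show 0 < J.card by omega)
      obtain ⟨f, hf, hwf, hfW⟩ := hJ3 w hw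
      refine absurd ?_ hfW
      have hlt : (f \ ground 𝒟).card < f.card := card_lt_card
        ⟨sdiff_subset, fun h' => (mem_sdiff.1 (h' hwf)).2 (hJW hw)⟩
      have := hE.1 f hf
      obtain ⟨A, hA, hfA⟩ := hst.subset_of_card_le_two (by omega) (by omega) hf (by omega)
      exact hfA.trans (subset_ground hA)
  · have h4 := hexc E' hE'.1
    have h5 : (t + 1) ^ 2 * D = (t + 1) * ((t + 1) * D) := by ring
    have h6 : (t + 1) * ((t + 1) * D) ≤ (t + 1) * (25 * J.card) := Nat.mul_le_mul_left _ hN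
    have h7 : (t + 1) * (25 * J.card) = 25 * ((t + 1) * J.card) := by ring
    have h8 : 6 * (t + 1) * J.card = 6 * ((t + 1) * J.card) := by ring
    omega

end Abundance

section Terminal

variable {V : Type*} [Fintype V] {E : Finset (Finset V)} {r κ t o : ℕ} {𝒟 : Finset (Finset V)}

/-- Two adjacent vertices of a mixed copy lie in a common mixed edge. -/
theorem IsState.exists_medge (h : IsState E r κ t 𝒟 o) (hr : 1 ≤ r) (hκ : r < κ) (hrt : r ≤ t)
    {K : Finset V} (hK : IsCopy E (r + 1) (κ + 1) K) (hKW : ¬ K ⊆ ground 𝒟) {v w : V}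
    (hv : v ∈ K) (hw : w ∈ K) : ∃ f ∈ medge E (ground 𝒟) v, w ∈ f := by
  obtain ⟨f, h1, h2, h3⟩ := exists_subsuperset_card_eq (s := {v, w}) (t := K) (n := r + 1)
    (insert_subset hv (singleton_subset_iff.2 hw)) (card_le_two.trans (by omega))
    (by rw [hK.1]; omega)
  exact ⟨f, mem_medge.2 ⟨hK.2 f h2 h3, h1 (by simp), h.not_subset_of_copy hr hrt hK hKW h2 h3⟩,
    h1 (by simp)⟩

theorem IsState.mcop_eq_of_disjoint (h : IsState E r κ t 𝒟 o) (hr : 1 ≤ r) (hκ : r < κ)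
    (hrt : r ≤ t) {Z : Finset V} {w : V} (hw : ∀ f ∈ medge E (ground 𝒟) w, Disjoint f Z) :
    mcop E (r + 1) (κ + 1) (ground 𝒟) Z w = mcop E (r + 1) (κ + 1) (ground 𝒟) ∅ w := by
  ext K
  rw [mem_mcop, mem_mcop]
  refine ⟨fun hK => ⟨hK.1, hK.2.1, hK.2.2.1, disjoint_empty_right _⟩,
    fun hK => ⟨hK.1, hK.2.1, hK.2.2.1, disjoint_left.2 fun x hx hxZ => ?_⟩⟩
  obtain ⟨f, hf, hxf⟩ := h.exists_medge hr hκ hrt hK.2.1 hK.2.2.1 hK.1 hx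
  exact disjoint_left.1 (hw f hf) hxf hxZ

/-- The vertices sharing an edge that leaves `W` with some vertex of `Z`. -/
noncomputable def mixedNbhd (E : Finset (Finset V)) (W Z : Finset V) : Finset V :=
  univ.filter fun u => ∃ w ∈ Z, ∃ f ∈ medge E W w, u ∈ f

theorem mem_mixedNbhd {W Z : Finset V} {u : V} :
    u ∈ mixedNbhd E W Z ↔ ∃ w ∈ Z, ∃ f ∈ medge E W w, u ∈ f := by
  simp [mixedNbhd]

theorem card_mixedNbhd_le {ℓ m : ℕ} (hE : IsLGraph ℓ E) {W Z : Finset V}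
    (hZ : ∀ w ∈ Z, (medge E W w).card ≤ m) : (mixedNbhd E W Z).card ≤ Z.card * (m * ℓ) := by
  have h1 : mixedNbhd E W Z ⊆ Z.biUnion fun w => (medge E W w).biUnion id := by
    intro u hu
    obtain ⟨w, hw, f, hf, huf⟩ := mem_mixedNbhd.1 hu
    exact mem_biUnion.2 ⟨w, hw, mem_biUnion.2 ⟨f, hf, huf⟩⟩
  refine (card_le_card h1).trans (card_biUnion_le_card_mul _ _ _ fun w hw => ?_)
  refine (card_biUnion_le_card_mul _ _ ℓ fun f hf => ?_).trans (Nat.mul_le_mul_right _ (hZ w hw))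
  exact (hE f (mem_medge.1 hf).1).le

theorem IsState.exists_copy_of_deficient (h : IsState E r κ t 𝒟 o) {Z : Finset V} {u : V}
    (hu : u ∈ deficient E r κ t (ground 𝒟) Z) : ∃ K ∈ mcop E (r + 1) (κ + 1) (ground 𝒟) ∅ u,
      ¬ Disjoint K Z := by
  by_contra hno
  push Not at hno
  obtain ⟨h1, h2⟩ := mem_deficient.1 hu
  have h3 := h.choose_le_mcop h1
  have h4 : mcop E (r + 1) (κ + 1) (ground 𝒟) ∅ u ⊆ mcop E (r + 1) (κ + 1) (ground 𝒟) Z u :=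
    fun K hK => by
      have hK' := mem_mcop.1 hK
      exact mem_mcop.2 ⟨hK'.1, hK'.2.1, hK'.2.2.1, hno K hK⟩
  have h5 := card_le_card h4
  unfold deficit at h2
  omega

theorem IsState.deficient_subset (h : IsState E r κ t 𝒟 o) (hr : 1 ≤ r) (hκ : r < κ)
    (hrt : r ≤ t) (Z : Finset V) :
    deficient E r κ t (ground 𝒟) Z ⊆ mixedNbhd E (ground 𝒟) Z := by
  intro u hu
  obtain ⟨K, hK, hKZ⟩ := h.exists_copy_of_deficient hu
  obtain ⟨w, hwK, hwZ⟩ := not_disjoint_iff.1 hKZ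
  have hK := mem_mcop.1 hK
  exact mem_mixedNbhd.2 ⟨w, hwZ, h.exists_medge hr hκ hrt hK.2.1 hK.2.2.1 hwK hK.1⟩

theorem IsState.sum_deficit_le (h : IsState E r κ t 𝒟 o) {Z : Finset V} {q : ℕ}
    (hq : ∀ w ∈ Z, (mcop E (r + 1) (κ + 1) (ground 𝒟) ∅ w).card ≤ q) :
    ∑ u ∈ deficient E r κ t (ground 𝒟) Z, deficit E r κ t (ground 𝒟) Z u ≤
      (κ + 1) * (Z.card * q) := by
  set W := ground 𝒟 with hW
  set 𝒦 := Z.biUnion fun w => mcop E (r + 1) (κ + 1) W ∅ w with h𝒦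
  have h1 : ∀ u ∈ deficient E r κ t W Z, deficit E r κ t W Z u ≤
      (bipartiteAbove (fun (u : V) (K : Finset V) => u ∈ K) 𝒦 u).card := by
    intro u hu
    have h2 := h.choose_le_mcop (mem_deficient.1 hu).1
    have h3 : mcop E (r + 1) (κ + 1) W ∅ u ⊆ mcop E (r + 1) (κ + 1) W Z u ∪
        bipartiteAbove (fun (u : V) (K : Finset V) => u ∈ K) 𝒦 u := by
      intro K hK
      have hK := mem_mcop.1 hK
      by_cases hKZ : Disjoint K Z
      · exact mem_union_left _ (mem_mcop.2 ⟨hK.1, hK.2.1, hK.2.2.1, hKZ⟩)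
      · obtain ⟨w, hwK, hwZ⟩ := not_disjoint_iff.1 hKZ
        exact mem_union_right _ (mem_filter.2 ⟨mem_biUnion.2 ⟨w, hwZ,
          mem_mcop.2 ⟨hwK, hK.2⟩⟩, hK.1⟩)
    have h4 := (card_le_card h3).trans (card_union_le _ _)
    rw [← hW] at h2
    unfold deficit
    omega
  refine (sum_le_sum h1).trans ?_
  rw [sum_card_bipartiteAbove_eq_sum_card_bipartiteBelow]
  refine (sum_le_card_nsmul _ _ (κ + 1) fun K hK => ?_).trans ?_
  · obtain ⟨w, -, hK⟩ := mem_biUnion.1 hK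
    rw [← (mem_mcop.1 hK).2.1.1]
    exact card_le_card fun u hu => (mem_filter.1 hu).2
  · rw [smul_eq_mul, mul_comm]
    exact Nat.mul_le_mul_left _ (card_biUnion_le_card_mul _ _ _ hq)

/-- The potential controlling the number of vertices of `R` that lose all their mixed copies. -/
noncomputable def potential (E : Finset (Finset V)) (r κ t : ℕ) (W Z R : Finset V) (q : ℕ) : ℕ :=
  (R.filter fun w => mcop E (r + 1) (κ + 1) W ∅ w = ∅).card +
    ∑ u ∈ Wᶜ, (deficit E r κ t W Z u + (q - 1)) / q

theorem IsState.potential_le (h : IsState E r κ t 𝒟 o) {Z R : Finset V} {q c : ℕ} (hq : 1 ≤ q)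
    (hR : ∀ w ∈ R, (mcop E (r + 1) (κ + 1) (ground 𝒟) ∅ w).Nonempty)
    (hZ : ∀ w ∈ Z, (mcop E (r + 1) (κ + 1) (ground 𝒟) ∅ w).card ≤ c * q) :
    potential E r κ t (ground 𝒟) Z R q ≤
      (deficient E r κ t (ground 𝒟) Z).card + (κ + 1) * (Z.card * c) := by
  have h1 : (R.filter fun w => mcop E (r + 1) (κ + 1) (ground 𝒟) ∅ w = ∅) = ∅ :=
    filter_eq_empty_iff.2 fun w hw h' => (hR w hw).ne_empty h'
  unfold potential
  rw [h1, card_empty, zero_add]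
  set P := deficient E r κ t (ground 𝒟) Z with hP
  have h2 : ∑ u ∈ (ground 𝒟)ᶜ, (deficit E r κ t (ground 𝒟) Z u + (q - 1)) / q =
      ∑ u ∈ P, (deficit E r κ t (ground 𝒟) Z u + (q - 1)) / q := by
    refine (sum_subset (fun u hu => mem_compl.2 (mem_deficient.1 hu).1) fun u hu hu' => ?_).symm
    have : deficit E r κ t (ground 𝒟) Z u = 0 := by
      by_contra h0
      exact hu' (mem_deficient.2 ⟨mem_compl.1 hu, by omega⟩)
    rw [this, zero_add]
    exact Nat.div_eq_of_lt (by omega)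
  rw [h2]
  refine Nat.le_of_mul_le_mul_left ?_ (show 0 < q by omega)
  have h3 : q * ∑ u ∈ P, (deficit E r κ t (ground 𝒟) Z u + (q - 1)) / q ≤
      ∑ u ∈ P, (deficit E r κ t (ground 𝒟) Z u + q) := by
    rw [mul_sum]
    exact sum_le_sum fun u _ => (Nat.mul_div_le _ _).trans (by omega)
  have h4 := h.sum_deficit_le hZ
  rw [sum_add_distrib, sum_const, smul_eq_mul] at h3
  refine h3.trans ((Nat.add_le_add_right h4 _).trans (le_of_eq ?_))
  ring

theorem IsState.potential_shift_le (h : IsState E r κ t 𝒟 o) (hr : 1 ≤ r) (hκ : r < κ)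
    (hrt : r ≤ t) {Z R : Finset V} {q : ℕ} (hq : 1 ≤ q) (hZ : Z ⊆ ground 𝒟) {w z : V}
    (hw : w ∈ ground 𝒟) (hwZ : ∀ f ∈ medge E (ground 𝒟) w, Disjoint f Z)
    (hwq : q ≤ (mcop E (r + 1) (κ + 1) (ground 𝒟) ∅ w).card)
    (hz : z ∈ deficient E r κ t (ground 𝒟) Z) :
    potential (_root_.shift E (ground 𝒟) w z) r κ t (ground 𝒟) Z R q ≤
      potential E r κ t (ground 𝒟) Z R q := by
  obtain ⟨hzW, hz0⟩ := mem_deficient.1 hz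
  have hzZ : z ∉ Z := fun h' => hzW (hZ h')
  set E' := _root_.shift E (ground 𝒟) w z with hE'
  have hdefle : ∀ u ∈ (ground 𝒟)ᶜ, (deficit E' r κ t (ground 𝒟) Z u + (q - 1)) / q ≤
      (deficit E r κ t (ground 𝒟) Z u + (q - 1)) / q := by
    intro u hu
    refine Nat.div_le_div_right (Nat.add_le_add_right (Nat.sub_le_sub_left ?_ _) _)
    exact h.card_mcop_le_shift hr hrt hw hzW hzZ (by rintro rfl; exact mem_compl.1 hu hw)
  have hdead : ∀ w' ≠ w, mcop E' (r + 1) (κ + 1) (ground 𝒟) ∅ w' = ∅ →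
      mcop E (r + 1) (κ + 1) (ground 𝒟) ∅ w' = ∅ := by
    intro w' hw' h0
    have := h.card_mcop_le_shift (p := κ + 1) hr hrt hw hzW (notMem_empty z) hw'
    rw [← hE', h0, card_empty] at this
    exact card_eq_zero.1 (by omega)
  unfold potential
  by_cases hdw : mcop E' (r + 1) (κ + 1) (ground 𝒟) ∅ w = ∅
  · have h1 : (R.filter fun w' => mcop E' (r + 1) (κ + 1) (ground 𝒟) ∅ w' = ∅) ⊆
        insert w (R.filter fun w' => mcop E (r + 1) (κ + 1) (ground 𝒟) ∅ w' = ∅) := by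
      intro w' hw'
      rw [mem_filter] at hw'
      by_cases h' : w' = w
      · exact h' ▸ mem_insert_self _ _
      · exact mem_insert_of_mem (mem_filter.2 ⟨hw'.1, hdead w' h' hw'.2⟩)
    have h2 := (card_le_card h1).trans (card_insert_le _ _)
    have h3 : ∑ u ∈ (ground 𝒟)ᶜ, (deficit E' r κ t (ground 𝒟) Z u + (q - 1)) / q <
        ∑ u ∈ (ground 𝒟)ᶜ, (deficit E r κ t (ground 𝒟) Z u + (q - 1)) / q := by
      refine sum_lt_sum hdefle ⟨z, mem_compl.2 hzW, ?_⟩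
      have h4 := h.card_mcop_add_le_shift hr hrt hw hzW hzZ hdw
      rw [h.mcop_eq_of_disjoint hr hκ hrt hwZ, ← hE'] at h4
      have h5 : deficit E' r κ t (ground 𝒟) Z z ≤ deficit E r κ t (ground 𝒟) Z z - q := by
        unfold deficit
        omega
      have h6 : (deficit E' r κ t (ground 𝒟) Z z + (q - 1)) + q ≤
          (deficit E r κ t (ground 𝒟) Z z + (q - 1)) ∨
          deficit E' r κ t (ground 𝒟) Z z = 0 := by omega
      rcases h6 with h6 | h6
      · have := Nat.div_le_div_right (c := q) h6
        rw [Nat.add_div_right _ (by omega)] at this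
        omega
      · rw [h6, zero_add, Nat.div_eq_of_lt (show q - 1 < q by omega)]
        exact Nat.div_pos (by omega) (by omega)
    omega
  · refine Nat.add_le_add (card_le_card fun w' hw' => ?_) (sum_le_sum hdefle)
    rw [mem_filter] at hw' ⊢
    exact ⟨hw'.1, hdead w' (by rintro rfl; exact hdw hw'.2) hw'.2⟩

/-- A state in which every deficient vertex dominates the vertices of `R` with many copies. -/
theorem IsState.exists_terminal (h : IsState E r κ t 𝒟 o) (hr : 1 ≤ r) (hκ : r < κ)
    (hrt : r ≤ t) {Z R : Finset V} {q : ℕ} (hq : 1 ≤ q) (hZ : Z ⊆ ground 𝒟) (hR : R ⊆ ground 𝒟)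
    (hRZ : ∀ w ∈ R, ∀ f ∈ medge E (ground 𝒟) w, Disjoint f Z) :
    ∃ E', IsState E' r κ t 𝒟 o ∧ (∀ f, ¬ Disjoint f Z → (f ∈ E' ↔ f ∈ E)) ∧
      (∀ u ∉ ground 𝒟, deficit E' r κ t (ground 𝒟) Z u ≤ deficit E r κ t (ground 𝒟) Z u) ∧
      potential E' r κ t (ground 𝒟) Z R q ≤ potential E r κ t (ground 𝒟) Z R q ∧
      ∀ z ∈ deficient E' r κ t (ground 𝒟) Z, ∀ w ∈ R,
        q ≤ (mcop E' (r + 1) (κ + 1) (ground 𝒟) ∅ w).card →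
        ∀ f ∈ medge E' (ground 𝒟) w, z ∉ f → insert z (f.erase w) ∈ E' := by
  set 𝒮 : Finset (Finset (Finset V)) := univ.filter fun E' =>
    IsState E' r κ t 𝒟 o ∧ (∀ f, ¬ Disjoint f Z → (f ∈ E' ↔ f ∈ E)) ∧
      (∀ u ∉ ground 𝒟, deficit E' r κ t (ground 𝒟) Z u ≤ deficit E r κ t (ground 𝒟) Z u) ∧
      potential E' r κ t (ground 𝒟) Z R q ≤ potential E r κ t (ground 𝒟) Z R q with h𝒮
  obtain ⟨E', hE', hmin⟩ := exists_min_image 𝒮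
    (fun E' => ∑ w ∈ R, (medge E' (ground 𝒟) w).card)
    ⟨E, mem_filter.2 ⟨mem_univ _, h, fun _ _ => Iff.rfl, fun _ _ => le_rfl, le_rfl⟩⟩
  obtain ⟨-, h1, h2, h3, h4⟩ := mem_filter.1 hE'
  refine ⟨E', h1, h2, h3, h4, fun z hz w hw hwq f hf hzf => ?_⟩
  by_contra hno
  have hfm : f ∈ moved E' (ground 𝒟) w z := by
    have hf := mem_medge.1 hf
    exact mem_moved.2 ⟨hf.1, hf.2.1, hf.2.2, hzf, hno⟩
  obtain ⟨hzW, -⟩ := mem_deficient.1 hz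
  have hwW := hR hw
  have hwz : w ≠ z := by rintro rfl; exact hzW hwW
  have hwZ : ∀ f ∈ medge E' (ground 𝒟) w, Disjoint f Z := by
    intro g hg
    by_contra hgZ
    have hg := mem_medge.1 hg
    exact hgZ (hRZ w hw g (mem_medge.2 ⟨(h2 g hgZ).1 hg.1, hg.2⟩))
  have hmZ : ∀ g ∈ moved E' (ground 𝒟) w z, Disjoint g Z := fun g hg => by
    have hg := mem_moved.1 hg
    exact hwZ g (mem_medge.2 ⟨hg.1, hg.2.1, hg.2.2.1⟩)
  have hmem : _root_.shift E' (ground 𝒟) w z ∈ 𝒮 := by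
    refine mem_filter.2 ⟨mem_univ _, h1.shift hr hrt hwW hzW, fun g hg => ?_, fun u hu => ?_,
      (h1.potential_shift_le hr hκ hrt hq hZ hwW hwZ hwq hz).trans h4⟩
    · rw [← h2 g hg, mem_shift]
      refine ⟨?_, fun h' => Or.inl ⟨h', fun hm => hg (hmZ g hm)⟩⟩
      rintro (h' | ⟨g', hg', rfl⟩)
      · exact h'.1
      · refine absurd ?_ hg
        rw [disjoint_insert_left]
        exact ⟨fun h' => hzW (hZ h'), (hmZ g' hg').mono_left (erase_subset _ _)⟩
    · refine le_trans (Nat.sub_le_sub_left ?_ _) (h3 u hu)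
      exact h1.card_mcop_le_shift hr hrt hwW hzW (fun h' => hzW (hZ h'))
        (by rintro rfl; exact hu hwW)
  refine (hmin _ hmem).not_gt (sum_lt_sum (fun w' hw' => ?_) ⟨w, hw, ?_⟩)
  · exact card_medge_shift_le hzW (hR hw')
  · exact card_medge_shift_lt hwz hfm

end Terminal

section Levels

theorem card_mul_le_card_filter_mul_add {α : Type*} (S : Finset α) (f : α → ℕ) (m : ℕ) :
    S.card * (m + 1) ≤ (S.filter fun w => f w ≤ m).card * (m + 1) + ∑ w ∈ S, f w := by
  have h1 : (S.filter fun w => ¬ f w ≤ m).card * (m + 1) ≤ ∑ w ∈ S, f w := by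
    refine le_trans ?_ (sum_le_sum_of_subset (filter_subset (fun w => ¬ f w ≤ m) S))
    rw [← smul_eq_mul]
    exact card_nsmul_le_sum _ _ _ fun w hw => by
      have := (mem_filter.1 hw).2
      omega
  rw [← card_filter_add_card_filter_not (s := S) (fun w => f w ≤ m), add_mul]
  omega

variable {V : Type*} [Fintype V] {E : Finset (Finset V)} {r κ t o : ℕ} {𝒟 : Finset (Finset V)}

/-- The vertices of `J` with a positive number of mixed copies, but fewer than `2 ^ (κ * i)`. -/
noncomputable def lowLevel (E : Finset (Finset V)) (r κ : ℕ) (W J : Finset V) (i : ℕ) :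
    Finset V :=
  J.filter fun w => (mcop E (r + 1) (κ + 1) W ∅ w).Nonempty ∧
    (mcop E (r + 1) (κ + 1) W ∅ w).card < (2 ^ i) ^ κ

theorem mem_lowLevel {W J : Finset V} {i : ℕ} {w : V} : w ∈ lowLevel E r κ W J i ↔
    w ∈ J ∧ (mcop E (r + 1) (κ + 1) W ∅ w).Nonempty ∧
      (mcop E (r + 1) (κ + 1) W ∅ w).card < (2 ^ i) ^ κ := by
  simp [lowLevel]

theorem lowLevel_zero {W J : Finset V} : lowLevel E r κ W J 0 = ∅ := by
  refine filter_eq_empty_iff.2 fun w _ h => ?_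
  have := card_pos.2 h.1
  rw [pow_zero, one_pow] at h
  omega

theorem IsState.mcop_nonempty (h : IsState E r κ t 𝒟 o) {w : V}
    (hw : (medge E (ground 𝒟) w).Nonempty) :
    (mcop E (r + 1) (κ + 1) (ground 𝒟) ∅ w).Nonempty := by
  obtain ⟨f, hf⟩ := hw
  have hf := mem_medge.1 hf
  obtain ⟨K, hfK, hK⟩ := h.1.exists_copy hf.1
  exact ⟨K, mem_mcop.2 ⟨hfK hf.2.1, hK, fun hs => hf.2.2 (hfK.trans hs),
    disjoint_empty_right _⟩⟩

theorem IsState.exists_level (h : IsState E r κ t 𝒟 o) (hr : 1 ≤ r) (hκ : r < κ) (hrt : r ≤ t)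
    {J : Finset V} {X m L Δ : ℕ} (hJ : ∀ w ∈ J, (medge E (ground 𝒟) w).Nonempty)
    (hX : ∑ w ∈ J, (medge E (ground 𝒟) w).card ≤ X) (hm : 2 * X ≤ J.card * (m + 1))
    (hL : m + r + 1 ≤ 2 ^ L) (hΔ : 2 * (L * Δ) ≤ J.card) :
    ∃ i E₀, IsState E₀ r κ t 𝒟 o ∧ (i + 1) * Δ ≤ (lowLevel E₀ r κ (ground 𝒟) J (i + 1)).card ∧
      ∀ E', IsState E' r κ t 𝒟 o → (lowLevel E' r κ (ground 𝒟) J i).card ≤ i * Δ := by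
  set P : ℕ → Prop := fun i => ∃ E₀, IsState E₀ r κ t 𝒟 o ∧
    (i + 1) * Δ ≤ (lowLevel E₀ r κ (ground 𝒟) J (i + 1)).card with hP
  have hLpos : L ≠ 0 := by
    rintro rfl
    rw [pow_zero] at hL
    omega
  obtain ⟨L, rfl⟩ := Nat.exists_eq_succ_of_ne_zero hLpos
  have hex : ∃ i, P i := by
    refine ⟨L, E, h, ?_⟩
    have h1 := card_mul_le_card_filter_mul_add J (fun w => (medge E (ground 𝒟) w).card) m
    have h2 : J.card ≤ 2 * (J.filter fun w => (medge E (ground 𝒟) w).card ≤ m).card := by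
      refine Nat.le_of_mul_le_mul_right ?_ (show 0 < m + 1 by omega)
      rw [mul_assoc]
      omega
    have h3 : (J.filter fun w => (medge E (ground 𝒟) w).card ≤ m) ⊆
        lowLevel E r κ (ground 𝒟) J (L + 1) := by
      intro w hw
      rw [mem_filter] at hw
      refine mem_lowLevel.2 ⟨hw.1, h.mcop_nonempty (hJ w hw.1), ?_⟩
      refine (h.card_mcop_lt hr hκ hrt w).trans_le (Nat.pow_le_pow_left ?_ _)
      exact le_trans (by omega) hL
    have h4 := card_le_card h3
    have h5 : L.succ * Δ = (L + 1) * Δ := rfl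
    omega
  obtain ⟨E₀, h1, h2⟩ := Nat.find_spec hex
  refine ⟨Nat.find hex, E₀, h1, h2, fun E' hE' => ?_⟩
  rcases Nat.eq_zero_or_pos (Nat.find hex) with h0 | h0
  · rw [h0, lowLevel_zero]
    simp
  · by_contra hlt
    refine Nat.find_min hex (m := Nat.find hex - 1) (by omega) ⟨E', hE', ?_⟩
    rw [Nat.sub_add_cancel h0]
    omega

/-- There is a state in which a set `Y` of vertices dominates many vertices of `J`. -/
theorem IsState.exists_dominating (h : IsState E r κ t 𝒟 o) (hr : 1 ≤ r) (hκ : r < κ)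
    (hrt : r ≤ t) {J : Finset V} {X m L Δ m' s : ℕ} (hJW : J ⊆ ground 𝒟)
    (hJ : ∀ w ∈ J, (medge E (ground 𝒟) w).Nonempty)
    (hX : ∀ E', IsState E' r κ t 𝒟 o → ∑ w ∈ J, (medge E' (ground 𝒟) w).card ≤ X)
    (hm : 2 * X ≤ J.card * (m + 1)) (hL : m + r + 1 ≤ 2 ^ L) (hΔ : 2 * (L * Δ) ≤ J.card)
    (hm' : 2 * X ≤ Δ * (m' + 1))
    (hs : s * ((4 * (r + 1) + 2 * ((κ + 1) * 2 ^ κ)) * (m' + 1)) ≤ Δ) :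
    ∃ (E' : Finset (Finset V)) (Y R : Finset V), IsState E' r κ t 𝒟 o ∧ R ⊆ J ∧ Δ ≤ 2 * R.card ∧
      (∀ w ∈ R, (mcop E' (r + 1) (κ + 1) (ground 𝒟) ∅ w).Nonempty) ∧
      s ≤ attackConst r κ ((κ + 1) * 2 ^ κ) * Y.card ∧
      ∀ z ∈ Y, ∀ w ∈ R, ∀ f ∈ medge E' (ground 𝒟) w, z ∉ f → insert z (f.erase w) ∈ E' := by
  obtain ⟨i, E₀, h₀, hi, hlow⟩ := h.exists_level hr hκ hrt hJ (hX E h) hm hL hΔ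
  set W := ground 𝒟 with hW
  set q := (2 ^ i) ^ κ with hq
  have hqpos : 1 ≤ q := Nat.one_le_pow _ _ (by positivity)
  set J₀ := lowLevel E₀ r κ W J (i + 1) with hJ₀
  set S := J₀ \ lowLevel E₀ r κ W J i with hS
  have hScard : Δ ≤ S.card := by
    have h1 := le_card_sdiff (lowLevel E₀ r κ W J i) J₀
    have h2 := hlow E₀ h₀
    rw [← hS] at h1
    rw [add_mul, one_mul] at hi
    omega
  have hSJ : S ⊆ J := fun w hw => (mem_lowLevel.1 (mem_sdiff.1 hw).1).1
  set S' := S.filter fun w => (medge E₀ W w).card ≤ m' with hS'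
  have hS'card : Δ ≤ 2 * S'.card := by
    have h1 := card_mul_le_card_filter_mul_add S (fun w => (medge E₀ W w).card) m'
    rw [← hS'] at h1
    have h2 := (sum_le_sum_of_subset hSJ).trans (hX E₀ h₀)
    have h3 := Nat.mul_le_mul_right (m' + 1) hScard
    refine Nat.le_of_mul_le_mul_right ?_ (show 0 < m' + 1 by omega)
    rw [mul_assoc]
    omega
  have hsle : s * (2 * (m' * (r + 1))) + s * (2 * (m' * (r + 1))) +
      2 * ((κ + 1) * (s * 2 ^ κ)) + 2 * s ≤ Δ := by
    refine le_trans ?_ hs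
    have h1 : s * ((4 * (r + 1) + 2 * ((κ + 1) * 2 ^ κ)) * (m' + 1)) =
        s * (2 * (m' * (r + 1))) + s * (2 * (m' * (r + 1))) +
          2 * ((κ + 1) * (s * 2 ^ κ)) + 2 * s + (s * (4 * r + 2) +
            s * (2 * ((κ + 1) * 2 ^ κ)) * m') := by ring
    rw [h1]
    exact Nat.le_add_right _ _
  obtain ⟨Z, hZS, hZc⟩ := exists_subset_card_eq (s := S') (n := s) (by omega)
  have hZmem : ∀ w ∈ Z, w ∈ J₀ ∧ q ≤ (mcop E₀ (r + 1) (κ + 1) W ∅ w).card ∧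
      (medge E₀ W w).card ≤ m' := by
    intro w hw
    obtain ⟨h1, h2⟩ := mem_filter.1 (hZS hw)
    obtain ⟨h1, h3⟩ := mem_sdiff.1 h1
    have h4 := mem_lowLevel.1 h1
    refine ⟨h1, ?_, h2⟩
    by_contra hlt
    exact h3 (mem_lowLevel.2 ⟨h4.1, h4.2.1, not_le.1 hlt⟩)
  have hZW : Z ⊆ W := fun w hw => hJW (mem_lowLevel.1 (hZmem w hw).1).1
  set R₀ := J₀.filter fun w => ∀ f ∈ medge E₀ W w, Disjoint f Z with hR₀
  have hR₀J : R₀ ⊆ J := fun w hw => (mem_lowLevel.1 (mem_filter.1 hw).1).1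
  have hB := card_mixedNbhd_le h₀.1.1 fun w hw => (hZmem w hw).2.2
  rw [hZc] at hB
  have hR₀card : J₀.card ≤ R₀.card + (mixedNbhd E₀ W Z).card := by
    refine le_trans (card_le_card fun w hw => ?_) (card_union_le _ _)
    by_cases hd : ∀ f ∈ medge E₀ W w, Disjoint f Z
    · exact mem_union_left _ (mem_filter.2 ⟨hw, hd⟩)
    · push Not at hd
      obtain ⟨f, hf, hfZ⟩ := hd
      obtain ⟨w', hw'f, hw'Z⟩ := not_disjoint_iff.1 hfZ
      have hf := mem_medge.1 hf
      exact mem_union_right _ (mem_mixedNbhd.2 ⟨w', hw'Z, f, mem_medge.2 ⟨hf.1, hw'f, hf.2.2⟩,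
        hf.2.1⟩)
  have hcq : (2 ^ (i + 1)) ^ κ = 2 ^ κ * q := by rw [pow_succ, mul_pow, mul_comm]
  have hZq : ∀ w ∈ Z, (mcop E₀ (r + 1) (κ + 1) W ∅ w).card ≤ 2 ^ κ * q := fun w hw => by
    rw [← hcq]
    exact (mem_lowLevel.1 (hZmem w hw).1).2.2.le
  have hpot := h₀.potential_le (R := R₀) hqpos
    (fun w hw => (mem_lowLevel.1 (mem_filter.1 hw).1).2.1) hZq
  have hdefsub := card_le_card (h₀.deficient_subset hr hκ hrt Z)
  obtain ⟨E', h', hEE', hdef, hpot', hdom⟩ := h₀.exists_terminal hr hκ hrt hqpos hZW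
    (hR₀J.trans hJW) fun w hw => (mem_filter.1 hw).2
  have hmedge : ∀ w ∈ Z, medge E' W w = medge E₀ W w := by
    intro w hw
    ext f
    rw [mem_medge, mem_medge]
    refine and_congr_left fun hf => hEE' f ?_
    exact not_disjoint_iff.2 ⟨w, hf.1, hw⟩
  set R := R₀.filter fun w => q ≤ (mcop E' (r + 1) (κ + 1) W ∅ w).card with hR
  refine ⟨E', deficient E' r κ t W Z, R, h', (filter_subset _ _).trans hR₀J, ?_,
    fun w hw => card_pos.1 (by have := (mem_filter.1 hw).2; omega), ?_,
    fun z hz w hw => hdom z hz w (mem_filter.1 hw).1 (mem_filter.1 hw).2⟩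
  · have h1 : R₀ ⊆ R ∪ ((R₀.filter fun w => mcop E' (r + 1) (κ + 1) W ∅ w = ∅) ∪
        lowLevel E' r κ W J i) := by
      intro w hw
      rcases (mcop E' (r + 1) (κ + 1) W ∅ w).eq_empty_or_nonempty with h0 | h0
      · exact mem_union_right _ (mem_union_left _ (mem_filter.2 ⟨hw, h0⟩))
      · by_cases hc : q ≤ (mcop E' (r + 1) (κ + 1) W ∅ w).card
        · exact mem_union_left _ (mem_filter.2 ⟨hw, hc⟩)
        · exact mem_union_right _ (mem_union_right _
            (mem_lowLevel.2 ⟨hR₀J hw, h0, not_le.1 hc⟩))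
    have h2 := (card_le_card h1).trans ((card_union_le _ _).trans
      (Nat.add_le_add_left (card_union_le _ _) _))
    have h3 := hlow E' h'
    have h4 : (R₀.filter fun w => mcop E' (r + 1) (κ + 1) W ∅ w = ∅).card ≤
        potential E' r κ t W Z R₀ q := Nat.le_add_right _ _
    rw [hZc] at hpot
    rw [← hW] at hpot hpot' hdefsub
    rw [add_mul, one_mul] at hi
    have h5 : s * (2 * (m' * (r + 1))) = 2 * (s * (m' * (r + 1))) := by ring
    omega
  · rw [← hZc]
    refine h'.card_le_mul_deficient (a := 2 ^ i) hr hκ hrt (Nat.one_le_pow _ _ two_pos)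
      (Nat.mul_pos (by omega) (by positivity)) (fun w hw => ?_) ?_
    · rw [hmedge w hw]
      exact h₀.pow_le_card_medge hr hκ hrt (Nat.one_le_pow _ _ two_pos) (hZmem w hw).2.1
    · have h1 := h₀.sum_deficit_le hZq
      have h2 : ∑ u ∈ deficient E' r κ t W Z, deficit E' r κ t W Z u ≤
          ∑ u ∈ deficient E₀ r κ t W Z, deficit E₀ r κ t W Z u := by
        refine (sum_le_sum fun u hu => hdef u (mem_deficient.1 hu).1).trans
          (sum_le_sum_of_subset fun u hu => ?_)
        have h3 := mem_deficient.1 hu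
        exact mem_deficient.2 ⟨h3.1, h3.2.trans_le (hdef u h3.1)⟩
      refine h2.trans (h1.trans (le_of_eq ?_))
      rw [hq]
      ring

end Levels

section Codegree

theorem pow_le_mul_choose {t κ : ℕ} (ht : 2 * κ ≤ t) :
    t ^ κ ≤ 2 ^ κ * κ.factorial * t.choose κ := by
  have h1 : (t + 1 - κ) ^ κ ≤ κ.factorial * t.choose κ := by
    rw [← Nat.descFactorial_eq_factorial_mul_choose]
    exact Nat.pow_sub_le_descFactorial _ _
  calc t ^ κ ≤ (2 * (t + 1 - κ)) ^ κ := Nat.pow_le_pow_left (by omega) _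
    _ = 2 ^ κ * (t + 1 - κ) ^ κ := mul_pow _ _ _
    _ ≤ 2 ^ κ * (κ.factorial * t.choose κ) := Nat.mul_le_mul_left _ h1
    _ = _ := by ring

theorem card_cliques_superset_le {V : Type*} [Fintype V] {Γ : Finset (Finset V)} {r κ j m : ℕ}
    (hκ : r < κ) (hj : j + 1 ≤ r) (hΓ : IsLGraph r Γ) {R₀ : Finset V} {x : V} (hx : x ∉ R₀)
    (hR₀ : R₀.card = j) (hm : (Γ.filter fun f => R₀ ⊆ f).card ≤ m.choose (r - j)) :
    ((cliques Γ r κ).filter fun K => insert x R₀ ⊆ K).card ≤ m.choose (κ - j - 1) := by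
  set Λ := (Γ.filter fun f => R₀ ⊆ f).image fun f => f \ R₀ with hΛ
  have hΛL : IsLGraph (r - j) Λ := by
    intro e he
    obtain ⟨f, hf, rfl⟩ := mem_image.1 he
    obtain ⟨hf, hs⟩ := mem_filter.1 hf
    rw [card_sdiff_of_subset hs, hΓ f hf, hR₀]
  refine le_trans ?_ (cliques_card_le (by omega) (by omega) hΛL (card_image_le.trans hm))
  refine card_le_card_of_injOn (fun K => K \ insert x R₀) (fun K hK => ?_) fun K hK K' hK' h => ?_
  · obtain ⟨hK, hs⟩ := mem_filter.1 hK
    obtain ⟨hKc, hK⟩ := mem_cliques.1 hK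
    refine mem_coe.2 (mem_cliques.2 ⟨?_, fun Q hQ hQc => ?_⟩)
    · rw [card_sdiff_of_subset hs, card_insert_of_notMem hx, hKc, hR₀]
      omega
    · have hd : Disjoint Q R₀ := (disjoint_sdiff.symm.mono_left hQ).mono_right (subset_insert _ _)
      refine mem_image.2 ⟨Q ∪ R₀, mem_filter.2 ⟨hK _ (union_subset (hQ.trans sdiff_subset)
        ((subset_insert _ _).trans hs)) ?_, subset_union_right⟩, ?_⟩
      · rw [card_union_of_disjoint hd, hQc, hR₀]
        omega
      · rw [union_sdiff_right, sdiff_eq_self_of_disjoint hd]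
  · have hs := (mem_filter.1 hK).2
    have hs' := (mem_filter.1 hK').2
    rw [← sdiff_union_of_subset hs, ← sdiff_union_of_subset hs']
    exact congrArg (· ∪ insert x R₀) h

/-- In a hypergraph with about `C(t, r)` edges and at least `C(t, κ)` cliques, the codegrees are
at most of the natural order, up to the excess in the number of edges. -/
theorem exists_codegree_le {r κ : ℕ} (hκ : r < κ) (j : ℕ) (hj : j + 1 ≤ r) :
    ∃ C : ℕ, ∀ t, 2 * κ ≤ t → ∀ (V : Type) [Fintype V] (Γ : Finset (Finset V)), IsLGraph r Γ →
      t.choose κ ≤ (cliques Γ r κ).card → ∀ x ≤ t ^ 2, Γ.card ≤ t.choose r + x →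
      ∀ R : Finset V, R.card = j → (Γ.filter fun f => R ⊆ f).card ≤ x + C * t ^ (r - j) := by
  induction j with
  | zero =>
    refine ⟨1, fun t _ V _ Γ _ _ x _ hc R _ => (card_filter_le _ _).trans (hc.trans ?_)⟩
    have := Nat.choose_le_pow t r
    rw [Nat.sub_zero]
    omega
  | succ j ih =>
    obtain ⟨C, hC⟩ := ih (by omega)
    refine ⟨2 ^ κ * κ.factorial * (r * (C + 1)) ^ (κ - j - 1),
      fun t ht V _ Γ hΓ hcl x hx hc R hR => ?_⟩
    obtain ⟨y, R₀, hy, rfl, hR₀⟩ := card_eq_succ.1 hR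
    have h1 := hC t ht V Γ hΓ hcl x hx hc R₀ hR₀
    have htpos : 0 < t := by omega
    have h2 : x + C * t ^ (r - j) ≤ (r * (C + 1) * t).choose (r - j) := by
      have h3 : t ^ 2 ≤ t ^ (r - j) := Nat.pow_le_pow_right htpos (by omega)
      calc x + C * t ^ (r - j) ≤ (C + 1) * t ^ (r - j) := by rw [add_mul, one_mul]; omega
        _ ≤ (C + 1) ^ (r - j) * t ^ (r - j) :=
          Nat.mul_le_mul_right _ (Nat.le_self_pow (by omega) _)
        _ = ((C + 1) * t) ^ (r - j) := (mul_pow _ _ _).symm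
        _ ≤ ((r - j) * ((C + 1) * t)).choose (r - j) := pow_le_choose_mul _ _
        _ ≤ _ := Nat.choose_le_choose _ (by
          rw [mul_assoc]
          exact Nat.mul_le_mul_right _ (Nat.sub_le _ _))
    have h3 := card_cliques_superset_le hκ (by omega) hΓ hy hR₀ (h1.trans h2)
    set Γ' := Γ.filter fun f => ¬ insert y R₀ ⊆ f with hΓ'
    have h4 : cliques Γ r κ ⊆ cliques Γ' r κ ∪
        (cliques Γ r κ).filter fun K => insert y R₀ ⊆ K := by
      intro K hK
      by_cases hs : insert y R₀ ⊆ K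
      · exact mem_union_right _ (mem_filter.2 ⟨hK, hs⟩)
      · have hK := mem_cliques.1 hK
        exact mem_union_left _ (mem_cliques.2 ⟨hK.1, fun e he hec =>
          mem_filter.2 ⟨hK.2 e he hec, fun h' => hs (h'.trans he)⟩⟩)
    have h5 := (card_le_card h4).trans (card_union_le _ _)
    have h6 := card_filter_add_card_filter_not (s := Γ) (fun f => insert y R₀ ⊆ f)
    rw [← hΓ'] at h6
    rcases Nat.lt_or_ge (t.choose r) Γ'.card with h7 | h7
    · exact le_trans (by omega) (Nat.le_add_right _ _)
    have h8 := cliques_card_mul_le (E := Γ') (q := κ) (m := t) (by omega) hκ.le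
      (fun f hf => hΓ f (mem_filter.1 hf).1) h7
    set lam := (r * (C + 1) * t).choose (κ - j - 1) with hlam
    have h9 : t.choose κ * (t.choose r - Γ'.card) ≤ lam * t.choose r := by
      obtain ⟨a, ha⟩ := Nat.exists_eq_add_of_le h7
      have h10 : t.choose κ * t.choose r ≤ ((cliques Γ' r κ).card + lam) * t.choose r :=
        Nat.mul_le_mul_right _ (by omega)
      have h11 : t.choose κ * t.choose r = Γ'.card * t.choose κ + t.choose κ * a := by
        rw [ha]; ring
      rw [add_mul] at h10
      rw [show t.choose r - Γ'.card = a by omega]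
      omega
    have h10 : t.choose r - Γ'.card ≤
        2 ^ κ * κ.factorial * (r * (C + 1)) ^ (κ - j - 1) * t ^ (r - (j + 1)) := by
      refine Nat.le_of_mul_le_mul_left ?_ (pow_pos htpos κ)
      calc t ^ κ * (t.choose r - Γ'.card)
          ≤ 2 ^ κ * κ.factorial * t.choose κ * (t.choose r - Γ'.card) :=
            Nat.mul_le_mul_right _ (pow_le_mul_choose ht)
        _ = 2 ^ κ * κ.factorial * (t.choose κ * (t.choose r - Γ'.card)) := by ring
        _ ≤ 2 ^ κ * κ.factorial * (lam * t.choose r) := Nat.mul_le_mul_left _ h9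
        _ ≤ 2 ^ κ * κ.factorial * ((r * (C + 1) * t) ^ (κ - j - 1) * t ^ r) :=
            Nat.mul_le_mul_left _
              (Nat.mul_le_mul (Nat.choose_le_pow _ _) (Nat.choose_le_pow _ _))
        _ = 2 ^ κ * κ.factorial * (r * (C + 1)) ^ (κ - j - 1) * t ^ (κ - j - 1 + r) := by
            rw [mul_pow, pow_add]; ring
        _ = t ^ κ * (2 ^ κ * κ.factorial * (r * (C + 1)) ^ (κ - j - 1) * t ^ (r - (j + 1))) := by
            rw [show κ - j - 1 + r = κ + (r - (j + 1)) by omega, pow_add]; ring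
    omega

/-- The codegree of an `r`-set containing a vertex of small degree. -/
theorem exists_codegree_le_of_hdeg_le {r κ : ℕ} (hr : 1 ≤ r) (hκ : r < κ) :
    ∃ C : ℕ, ∀ t, 2 * κ ≤ t → ∀ (V : Type) [Fintype V] (E : Finset (Finset V)),
      IsExtremal E (r + 1) (κ + 1) t → ∀ u, hdeg E u ≤ t.choose r + t ^ 2 →
      ∀ P : Finset V, u ∈ P → P.card = r →
        (E.filter fun f => P ⊆ f).card ≤ hdeg E u - t.choose r + C * t := by
  obtain ⟨C, hC⟩ := exists_codegree_le hκ (r - 1) (by omega)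
  refine ⟨C, fun t ht V _ E hE u hu P huP hP => ?_⟩
  have h1 : t.choose κ ≤ (cliques (vlink E u) r κ).card := by
    have h2 := hE.2.1 u
    rw [Nat.add_sub_cancel, copiesAt_eq] at h2
    exact h2.trans (hdeg_cliques_le_link _ _ _ _)
  have h2 := hC t ht V (vlink E u) (isLGraph_vlink hE.1 u) h1 (hdeg E u - t.choose r) (by omega)
    (by rw [card_vlink]; omega) (P.erase u) (by rw [card_erase_of_mem huP, hP])
  rw [show r - (r - 1) = 1 by omega, pow_one] at h2
  refine le_trans (card_le_card_of_injOn (fun f => f.erase u) (fun f hf => ?_)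
    fun f hf f' hf' h => ?_) h2
  · obtain ⟨hf, hs⟩ := mem_filter.1 hf
    refine mem_coe.2 (mem_filter.2 ⟨mem_vlink.2 ⟨by simp, ?_⟩, erase_subset_erase _ hs⟩)
    rwa [insert_erase (hs huP)]
  · have hs := (mem_filter.1 hf).2
    have hs' := (mem_filter.1 hf').2
    rw [← insert_erase (hs huP), ← insert_erase (hs' huP)]
    exact congrArg (insert u) h

end Codegree

section Final

theorem exists_forall_mul_log_pow_lt (K j : ℕ) :
    ∃ t₀ : ℕ, ∀ t, t₀ ≤ t → K * (Nat.log 2 t + 1) ^ j < t := by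
  have h1 := tendsto_pow_const_div_const_pow_of_one_lt j (r := (2 : ℝ)) (by norm_num)
  have h2 := h1.eventually (gt_mem_nhds (show (0 : ℝ) < 1 / (2 * K + 1) by positivity))
  obtain ⟨n, hn⟩ := Filter.eventually_atTop.1 h2
  refine ⟨2 ^ n, fun t ht => ?_⟩
  have ht0 : t ≠ 0 := (lt_of_lt_of_le (by positivity) ht).ne'
  have hp : n ≤ Nat.log 2 t + 1 :=
    ((Nat.le_log_iff_pow_le one_lt_two ht0).2 ht).trans (Nat.le_succ _)
  have h3 := hn _ hp
  have h4 := Nat.pow_log_le_self 2 ht0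
  set p := Nat.log 2 t
  rw [div_lt_div_iff₀ (by positivity) (by positivity), one_mul] at h3
  have h5 : (p + 1) ^ j * (2 * K + 1) < 2 ^ (p + 1) := by exact_mod_cast h3
  rw [pow_succ 2 p] at h5
  nlinarith [Nat.zero_le ((p + 1) ^ j)]

variable {V : Type*} [Fintype V] {E : Finset (Finset V)} {r κ t o : ℕ} {𝒟 : Finset (Finset V)}

theorem exists_log_class {α : Type*} (S : Finset α) (f : α → ℕ) {b L : ℕ} (hb : 1 < b)
    (hf : ∀ w ∈ S, 1 ≤ f w) (hL : ∀ w ∈ S, f w < b ^ L) :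
    ∃ i, ∃ Z ⊆ S, S.card ≤ L * Z.card ∧ ∀ w ∈ Z, b ^ i ≤ f w ∧ f w ≤ b * b ^ i := by
  rcases Nat.eq_zero_or_pos L with rfl | hLpos
  · refine ⟨0, ∅, empty_subset _, ?_, by simp⟩
    rw [zero_mul, Nat.le_zero, card_eq_zero]
    refine eq_empty_of_forall_notMem fun w hw => ?_
    have := hL w hw
    have := hf w hw
    rw [pow_zero] at *
    omega
  obtain ⟨i, hi, hmax⟩ := exists_max_image (range L)
    (fun i => (S.filter fun w => Nat.log b (f w) = i).card) ⟨0, mem_range.2 hLpos⟩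
  refine ⟨i, S.filter fun w => Nat.log b (f w) = i, filter_subset _ _, ?_, fun w hw => ?_⟩
  · rw [card_eq_sum_card_fiberwise (f := fun w => Nat.log b (f w)) (t := range L)]
    · refine (sum_le_card_nsmul _ _ _ hmax).trans ?_
      rw [card_range, smul_eq_mul]
    · intro w hw
      have := hf w hw
      exact mem_coe.2 (mem_range.2 ((Nat.log_lt_iff_lt_pow hb (by omega)).2 (hL w hw)))
  · obtain ⟨hwS, rfl⟩ := mem_filter.1 hw
    have := hf w hwS
    refine ⟨Nat.pow_log_le_self b (by omega), ?_⟩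
    have h := (Nat.lt_pow_succ_log_self hb (f w)).le
    rwa [Nat.succ_eq_add_one, pow_succ'] at h

theorem IsState.exists_card_le_mul_deficient (h : IsState E r κ t 𝒟 o) (hr : 1 ≤ r) (hκ : r < κ)
    (hrt : r ≤ t) {R : Finset V} {m L : ℕ}
    (hR : ∀ w ∈ R, (mcop E (r + 1) (κ + 1) (ground 𝒟) ∅ w).Nonempty)
    (hm : ∀ w ∈ R, (medge E (ground 𝒟) w).card ≤ m) (hL : m + r + 1 ≤ 2 ^ L) :
    ∃ Z ⊆ R, R.card ≤ L * (attackConst r κ ((κ + 1) * 2 ^ κ) *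
      (deficient E r κ t (ground 𝒟) Z).card) := by
  obtain ⟨i, Z, hZR, hZ, hZi⟩ := exists_log_class R
    (fun w => (mcop E (r + 1) (κ + 1) (ground 𝒟) ∅ w).card) (b := 2 ^ κ) (L := L)
    (Nat.one_lt_two_pow (by omega)) (fun w hw => card_pos.2 (hR w hw)) fun w hw => by
      refine (h.card_mcop_lt hr hκ hrt w).trans_le ?_
      rw [← pow_mul, mul_comm, pow_mul]
      have := hm w hw
      exact Nat.pow_le_pow_left (by omega) _
  refine ⟨Z, hZR, hZ.trans (Nat.mul_le_mul_left _ ?_)⟩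
  have hpow : (2 ^ κ) ^ i = (2 ^ i) ^ κ := by rw [← pow_mul, mul_comm, pow_mul]
  rw [hpow] at hZi
  refine h.card_le_mul_deficient (a := 2 ^ i) hr hκ hrt (Nat.one_le_pow _ _ two_pos)
    (Nat.mul_pos (by omega) (by positivity)) (fun w hw => ?_) ?_
  · exact h.pow_le_card_medge hr hκ hrt (Nat.one_le_pow _ _ two_pos) (hZi w hw).1
  · refine (h.sum_deficit_le fun w hw => (hZi w hw).2).trans (le_of_eq ?_)
    ring

theorem sq_le_mul_excess (hE : IsLGraph (r + 1) E) {W Y R : Finset V} {C D : ℕ} {u : V}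
    (hdom : ∀ z ∈ Y, ∀ w ∈ R, ∀ f ∈ medge E W w, z ∉ f → insert z (f.erase w) ∈ E)
    (hcodeg : hdeg E u ≤ t.choose r + t ^ 2 → ∀ P, u ∈ P → P.card = r →
      (E.filter fun f => P ⊆ f).card ≤ hdeg E u - t.choose r + C * t)
    (hY : t ^ 2 ≤ D * Y.card) (hD : 1 ≤ D) (hDt : 2 * (D * (C * t + r + 1)) ≤ t ^ 2)
    (hRW : R ⊆ W) (huW : u ∉ W) (hu : u ∈ mixedNbhd E W R) :
    t ^ 2 ≤ 2 * (D * (hdeg E u - t.choose r)) := by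
  rcases lt_or_ge (t.choose r + t ^ 2) (hdeg E u) with h | h
  · have h1 : hdeg E u - t.choose r ≤ D * (hdeg E u - t.choose r) :=
      Nat.le_mul_of_pos_left _ hD
    omega
  obtain ⟨w, hw, f, hf, huf⟩ := mem_mixedNbhd.1 hu
  have hfm := mem_medge.1 hf
  have hfc := hE f hfm.1
  have huw : u ≠ w := fun h => huW (h ▸ hRW hw)
  have hP : u ∈ f.erase w := mem_erase.2 ⟨huw, huf⟩
  have hPc : (f.erase w).card = r := by
    rw [card_erase_of_mem hfm.2.1, hfc, Nat.add_sub_cancel]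
  have h1 := hcodeg h _ hP hPc
  have h2 : (Y \ f).card ≤ (E.filter fun g => f.erase w ⊆ g).card := by
    refine card_le_card_of_injOn (fun z => insert z (f.erase w)) (fun z hz => ?_) ?_
    · obtain ⟨hzY, hzf⟩ := mem_sdiff.1 (mem_coe.1 hz)
      exact mem_coe.2 (mem_filter.2 ⟨hdom z hzY w hw f hf hzf, subset_insert _ _⟩)
    · intro z hz z' hz' hzz
      have hzf := (mem_sdiff.1 (mem_coe.1 hz)).2
      have h3 : z ∈ insert z' (f.erase w) := by
        rw [← show insert z (f.erase w) = insert z' (f.erase w) from hzz]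
        exact mem_insert_self _ _
      rcases mem_insert.1 h3 with h3 | h3
      · exact h3
      · exact absurd (mem_of_mem_erase h3) hzf
  have h3 := le_card_sdiff f Y
  have h4 : Y.card ≤ hdeg E u - t.choose r + (C * t + r + 1) := by omega
  have h5 := Nat.mul_le_mul_left D h4
  rw [mul_add] at h5
  omega

theorem IsState.mul_sq_le (h : IsState E r κ t 𝒟 o) (hr : 1 ≤ r) (hκ : r < κ) (hrt : r ≤ t)
    {Y R : Finset V} {C D L X m Δ : ℕ} (hRW : R ⊆ ground 𝒟)
    (hR : ∀ w ∈ R, (mcop E (r + 1) (κ + 1) (ground 𝒟) ∅ w).Nonempty) (hΔ : Δ ≤ 2 * R.card)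
    (hX : totalExcess E r t ≤ X) (hm : 4 * X ≤ Δ * (m + 1)) (hL : m + r + 1 ≤ 2 ^ L)
    (hdom : ∀ z ∈ Y, ∀ w ∈ R, ∀ f ∈ medge E (ground 𝒟) w, z ∉ f → insert z (f.erase w) ∈ E)
    (hcodeg : ∀ u, hdeg E u ≤ t.choose r + t ^ 2 → ∀ P, u ∈ P → P.card = r →
      (E.filter fun f => P ⊆ f).card ≤ hdeg E u - t.choose r + C * t)
    (hY : t ^ 2 ≤ D * Y.card) (hD : 1 ≤ D) (hDt : 2 * (D * (C * t + r + 1)) ≤ t ^ 2) :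
    Δ * t ^ 2 ≤ 8 * L * attackConst r κ ((κ + 1) * 2 ^ κ) * (D * X) := by
  set B := attackConst r κ ((κ + 1) * 2 ^ κ)
  set S := R.filter fun w => (medge E (ground 𝒟) w).card ≤ m with hS
  have hSR : S ⊆ R := filter_subset _ _
  have hΔS : Δ ≤ 4 * S.card := by
    have h1 := card_mul_le_card_filter_mul_add R (fun w => (medge E (ground 𝒟) w).card) m
    rw [← hS] at h1
    have h2 := (h.sum_card_medge_le hRW).trans hX
    have h3 := Nat.mul_le_mul_right (m + 1) hΔ
    refine Nat.le_of_mul_le_mul_right ?_ (show 0 < m + 1 by omega)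
    rw [mul_assoc] at h3 ⊢
    omega
  obtain ⟨Z, hZS, hSZ⟩ := h.exists_card_le_mul_deficient hr hκ hrt (fun w hw => hR w (hSR hw))
    (fun w hw => (mem_filter.1 hw).2) hL
  have hZR := hZS.trans hSR
  have hexcu : ∀ u ∈ deficient E r κ t (ground 𝒟) Z,
      t ^ 2 ≤ 2 * (D * (hdeg E u - t.choose r)) := fun u hu =>
    sq_le_mul_excess h.1.1 (fun z hz w hw => hdom z hz w (hZR hw)) (hcodeg u) hY hD hDt
      (hZR.trans hRW) (mem_deficient.1 hu).1 (h.deficient_subset hr hκ hrt Z hu)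
  have hsum : (deficient E r κ t (ground 𝒟) Z).card * t ^ 2 ≤ 2 * (D * X) := by
    rw [← smul_eq_mul]
    refine (card_nsmul_le_sum _ _ _ hexcu).trans ?_
    rw [← mul_sum, ← mul_sum]
    gcongr
    exact (sum_le_sum_of_subset (subset_univ _)).trans hX
  set d := (deficient E r κ t (ground 𝒟) Z).card
  calc Δ * t ^ 2 ≤ 4 * (L * (B * d)) * t ^ 2 :=
        Nat.mul_le_mul_right _ (hΔS.trans (Nat.mul_le_mul_left _ hSZ))
    _ = 4 * L * B * (d * t ^ 2) := by ring
    _ ≤ 4 * L * B * (2 * (D * X)) := Nat.mul_le_mul_left _ hsum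
    _ = _ := by ring

theorem not_exists_goodFamily (hr : 2 ≤ r) (hκ : r < κ) :
    ∃ t₀ : ℕ, ∀ t, t₀ ≤ t → ∀ (V : Type) [Fintype V] (E : Finset (Finset V)),
      (t + 1) ^ 2 * (t - 1).choose (r - 1) + 8 * t < 4 * Fintype.card V →
      IsExtremal E (r + 1) (κ + 1) t → (∀ A, ¬ IsIsolatedCopy E (r + 1) t A) →
      ¬ ∃ 𝒟 o, GoodFamily E (r + 1) t 𝒟 o := by
  obtain ⟨C₀, T₀, hstate⟩ := exists_state hr hκ
  obtain ⟨C₂, hcodeg⟩ := exists_codegree_le_of_hdeg_le (show 1 ≤ r by omega) hκ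
  set B := attackConst r κ ((κ + 1) * 2 ^ κ) with hB
  set C₁ := 4 * (r + 1) + 2 * ((κ + 1) * 2 ^ κ) with hC₁
  set K := (24 + r) + (400 + r) + 4 * C₀ + 3200 * (C₀ * C₁) +
    12800 * (C₀ * C₁ * B) * (C₂ + r + 1) + 2304 * 6400 * (C₀ * C₁ * B * B) with hK
  obtain ⟨T₁, hT₁⟩ := exists_forall_mul_log_pow_lt K 4
  refine ⟨max (max T₀ T₁) (2 * κ), fun t ht V _ E hV hE hiso hgood => ?_⟩
  have htT₀ : T₀ ≤ t := by omega
  have htκ : 2 * κ ≤ t := by omega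
  have hKt := hT₁ t (by omega)
  have htp : t < 2 ^ (Nat.log 2 t + 1) := Nat.lt_pow_succ_log_self one_lt_two t
  have hp1 : 1 ≤ Nat.log 2 t + 1 := by omega
  generalize Nat.log 2 t + 1 = p at hKt htp hp1
  have hKc : ∀ c j, c ≤ K → j ≤ 4 → c * p ^ j < t := fun c j hc hj =>
    (Nat.mul_le_mul hc (Nat.pow_le_pow_right hp1 hj)).trans_lt hKt
  have ka := hKc (24 + r) 0 (by omega) (by omega)
  have kb := hKc (4 * C₀) 1 (by omega) (by omega)
  have kc := hKc (3200 * (C₀ * C₁)) 2 (by omega) (by omega)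
  have kd := hKc (12800 * (C₀ * C₁ * B) * (C₂ + r + 1)) 2 (by omega) (by omega)
  have ke := hKc (400 + r) 1 (by omega) (by omega)
  have kf := hKc (2304 * 6400 * (C₀ * C₁ * B * B)) 4 (by omega) (by omega)
  clear_value K B C₁
  rw [pow_zero, mul_one] at ka
  rw [pow_one] at kb ke
  obtain ⟨𝒟, o, J, hst, hJW, hJne, hJc, hexc⟩ := hstate t htT₀ V E hV hE hiso hgood
  have hr1 : 1 ≤ r := by omega
  have hrt : r ≤ t := by omega
  have htpos : 0 < t := by omega
  have htt : t ≤ t ^ 2 := Nat.le_self_pow two_ne_zero t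
  have hC₀ : 1 ≤ C₀ := by
    by_contra h0
    have : t ^ 3 ≤ 0 := by simpa [show C₀ = 0 by omega] using hJc
    have := Nat.pow_pos (n := 3) htpos
    omega
  set N := J.card with hN
  have hX : ∀ E', IsState E' r κ t 𝒟 o →
      ∑ w ∈ J, (medge E' (ground 𝒟) w).card ≤ 6 * (t + 1) * N := fun E' hE' =>
    (hE'.sum_card_medge_le hJW).trans (hexc E' hE')
  have hdiv := Nat.div_add_mod N (4 * p)
  have hmod := Nat.mod_lt N (show 0 < 4 * p by omega)
  set Δ := N / (4 * p) with hΔ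
  have hNp : 4 * p ≤ N := by
    refine Nat.le_of_mul_le_mul_left ?_ (show 0 < C₀ by omega)
    have : t ≤ t ^ 3 := Nat.le_self_pow three_ne_zero t
    have : C₀ * (4 * p) = 4 * C₀ * p := by ring
    omega
  have hΔpos : 1 ≤ Δ := (Nat.one_le_div_iff (by omega)).2 hNp
  have hNΔ : N ≤ 8 * (p * Δ) := by
    have h1 := Nat.le_mul_of_pos_right p hΔpos
    rw [mul_assoc] at hdiv
    omega
  have hXΔ : 4 * (6 * (t + 1) * N) ≤ Δ * (400 * t * p) := by
    calc 4 * (6 * (t + 1) * N) ≤ 4 * (6 * (t + t) * (8 * (p * Δ))) := by gcongr; omega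
      _ = Δ * (384 * t * p) := by ring
      _ ≤ _ := by gcongr; omega
  have hm' : 400 * t * p - 1 + 1 = 400 * t * p :=
    Nat.sub_add_cancel (Nat.mul_pos (by omega) (by omega))
  set m' := 400 * t * p - 1 with hm'def
  set q := C₁ * (400 * t * p) with hq
  have hqpos : 0 < q := Nat.mul_pos (by omega) (by omega)
  have hqΔ : q ≤ Δ := by
    refine Nat.le_of_mul_le_mul_left ?_ (show 0 < C₀ * (8 * p) by positivity)
    calc C₀ * (8 * p) * q = 3200 * (C₀ * C₁) * p ^ 2 * t := by rw [hq]; ring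
      _ ≤ t ^ 2 * t := Nat.mul_le_mul_right _ (by omega)
      _ = t ^ 3 := by ring
      _ ≤ C₀ * (8 * (p * Δ)) := hJc.trans (Nat.mul_le_mul_left _ hNΔ)
      _ = _ := by ring
  have hsdiv := Nat.div_add_mod Δ q
  have hsmod := Nat.mod_lt Δ hqpos
  have hspos : 1 ≤ Δ / q := (Nat.one_le_div_iff hqpos).2 hqΔ
  have hsΔ : Δ ≤ 2 * (q * (Δ / q)) := by
    have := Nat.le_mul_of_pos_right q hspos
    omega
  obtain ⟨E', Y, R, hst', hRJ, hΔR, hRne, hsY, hdom⟩ := hst.exists_dominating hr1 hκ hrt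
    (m := 12 * t + 11) (L := 2 * p) (Δ := Δ) (m' := m') (s := Δ / q) hJW hJne hX
    (le_of_eq (by ring))
    (by
      have h1 : t ^ 2 ≤ 2 ^ (2 * p) := by
        rw [mul_comm, pow_mul]
        exact Nat.pow_le_pow_left htp.le 2
      have h2 : 14 * t ≤ t ^ 2 := by
        rw [sq]
        exact Nat.mul_le_mul_right _ (by omega)
      omega)
    (by
      have : 2 * (2 * p * Δ) = 4 * p * Δ := by ring
      omega)
    (by rw [hm']; omega)
    (by
      rw [hm', ← hC₁, ← hq, mul_comm]
      omega)
  rw [← hB] at hsY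
  set D := 6400 * (C₀ * C₁ * B) * p ^ 2 with hD
  have hY : t ^ 2 ≤ D * Y.card := by
    refine Nat.le_of_mul_le_mul_right ?_ htpos
    calc t ^ 2 * t = t ^ 3 := by ring
      _ ≤ C₀ * (8 * (p * (2 * (q * (B * Y.card))))) := by
        refine hJc.trans (Nat.mul_le_mul_left _ (hNΔ.trans ?_))
        gcongr
        exact hsΔ.trans (by gcongr)
      _ = _ := by rw [hq, hD]; ring
  have hDpos : 1 ≤ D := by
    by_contra h0
    rw [show D = 0 by omega, zero_mul] at hY
    omega
  have hDt : 2 * (D * (C₂ * t + r + 1)) ≤ t ^ 2 := by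
    calc 2 * (D * (C₂ * t + r + 1)) ≤ 2 * (D * ((C₂ + r + 1) * t)) := by
          rw [add_assoc C₂, add_mul C₂, add_assoc (C₂ * t)]
          gcongr
          exact Nat.le_mul_of_pos_right _ htpos
      _ = 12800 * (C₀ * C₁ * B) * (C₂ + r + 1) * p ^ 2 * t := by rw [hD]; ring
      _ ≤ t * t := Nat.mul_le_mul_right _ kd.le
      _ = _ := by ring
  have hmain := hst'.mul_sq_le hr1 hκ hrt (L := 3 * p) (hRJ.trans hJW) hRne hΔR (hexc E' hst')
    (by rwa [hm'])
    (by
      have h1 : t ^ 3 ≤ 2 ^ (3 * p) := by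
        rw [mul_comm, pow_mul]
        exact Nat.pow_le_pow_left htp.le 3
      have h2 : (400 + r) * p * t ≤ t * t := Nat.mul_le_mul_right _ ke.le
      have h3 : r ≤ r * p * t := by
        rw [mul_assoc]
        exact Nat.le_mul_of_pos_right _ (by positivity)
      have h4 : t * t ≤ t ^ 3 := by
        rw [← sq]
        exact Nat.pow_le_pow_right htpos (by omega)
      have h5 : (400 + r) * p * t = 400 * t * p + r * p * t := by ring
      omega)
    hdom (hcodeg t htκ V E' hst'.1) hY hDpos hDt
  rw [← hB] at hmain
  refine absurd ?_ (not_le.2 kf)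
  refine Nat.le_of_mul_le_mul_right ?_ (show 0 < t * Δ by positivity)
  calc t * (t * Δ) = Δ * t ^ 2 := by ring
    _ ≤ 8 * (3 * p) * B * (D * (6 * (t + t) * (8 * (p * Δ)))) :=
      hmain.trans (by gcongr; omega)
    _ = _ := by rw [hD]; ring

end Final

/-- In an extremal `ℓ`-graph with no isolated copy of `K_{t+1}^ℓ`, there is at most one
unordered pair of distinct intersecting copies of `K_{t+1}^ℓ` (Lemma 14 of the paper). -/
theorem stmt13 (k ℓ : ℕ) (hkl : ℓ < k) (hl : 2 ≤ ℓ) :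
    ∃ t₀ : ℕ, ∀ t : ℕ, t₀ ≤ t →
      ∀ (V : Type) [DecidableEq V] [Fintype V],
      (((t + 1) ^ 2 * Nat.choose (t - 1) (ℓ - 2) : ℕ) : ℚ) / 4 + 2 * (t : ℚ) <
        (Fintype.card V : ℚ) →
      ∀ E : Finset (Finset V), IsExtremal E ℓ k t →
      (∀ A : Finset V, ¬IsIsolatedCopy E ℓ t A) →
      ∀ A₁ A₂ A₃ A₄ : Finset V,
        A₁ ≠ A₂ → A₃ ≠ A₄ →
        IsCopy E ℓ (t + 1) A₁ → IsCopy E ℓ (t + 1) A₂ →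
        IsCopy E ℓ (t + 1) A₃ → IsCopy E ℓ (t + 1) A₄ →
        (A₁ ∩ A₂).Nonempty → (A₃ ∩ A₄).Nonempty →
        ({A₁, A₂} : Finset (Finset V)) = {A₃, A₄} := by
  obtain ⟨κ, rfl⟩ : ∃ κ, k = κ + 1 := ⟨k - 1, by omega⟩
  obtain ⟨r, rfl⟩ : ∃ r, ℓ = r + 1 := ⟨ℓ - 1, by omega⟩
  obtain ⟨T, hT⟩ : ∃ t₀ : ℕ, ∀ t, t₀ ≤ t → ∀ (V : Type) [Fintype V] (E : Finset (Finset V)),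
      (t + 1) ^ 2 * (t - 1).choose (r - 1) + 8 * t < 4 * Fintype.card V →
      IsExtremal E (r + 1) (κ + 1) t → (∀ A, ¬ IsIsolatedCopy E (r + 1) t A) →
      ¬ ∃ 𝒟 o, GoodFamily E (r + 1) t 𝒟 o := by
    rcases Nat.lt_or_ge r 2 with hr | hr
    · exact ⟨0, fun t _ V _ E _ _ _ ⟨𝒟, o, h⟩ => by
        have := h.2.2.1
        have := h.2.2.2
        omega⟩
    · exact not_exists_goodFamily hr (by omega)
  refine ⟨max T r, fun t ht V dV _ hV E hE hiso A₁ A₂ A₃ A₄ hne₁ hne₃ h₁ h₂ h₃ h₄ hi₁ hi₃ => ?_⟩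
  obtain rfl : dV = fun a b => Classical.propDecidable _ := Subsingleton.elim _ _
  by_contra hne
  refine hT t (by omega) V E ?_ hE hiso
    (exists_goodFamily (by omega) (by omega) hE hne₁ hne₃ h₁ h₂ h₃ h₄ hi₁ hi₃ fun h => hne ?_)
  · rw [show r + 1 - 2 = r - 1 by omega] at hV
    have h : (((t + 1) ^ 2 * (t - 1).choose (r - 1) + 8 * t : ℕ) : ℚ) <
        ((4 * Fintype.card V : ℕ) : ℚ) := by
      push_cast at hV ⊢
      linarith
    exact_mod_cast h
  · convert h
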